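/- Suppose the delayed mass-action system is a DeCBMAS and the network is a combination of ℓ subnetworks each of which is a 2d sub-DeCBMAS. If every nontrivial semilocking set W of the combined network satisfies W ∩ S_c = ∅, then the system is persistent. -/

import Mathlib

open Finset Filter

variable {n r : ℕ}

/-- Mass-action monomial `x^y = ∏ j, x j ^ y j`. -/
def mono (x : Fin n → ℝ) (y : Fin n → ℕ) : ℝ := ∏ j, x j ^ y j

/-- A (bounded-domain) solution of the delayed mass-action system whose reactions are
those in the index set `R` (with reactant complexes `y`, product complexes `y'`,
rate constants `k`, delays `τ`, and maximal delay `τm`):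
nonnegative, continuous on `[-τm, ∞)`, and satisfying the delay differential equation
`x'(t) = ∑ i ∈ R, k i (x(t-τ i)^{y i} • y' i - x(t)^{y i} • y i)` for `t > 0`. -/
def IsSolutionOn (y y' : Fin r → Fin n → ℕ) (k τ : Fin r → ℝ) (τm : ℝ)
    (R : Finset (Fin r)) (x : ℝ → Fin n → ℝ) : Prop :=
  (∀ t ∈ Set.Ici (-τm), ∀ j, 0 ≤ x t j) ∧
  ContinuousOn x (Set.Ici (-τm)) ∧
  ∀ t > (0 : ℝ), HasDerivAt x
    (fun j => ∑ i ∈ R, k i * (mono (x (t - τ i)) (y i) * (y' i j : ℝ)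
      - mono (x t) (y i) * (y i j : ℝ))) t

/-- A solution of the full delayed mass-action system. -/
def IsSolution (y y' : Fin r → Fin n → ℕ) (k τ : Fin r → ℝ) (τm : ℝ)
    (x : ℝ → Fin n → ℝ) : Prop :=
  IsSolutionOn y y' k τ τm Finset.univ x

/-- Positive initial condition: `x` is strictly positive on `[-τm, 0]`. -/
def PosInit (τm : ℝ) (x : ℝ → Fin n → ℝ) : Prop :=
  ∀ t ∈ Set.Icc (-τm) 0, ∀ j, 0 < x t j

/-- The solution is bounded on `[-τm, ∞)`. -/
def BoundedSol (τm : ℝ) (x : ℝ → Fin n → ℝ) : Prop :=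
  ∃ M : ℝ, ∀ t ∈ Set.Ici (-τm), ‖x t‖ ≤ M

/-- The (sub)system consisting of the reactions in `R` is complex balanced:
there is a positive state `xb` at which, for every complex `η`, the inflow and
outflow rates of `η` coincide. -/
def ComplexBalancedOn (y y' : Fin r → Fin n → ℕ) (k : Fin r → ℝ)
    (R : Finset (Fin r)) : Prop :=
  ∃ xb : Fin n → ℝ, (∀ j, 0 < xb j) ∧ ∀ η : Fin n → ℕ,
    ∑ i ∈ R.filter (fun i => y i = η), k i * mono xb (y i)
      = ∑ i ∈ R.filter (fun i => y' i = η), k i * mono xb (y i)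

/-- `W` is a semilocking set for the reactions in `R`. -/
def Semilocking (y y' : Fin r → Fin n → ℕ) (R : Finset (Fin r)) (W : Set (Fin n)) : Prop :=
  W.Nonempty ∧ ∀ i ∈ R, (∃ j ∈ W, y' i j ≠ 0) → ∃ j ∈ W, y i j ≠ 0

/-- Stoichiometric subspace spanned by the reaction vectors of the reactions in `R`. -/
def stoichOn (y y' : Fin r → Fin n → ℕ) (R : Finset (Fin r)) : Submodule ℝ (Fin n → ℝ) :=
  Submodule.span ℝ {v | ∃ i ∈ R, v = fun j => (y' i j : ℝ) - (y i j : ℝ)}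

/-- `W` is vertex-type w.r.t. the subspace `V`: the only `v ∈ V` vanishing on `W` is `0`. -/
def VertexType (V : Submodule ℝ (Fin n → ℝ)) (W : Set (Fin n)) : Prop :=
  ∀ v ∈ V, (∀ j ∈ W, v j = 0) → v = 0

/-- `W` is facet-type w.r.t. the subspace `V`: the projection of `V` onto the
coordinates outside `W` has dimension `dim V - 1`. -/
def FacetType (V : Submodule ℝ (Fin n → ℝ)) (W : Set (Fin n)) : Prop :=
  Module.finrank ℝ
      (V.map (LinearMap.funLeft ℝ ℝ (Subtype.val : {j : Fin n // j ∉ W} → Fin n)))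
    = Module.finrank ℝ V - 1

/-- The network is a combination of subnetworks with species sets `Sp p` and with
reaction `i` assigned to subnetwork `grp i`. -/
def IsCombination {l : ℕ} (y y' : Fin r → Fin n → ℕ) (Sp : Fin l → Set (Fin n))
    (grp : Fin r → Fin l) : Prop :=
  (∀ j, ∃ p, j ∈ Sp p) ∧ ∀ i j, (y i j ≠ 0 ∨ y' i j ≠ 0) → j ∈ Sp (grp i)

/-- The reaction index set of subnetwork `p`. -/
def Rgrp {l : ℕ} (grp : Fin r → Fin l) (p : Fin l) : Finset (Fin r) :=
  Finset.univ.filter (fun i => grp i = p)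

/-- The set `S_c` of intersecting species. -/
def interSpecies {l : ℕ} (Sp : Fin l → Set (Fin n)) : Set (Fin n) :=
  {j | ∃ p q, p ≠ q ∧ j ∈ Sp p ∧ j ∈ Sp q}

/-- `W^{cn}`: species outside `W` lying in some subnetwork `p'` with `W ∩ S^(p') = ∅`. -/
def Wcn {l : ℕ} (Sp : Fin l → Set (Fin n)) (W : Set (Fin n)) : Set (Fin n) :=
  {j | j ∉ W ∧ ∃ p, W ∩ Sp p = ∅ ∧ j ∈ Sp p}

/-- `W^{tf}`: completely unrestricted species outside `W`: they occur in some reaction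
all of whose species lie outside `W`. -/
def Wtf (y y' : Fin r → Fin n → ℕ) (W : Set (Fin n)) : Set (Fin n) :=
  {j | j ∉ W ∧ ∃ i, (y i j ≠ 0 ∨ y' i j ≠ 0) ∧
    ∀ j', (y i j' ≠ 0 ∨ y' i j' ≠ 0) → j' ∉ W}

/-- `W^{tr}`: totally restricted species outside `W`: every stoichiometric vector
vanishing on `W` also vanishes at `j`. -/
def Wtr (y y' : Fin r → Fin n → ℕ) (W : Set (Fin n)) : Set (Fin n) :=
  {j | j ∉ W ∧ ∀ v ∈ stoichOn y y' Finset.univ, (∀ j' ∈ W, v j' = 0) → v j = 0}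

/-- `θ` (a function on `[-τm,0]`) is an ω-limit point of the solution `x`. -/
def OmegaLimitPt (τm : ℝ) (x θ : ℝ → Fin n → ℝ) : Prop :=
  ContinuousOn θ (Set.Icc (-τm) 0) ∧ (∀ s ∈ Set.Icc (-τm) 0, ∀ j, 0 ≤ θ s j) ∧
  ∃ tN : ℕ → ℝ, Tendsto tN atTop atTop ∧
    ∀ ε > (0 : ℝ), ∃ N₀, ∀ N ≥ N₀, ∀ s ∈ Set.Icc (-τm) 0, ‖x (tN N + s) - θ s‖ < ε

/-- `θ` lies on the boundary `L_W`: it vanishes identically on the coordinates of `W`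
and is nowhere zero on the coordinates outside `W`. -/
def OnBoundary (τm : ℝ) (W : Set (Fin n)) (θ : ℝ → Fin n → ℝ) : Prop :=
  (∀ s ∈ Set.Icc (-τm) 0, ∀ j ∈ W, θ s j = 0) ∧
  ∀ s ∈ Set.Icc (-τm) 0, ∀ j ∉ W, θ s j ≠ 0

/-- Persistence of the delayed mass-action system: every bounded solution with
positive initial condition has `liminf_{t→∞} x_j(t) > 0` for every species `j`. -/
def Persistent (y y' : Fin r → Fin n → ℕ) (k τ : Fin r → ℝ) (τm : ℝ) : Prop :=
  ∀ x : ℝ → Fin n → ℝ, IsSolution y y' k τ τm x → PosInit τm x → BoundedSol τm x →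
    ∀ j, 0 < liminf (fun t => x t j) atTop


open Topology

lemma mono_pos' {x : Fin n → ℝ} (hx : ∀ j, 0 < x j) (y : Fin n → ℕ) : 0 < mono x y :=
  Finset.prod_pos fun j _ => pow_pos (hx j) _

lemma mono_nonneg' {x : Fin n → ℝ} (hx : ∀ j, 0 ≤ x j) (y : Fin n → ℕ) : 0 ≤ mono x y :=
  Finset.prod_nonneg fun j _ => pow_nonneg (hx j) _

lemma continuous_mono (y : Fin n → ℕ) : Continuous (fun x : Fin n → ℝ => mono x y) := by
  unfold mono; fun_prop

lemma mono_le_pow {x : Fin n → ℝ} {M : ℝ} (hx : ∀ j, 0 ≤ x j) (hM : ∀ j, x j ≤ M)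
    (y : Fin n → ℕ) : mono x y ≤ M ^ (∑ j, y j) := by
  unfold mono
  rw [← Finset.prod_pow_eq_pow_sum]
  exact Finset.prod_le_prod (fun j _ => pow_nonneg (hx j) _)
    (fun j _ => pow_le_pow_left₀ (hx j) (hM j) _)

lemma pow_le_mono {x : Fin n → ℝ} {c : ℝ} (hc : 0 ≤ c) (hx : ∀ j, c ≤ x j)
    (y : Fin n → ℕ) : c ^ (∑ j, y j) ≤ mono x y := by
  unfold mono
  rw [← Finset.prod_pow_eq_pow_sum]
  exact Finset.prod_le_prod (fun j _ => pow_nonneg hc _)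
    (fun j _ => pow_le_pow_left₀ hc (hx j) _)

lemma mono_le_mul {x : Fin n → ℝ} {M : ℝ} (h1 : 1 ≤ M) (hx : ∀ j, 0 ≤ x j) (hM : ∀ j, x j ≤ M)
    (y : Fin n → ℕ) (j : Fin n) (hj : y j ≠ 0) : mono x y ≤ M ^ (∑ j, y j) * x j := by
  unfold mono
  rw [← Finset.prod_pow_eq_pow_sum, ← Finset.mul_prod_erase _ _ (Finset.mem_univ j),
    ← Finset.mul_prod_erase _ (fun i => M ^ y i) (Finset.mem_univ j)]
  have h2 : ∏ i ∈ univ.erase j, x i ^ y i ≤ ∏ i ∈ univ.erase j, M ^ y i :=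
    Finset.prod_le_prod (fun j _ => pow_nonneg (hx j) _)
      (fun j _ => pow_le_pow_left₀ (hx j) (hM j) _)
  have h3 : x j ^ y j ≤ M ^ y j * x j := by
    obtain ⟨m, hm⟩ := Nat.exists_eq_succ_of_ne_zero hj
    rw [hm, pow_succ]
    have : x j ^ m ≤ M ^ (m+1) := (pow_le_pow_left₀ (hx j) (hM j) _).trans
      (pow_le_pow_right₀ h1 (Nat.le_succ _))
    exact mul_le_mul_of_nonneg_right this (hx j)
  have h4 : 0 ≤ ∏ i ∈ univ.erase j, x i ^ y i :=
    Finset.prod_nonneg fun j _ => pow_nonneg (hx j) _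
  have hM0 : 0 ≤ M := by linarith
  calc _ ≤ (M ^ y j * x j) * ∏ i ∈ univ.erase j, M ^ y i :=
        mul_le_mul h3 h2 h4 (mul_nonneg (pow_nonneg hM0 _) (hx j))
    _ = _ := by ring

lemma log_mono {x : Fin n → ℝ} (hx : ∀ j, 0 < x j) (y : Fin n → ℕ) :
    Real.log (mono x y) = ∑ j, (y j : ℝ) * Real.log (x j) := by
  unfold mono
  rw [Real.log_prod (fun j _ => (pow_pos (hx j) _).ne')]
  simp

lemma mono_eq_zero {x : Fin n → ℝ} {y : Fin n → ℕ} :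
    mono x y = 0 ↔ ∃ j, x j = 0 ∧ y j ≠ 0 := by
  unfold mono
  simp [Finset.prod_eq_zero_iff]

/-- relative entropy function -/
noncomputable def FF (a b : ℝ) : ℝ := a * Real.log a - a * Real.log b - a + b

lemma FF_ge {a b c : ℝ} (ha : 0 < a) (hb : 0 < b) (hc : 0 < c) :
    (1 - c) * b + a * Real.log c ≤ FF a b := by
  unfold FF
  have h := Real.add_one_le_exp (Real.log c + Real.log b - Real.log a)
  rw [Real.exp_sub, Real.exp_add, Real.exp_log hc, Real.exp_log hb, Real.exp_log ha] at h
  rw [le_div_iff₀ ha] at h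
  nlinarith

lemma FF_nonneg {a b : ℝ} (ha : 0 < a) (hb : 0 < b) : 0 ≤ FF a b := by
  simpa using FF_ge ha hb one_pos

lemma FF_sqrt {a b : ℝ} (ha : 0 < a) (hb : 0 < b) : (√a - √b)^2 ≤ FF a b := by
  have hsa := Real.sqrt_pos.2 ha
  have hsb := Real.sqrt_pos.2 hb
  have h := FF_ge ha hb (div_pos hsa hsb)
  have e1 := Real.sq_sqrt ha.le
  have e2 := Real.sq_sqrt hb.le
  have hl : Real.log a = 2 * Real.log (√a) := by rw [Real.log_sqrt ha.le]; ring
  have hlb : Real.log b = 2 * Real.log (√b) := by rw [Real.log_sqrt hb.le]; ring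
  unfold FF
  rw [hl, hlb]
  have h2 := Real.log_le_sub_one_of_pos (div_pos hsb hsa)
  rw [Real.log_div hsb.ne' hsa.ne'] at h2
  have h3 : a * (Real.log (√b) - Real.log (√a)) ≤ √a * √b - a := by
    calc _ ≤ a * (√b / √a - 1) := mul_le_mul_of_nonneg_left h2 ha.le
      _ = √a ^ 2 * (√b / √a - 1) := by rw [e1]
      _ = √a * √b - √a^2 := by field_simp
      _ = _ := by rw [e1]
  nlinarith

lemma FF_sq {a b B : ℝ} (ha : 0 < a) (hb : 0 < b) (hB : a ≤ B) (hB' : b ≤ B) :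
    (a - b)^2 ≤ 4 * B * FF a b := by
  have h := FF_sqrt ha hb
  have e1 := Real.sq_sqrt ha.le
  have e2 := Real.sq_sqrt hb.le
  have : (a-b)^2 = (√a+√b)^2 * (√a-√b)^2 := by
    rw [← mul_pow]
    congr 1; nlinarith
  rw [this]
  have h4 : (√a+√b)^2 ≤ 4 * B := by nlinarith [sq_nonneg (√a-√b)]
  have := FF_nonneg ha hb
  exact mul_le_mul h4 h (sq_nonneg _) (by linarith)

lemma FF_le_sq {a b : ℝ} (ha : 0 < a) (hb : 0 < b) : FF a b ≤ (a - b)^2 / b := by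
  have h2 := Real.log_le_sub_one_of_pos (div_pos ha hb)
  rw [Real.log_div ha.ne' hb.ne'] at h2
  unfold FF
  have h3 : a * (Real.log a - Real.log b) ≤ a * (a / b - 1) := mul_le_mul_of_nonneg_left h2 ha.le
  have : (a-b)^2/b = a * (a / b - 1) - a + b := by field_simp; ring
  linarith

lemma continuous_FF (b : ℝ) : Continuous (fun a => FF a b) := by
  unfold FF
  have := Real.continuous_mul_log
  fun_prop

/-- dissipation bound for reactions out of balance -/
lemma FF_gap {a b c R : ℝ} (ha : 0 < a) (hb : 0 < b) (hR : 0 < R)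
    (h : (1 ≤ R ∧ R * c ≤ b) ∨ (R ≤ 1 ∧ b ≤ R * c)) :
    (R - 1 - Real.log R) * a + (R - 1) * (c - a) ≤ FF a b := by
  have h1 := FF_ge ha hb (inv_pos.2 hR)
  rw [Real.log_inv] at h1
  have h2 : (R - 1) * c ≤ (1 - R⁻¹) * b := by
    have e : (1 - R⁻¹) * b = (R - 1) * (R⁻¹ * b) := by field_simp
    rw [e]
    rcases h with ⟨h3, h4⟩ | ⟨h3, h4⟩
    · apply mul_le_mul_of_nonneg_left _ (by linarith)
      rw [inv_mul_eq_div, le_div_iff₀ hR]; linarith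
    · apply mul_le_mul_of_nonpos_left _ (by linarith)
      rw [inv_mul_eq_div, div_le_iff₀ hR]; linarith
  linarith

lemma gap_pos {R : ℝ} (hR : 0 < R) (h1 : R ≠ 1) : 0 < R - 1 - Real.log R := by
  have := Real.log_lt_sub_one_of_pos hR h1
  linarith
open Topology

/-- window integral -/
noncomputable def Win (τ : ℝ) (G : ℝ → ℝ) (t : ℝ) : ℝ := ∫ s in (t - τ)..t, G s

lemma hasDerivAt_Win {G : ℝ → ℝ} (hG : Continuous G) (τ t : ℝ) :
    HasDerivAt (Win τ G) (G t - G (t - τ)) t := by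
  have h1 : ∀ u, HasDerivAt (fun u => ∫ s in (0:ℝ)..u, G s) (G u) u := fun u =>
    intervalIntegral.integral_hasDerivAt_right (hG.intervalIntegrable _ _)
      (hG.stronglyMeasurableAtFilter _ _) hG.continuousAt
  have h2 : HasDerivAt (fun u => ∫ s in (0:ℝ)..(u-τ), G s) (G (t-τ)) t := by
    have := (h1 (t-τ)).comp t ((hasDerivAt_id t).sub_const τ)
    simpa [Function.comp_def] using this
  have h3 := (h1 t).sub h2
  refine h3.congr_of_eventuallyEq (Eventually.of_forall fun u => ?_)
  simp only [Win, Pi.sub_apply]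
  rw [intervalIntegral.integral_interval_sub_left (hG.intervalIntegrable _ _)
    (hG.intervalIntegrable _ _)]

lemma Win_mono {F G : ℝ → ℝ} (hF : Continuous F) (hG : Continuous G) {τ t : ℝ} (hτ : 0 ≤ τ)
    (h : ∀ s ∈ Set.Icc (t - τ) t, F s ≤ G s) : Win τ F t ≤ Win τ G t :=
  intervalIntegral.integral_mono_on (by linarith) (hF.intervalIntegrable _ _)
    (hG.intervalIntegrable _ _) h

lemma Win_const (τ c t : ℝ) : Win τ (fun _ => c) t = τ * c := by
  simp [Win]

lemma Win_le {G : ℝ → ℝ} (hG : Continuous G) {τ t c : ℝ} (hτ : 0 ≤ τ)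
    (h : ∀ s ∈ Set.Icc (t - τ) t, G s ≤ c) : Win τ G t ≤ τ * c := by
  rw [← Win_const τ c t]; exact Win_mono hG continuous_const hτ h

lemma le_Win {G : ℝ → ℝ} (hG : Continuous G) {τ t c : ℝ} (hτ : 0 ≤ τ)
    (h : ∀ s ∈ Set.Icc (t - τ) t, c ≤ G s) : τ * c ≤ Win τ G t := by
  rw [← Win_const τ c t]; exact Win_mono continuous_const hG hτ h

lemma Win_nonneg {G : ℝ → ℝ} (hG : Continuous G) {τ t : ℝ} (hτ : 0 ≤ τ)
    (h : ∀ s, 0 ≤ G s) : 0 ≤ Win τ G t := by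
  simpa using le_Win (t := t) hG hτ (fun s _ => h s)

lemma Win_sub_abs {G : ℝ → ℝ} (hG : Continuous G) {τ t c e : ℝ} (hτ : 0 ≤ τ)
    (h : ∀ s ∈ Set.Icc (t - τ) t, |G s - c| ≤ e) : |Win τ G t - τ * c| ≤ τ * e := by
  rw [abs_le]
  have h1 := Win_le hG hτ (c := c + e) (fun s hs => by have := abs_le.1 (h s hs); linarith)
  have h2 := le_Win hG hτ (c := c - e) (fun s hs => by have := abs_le.1 (h s hs); linarith)
  constructor <;> nlinarith

lemma continuous_Win {G : ℝ → ℝ} (hG : Continuous G) (τ : ℝ) : Continuous (Win τ G) :=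
  continuous_iff_continuousAt.2 fun t => (hasDerivAt_Win hG τ t).continuousAt

/-- monotonicity on a half-line from derivative sign -/
lemma mono_of_deriv {f f' : ℝ → ℝ} {a : ℝ} (hc : Continuous f)
    (hd : ∀ t > a, HasDerivAt f (f' t) t) (h0 : ∀ t > a, 0 ≤ f' t) :
    MonotoneOn f (Set.Ici a) := by
  apply monotoneOn_of_deriv_nonneg (convex_Ici a) hc.continuousOn
  · intro t ht; rw [interior_Ici] at ht
    exact (hd t ht).differentiableAt.differentiableWithinAt
  · intro t ht; rw [interior_Ici] at ht
    rw [(hd t ht).deriv]; exact h0 t ht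

lemma anti_of_deriv {f f' : ℝ → ℝ} {a : ℝ} (hc : Continuous f)
    (hd : ∀ t > a, HasDerivAt f (f' t) t) (h0 : ∀ t > a, f' t ≤ 0) :
    AntitoneOn f (Set.Ici a) := by
  have := mono_of_deriv hc.neg (fun t ht => (hd t ht).neg) (fun t ht => by linarith [h0 t ht])
  intro s hs t ht hst
  have := this hs ht hst
  simpa using this

lemma mono_of_deriv_Icc {f f' : ℝ → ℝ} {a b : ℝ} (hab : a ≤ b) (hc : Continuous f)
    (hd : ∀ t, a < t → t < b → HasDerivAt f (f' t) t) (h0 : ∀ t, a < t → t < b → 0 ≤ f' t) :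
    f a ≤ f b := by
  have : MonotoneOn f (Set.Icc a b) := by
    apply monotoneOn_of_deriv_nonneg (convex_Icc a b) hc.continuousOn
    · intro t ht; rw [interior_Icc] at ht
      exact (hd t ht.1 ht.2).differentiableAt.differentiableWithinAt
    · intro t ht; rw [interior_Icc] at ht
      rw [(hd t ht.1 ht.2).deriv]; exact h0 t ht.1 ht.2
  exact this ⟨le_rfl, hab⟩ ⟨hab, le_rfl⟩ hab

/-- Gronwall-type lower bound -/
lemma gron_Ici {f f' : ℝ → ℝ} {a C : ℝ} (hc : Continuous f)
    (hd : ∀ t > a, HasDerivAt f (f' t) t) (h0 : ∀ t > a, -C * f t ≤ f' t)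
    {s t : ℝ} (hs : a ≤ s) (hst : s ≤ t) : f s ≤ Real.exp (C * (t - s)) * f t := by
  have h := mono_of_deriv (f := fun t => Real.exp (C * t) * f t) (a := a)
    (f' := fun t => Real.exp (C * t) * C * f t + Real.exp (C * t) * f' t)
    (by fun_prop)
    (fun t ht => by
      have h1 : HasDerivAt (fun t => Real.exp (C * t)) (Real.exp (C * t) * C) t := by
        have := ((hasDerivAt_id t).const_mul C).exp
        simpa using this
      exact h1.mul (hd t ht))
    (fun t ht => by
      have := h0 t ht
      have := Real.exp_pos (C * t)
      nlinarith)
  have := h (Set.mem_Ici.2 hs) (Set.mem_Ici.2 (hs.trans hst)) hst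
  simp only at this
  have e : Real.exp (C * (t - s)) = Real.exp (C * t) * (Real.exp (C * s))⁻¹ := by
    rw [mul_sub, Real.exp_sub]; rfl
  rw [e]
  have hp := Real.exp_pos (C * s)
  rw [mul_right_comm, ← div_eq_mul_inv, le_div_iff₀ hp]
  linarith

/-- bundled bounded positive solution -/
structure Sys (y y' : Fin r → Fin n → ℕ) (k τ : Fin r → ℝ) (τm M : ℝ) (x : ℝ → Fin n → ℝ) :
    Prop where
  hk : ∀ i, 0 < k i
  hτ : ∀ i, 0 ≤ τ i
  hτm : ∀ i, τ i ≤ τm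
  hτm0 : 0 ≤ τm
  cont : Continuous x
  pos : ∀ t j, 0 < x t j
  bd : ∀ t j, x t j ≤ M
  hM : 1 ≤ M
  der : ∀ t > τm, ∀ j, HasDerivAt (fun s => x s j)
    (∑ i, k i * (mono (x (t - τ i)) (y i) * (y' i j : ℝ) - mono (x t) (y i) * (y i j : ℝ))) t

/-- loss constant -/
noncomputable def lossC (y : Fin r → Fin n → ℕ) (k : Fin r → ℝ) (M : ℝ) (j : Fin n) : ℝ :=
  ∑ i, k i * (M ^ (∑ j, y i j) * (y i j : ℝ))

lemma loss_bound {y : Fin r → Fin n → ℕ} {k : Fin r → ℝ} (hk : ∀ i, 0 < k i) {M : ℝ}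
    (hM : 1 ≤ M) {y' : Fin r → Fin n → ℕ} {a : Fin r → ℝ} (ha : ∀ i, 0 ≤ a i)
    {x : Fin n → ℝ} (hx : ∀ j, 0 ≤ x j) (hxM : ∀ j, x j ≤ M) (j : Fin n) :
    -lossC y k M j * x j ≤ ∑ i, k i * (a i * (y' i j : ℝ) - mono x (y i) * (y i j : ℝ)) := by
  unfold lossC
  rw [neg_mul, Finset.sum_mul, ← Finset.sum_neg_distrib]
  apply Finset.sum_le_sum
  intro i _
  have h1 : mono x (y i) * (y i j : ℝ) ≤ M ^ (∑ j, y i j) * x j * (y i j : ℝ) := by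
    by_cases hj : y i j = 0
    · simp [hj]
    · exact mul_le_mul_of_nonneg_right (mono_le_mul hM hx hxM _ j hj) (Nat.cast_nonneg _)
  have h2 : 0 ≤ a i * (y' i j : ℝ) := mul_nonneg (ha i) (Nat.cast_nonneg _)
  have h3 : k i * (-(M ^ (∑ j, y i j) * x j * (y i j : ℝ))) ≤
      k i * (a i * (y' i j : ℝ) - mono x (y i) * (y i j : ℝ)) :=
    mul_le_mul_of_nonneg_left (by linarith) (hk i).le
  linarith

lemma lossC_nonneg {y : Fin r → Fin n → ℕ} {k : Fin r → ℝ} (hk : ∀ i, 0 < k i) {M : ℝ}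
    (hM : 1 ≤ M) (j : Fin n) : 0 ≤ lossC y k M j :=
  Finset.sum_nonneg fun i _ => by have := hk i; positivity

/-- reduction of the original problem -/
lemma Sys.of_solution {y y' : Fin r → Fin n → ℕ} {k τ : Fin r → ℝ} {τm : ℝ}
    (hk : ∀ i, 0 < k i) (hτ : ∀ i, 0 ≤ τ i) (hτm : ∀ i, τ i ≤ τm) (hτm0 : 0 ≤ τm)
    {x : ℝ → Fin n → ℝ} (hx : IsSolution y y' k τ τm x) (hp : PosInit τm x)
    (hb : BoundedSol τm x) : ∃ M, Sys y y' k τ τm M (fun t => x (max t 0)) := by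
  obtain ⟨h0, hc, hd⟩ := hx
  obtain ⟨M, hM⟩ := hb
  have hcont : Continuous (fun t => x (max t 0)) := by
    apply hc.comp_continuous (by fun_prop)
    intro t
    have := le_max_right t 0
    simp only [Set.mem_Ici]; linarith
  have hnn : ∀ t j, 0 ≤ x (max t 0) j := fun t j => by
    apply h0
    have := le_max_right t 0
    simp only [Set.mem_Ici]; linarith
  have hbd : ∀ t j, x (max t 0) j ≤ max M 1 := fun t j => by
    have h1 := hM (max t 0) (by
      have := le_max_right t 0
      simp only [Set.mem_Ici]; linarith)
    have h2 := norm_le_pi_norm (x (max t 0)) j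
    rw [Real.norm_eq_abs] at h2
    exact (le_abs_self _).trans (h2.trans (h1.trans (le_max_left _ _)))
  refine ⟨max M 1, hk, hτ, hτm, hτm0, hcont, ?_, hbd, le_max_right _ _, ?_⟩
  · intro t j
    have hder : ∀ t > 0, HasDerivAt (fun s => x (max s 0) j)
        (∑ i, k i * (mono (x (t - τ i)) (y i) * (y' i j : ℝ)
          - mono (x t) (y i) * (y i j : ℝ))) t := by
      intro t ht
      have := (hasDerivAt_pi.1 (hd t ht)) j
      refine this.congr_of_eventuallyEq ?_
      filter_upwards [lt_mem_nhds ht] with s hs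
      rw [max_eq_left hs.le]
    have hM1 : 1 ≤ max M 1 := le_max_right _ _
    have := gron_Ici (f := fun s => x (max s 0) j) (a := 0) (C := lossC y k (max M 1) j)
      ((continuous_apply j).comp hcont) hder (fun t ht => by
        have e : max t 0 = t := max_eq_left ht.le
        have := loss_bound (y := y) (y' := y') hk hM1 (a := fun i => mono (x (t - τ i)) (y i))
          (fun i => mono_nonneg' (fun j => h0 _ (by
            have := hτm i
            simp only [Set.mem_Ici]; linarith) j) _) (x := x (max t 0)) (hnn t) (hbd t) j
        rw [e] at this ⊢
        exact this) le_rfl (le_max_right t 0)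
    simp only [max_self] at this
    have h3 := hp 0 ⟨by linarith, le_rfl⟩ j
    have e : max (max t 0) 0 = max t 0 := max_eq_left (le_max_right _ _)
    rw [e] at this
    by_contra hneg
    push Not at hneg
    have := mul_nonpos_of_nonneg_of_nonpos (Real.exp_pos
      (lossC y k (max M 1) j * (max t 0 - 0))).le hneg
    linarith
  · intro t ht j
    have ht0 : 0 < t := by linarith
    have := (hasDerivAt_pi.1 (hd t ht0)) j
    have e : max t 0 = t := max_eq_left ht0.le
    have e2 : ∀ i, max (t - τ i) 0 = t - τ i := fun i => max_eq_left (by linarith [hτm i])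
    simp only [e, e2]
    refine this.congr_of_eventuallyEq ?_
    filter_upwards [lt_mem_nhds ht0] with s hs
    rw [max_eq_left hs.le]

section SysLemmas
variable {y y' : Fin r → Fin n → ℕ} {k τ : Fin r → ℝ} {τm M : ℝ} {x : ℝ → Fin n → ℝ}

lemma Sys.contj (S : Sys y y' k τ τm M x) (j : Fin n) : Continuous (fun t => x t j) :=
  (continuous_apply j).comp S.cont

lemma Sys.contg (S : Sys y y' k τ τm M x) (η : Fin n → ℕ) : Continuous (fun t => mono (x t) η) :=
  (continuous_mono η).comp S.cont

lemma Sys.gpos (S : Sys y y' k τ τm M x) (η : Fin n → ℕ) (t : ℝ) : 0 < mono (x t) η :=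
  mono_pos' (S.pos t) η

lemma Sys.harnack (S : Sys y y' k τ τm M x) (j : Fin n) {s t : ℝ} (hs : τm ≤ s) (hst : s ≤ t) :
    x s j ≤ Real.exp (lossC y k M j * (t - s)) * x t j :=
  gron_Ici (S.contj j) (fun t ht => S.der t ht j) (fun t _ =>
    loss_bound (y := y) (y' := y') S.hk S.hM (a := fun i => mono (x (t - τ i)) (y i))
      (fun i => (S.gpos _ _).le) (fun j => (S.pos t j).le) (S.bd t) j) hs hst

lemma Sys.harnack_win (S : Sys y y' k τ τm M x) : ∃ C, 1 ≤ C ∧ ∀ j t s, 2 * τm ≤ t →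
    s ∈ Set.Icc (t - τm) t → x s j ≤ C * x t j := by
  refine ⟨1 + ∑ j, Real.exp (lossC y k M j * τm), ?_, ?_⟩
  · have : 0 ≤ ∑ j, Real.exp (lossC y k M j * τm) := Finset.sum_nonneg fun j _ => (Real.exp_pos _).le
    linarith
  · intro j t s ht hs
    have h1 := S.harnack j (s := s) (t := t) (by linarith [hs.1]) hs.2
    have h2 : Real.exp (lossC y k M j * (t - s)) ≤ Real.exp (lossC y k M j * τm) := by
      apply Real.exp_le_exp.2
      exact mul_le_mul_of_nonneg_left (by linarith [hs.1]) (lossC_nonneg S.hk S.hM j)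
    have h3 : Real.exp (lossC y k M j * τm) ≤ ∑ j, Real.exp (lossC y k M j * τm) :=
      Finset.single_le_sum (f := fun j => Real.exp (lossC y k M j * τm))
        (fun j _ => (Real.exp_pos _).le) (Finset.mem_univ j)
    exact h1.trans (mul_le_mul_of_nonneg_right (by linarith) (S.pos t j).le)

/-- conserved-type quantity -/
noncomputable def XX (y : Fin r → Fin n → ℕ) (k τ : Fin r → ℝ) (x : ℝ → Fin n → ℝ) (t : ℝ)
    (j : Fin n) : ℝ :=
  x t j + ∑ i, k i * (y i j : ℝ) * Win (τ i) (fun s => mono (x s) (y i)) t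

lemma Sys.XX_der (S : Sys y y' k τ τm M x) (j : Fin n) (t : ℝ) (ht : τm < t) :
    HasDerivAt (fun t => XX y k τ x t j)
      (∑ i, k i * mono (x (t - τ i)) (y i) * ((y' i j : ℝ) - (y i j : ℝ))) t := by
  have h1 := S.der t ht j
  have h2 : ∀ i ∈ (univ : Finset (Fin r)), HasDerivAt
      (fun t => k i * (y i j : ℝ) * Win (τ i) (fun s => mono (x s) (y i)) t)
      (k i * (y i j : ℝ) * (mono (x t) (y i) - mono (x (t - τ i)) (y i))) t := fun i _ =>
    (hasDerivAt_Win (S.contg (y i)) (τ i) t).const_mul _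
  have h3 := h1.add (HasDerivAt.fun_sum h2)
  refine (h3.congr_deriv ?_)
  rw [← Finset.sum_add_distrib]
  apply Finset.sum_congr rfl
  intro i _
  ring

lemma Sys.XX_cont (S : Sys y y' k τ τm M x) (j : Fin n) : Continuous (fun t => XX y k τ x t j) := by
  unfold XX
  have := S.contj j
  have h2 : ∀ i, Continuous (Win (τ i) (fun s => mono (x s) (y i))) :=
    fun i => continuous_Win (S.contg _) _
  fun_prop

lemma Sys.le_XX (S : Sys y y' k τ τm M x) (j : Fin n) (t : ℝ) : x t j ≤ XX y k τ x t j := by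
  unfold XX
  have : 0 ≤ ∑ i, k i * (y i j : ℝ) * Win (τ i) (fun s => mono (x s) (y i)) t :=
    Finset.sum_nonneg fun i _ => mul_nonneg (mul_nonneg (S.hk i).le (Nat.cast_nonneg _))
      (Win_nonneg (S.contg _) (S.hτ i) (fun s => (S.gpos _ _).le))
  linarith

/-- a window integral of a monomial involving j is bounded by C x_j -/
lemma Sys.Win_le_mul (S : Sys y y' k τ τm M x) : ∃ C, 0 ≤ C ∧ ∀ i j t, 2 * τm ≤ t →
    y i j ≠ 0 → (∀ s ∈ Set.Icc (t - τ i) t, mono (x s) (y i) ≤ C * x t j) ∧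
      Win (τ i) (fun s => mono (x s) (y i)) t ≤ C * x t j := by
  obtain ⟨C, hC1, hC⟩ := S.harnack_win
  have hM0 : (0:ℝ) ≤ M := by linarith [S.hM]
  have hp : ∀ i, 0 ≤ M ^ (∑ j, y i j) := fun i => by positivity
  have hle : ∀ i, M ^ (∑ j, y i j) ≤ ∑ i, M ^ (∑ j, y i j) := fun i =>
    Finset.single_le_sum (f := fun i => M ^ (∑ j, y i j)) (fun i _ => hp i) (Finset.mem_univ i)
  have hB : 0 ≤ ∑ i, M ^ (∑ j, y i j) := Finset.sum_nonneg fun i _ => hp i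
  set B := ∑ i, M ^ (∑ j, y i j)
  refine ⟨(1 + τm) * (B * C), by have := S.hτm0; positivity, ?_⟩
  intro i j t ht hij
  have h1 : ∀ s ∈ Set.Icc (t - τ i) t, mono (x s) (y i) ≤ B * C * x t j := by
    intro s hs
    have h2 := mono_le_mul S.hM (fun j => (S.pos s j).le) (S.bd s) (y i) j hij
    have h3 := hC j t s ht ⟨by linarith [hs.1, S.hτm i], hs.2⟩
    calc _ ≤ M ^ (∑ j, y i j) * x s j := h2
      _ ≤ B * (C * x t j) := mul_le_mul (hle i) h3 (S.pos s j).le hB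
      _ = _ := by ring
  have hpos : 0 ≤ B * C * x t j := by have := (S.pos t j).le; positivity
  refine ⟨fun s hs => (h1 s hs).trans ?_, ?_⟩
  · have := mul_nonneg S.hτm0 hpos
    nlinarith
  · refine (Win_le (S.contg _) (S.hτ i) h1).trans ?_
    have := mul_le_mul_of_nonneg_right (S.hτm i) hpos
    nlinarith

lemma Sys.XX_le (S : Sys y y' k τ τm M x) : ∃ C, 1 ≤ C ∧ ∀ j t, 2 * τm ≤ t →
    XX y k τ x t j ≤ C * x t j := by
  obtain ⟨C, hC0, hC⟩ := S.Win_le_mul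
  have hb : ∀ i j, 0 ≤ k i * (y i j : ℝ) := fun i j => mul_nonneg (S.hk i).le (Nat.cast_nonneg _)
  refine ⟨1 + ∑ j, ∑ i, k i * (y i j : ℝ) * C, ?_, ?_⟩
  · have : 0 ≤ ∑ j, ∑ i, k i * (y i j : ℝ) * C := Finset.sum_nonneg fun j _ =>
      Finset.sum_nonneg fun i _ => mul_nonneg (hb i j) hC0
    linarith
  · intro j t ht
    unfold XX
    have h1 : ∑ i, k i * (y i j : ℝ) * Win (τ i) (fun s => mono (x s) (y i)) t ≤
        (∑ i, k i * (y i j : ℝ) * C) * x t j := by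
      rw [Finset.sum_mul]
      apply Finset.sum_le_sum
      intro i _
      by_cases hij : y i j = 0
      · simp [hij]
      · rw [mul_assoc (k i * (y i j : ℝ))]
        exact mul_le_mul_of_nonneg_left (hC i j t ht hij).2 (hb i j)
    have h2 : ∑ i, k i * (y i j : ℝ) * C ≤ ∑ j, ∑ i, k i * (y i j : ℝ) * C :=
      Finset.single_le_sum (f := fun j => ∑ i, k i * (y i j : ℝ) * C)
        (fun j _ => Finset.sum_nonneg fun i _ => mul_nonneg (hb i j) hC0) (Finset.mem_univ j)
    have h3 := mul_le_mul_of_nonneg_right h2 (S.pos t j).le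
    linarith

end SysLemmas
open Topology

/-- functional form of complex balance -/
def CBf (y y' : Fin r → Fin n → ℕ) (k : Fin r → ℝ) (xh : Fin n → ℝ) : Prop :=
  ∀ f : (Fin n → ℕ) → ℝ, ∑ i, k i * mono xh (y i) * (f (y' i) - f (y i)) = 0

lemma CBf_of {y y' : Fin r → Fin n → ℕ} {k : Fin r → ℝ} {xb : Fin n → ℝ}
    (h : ∀ η : Fin n → ℕ,
    ∑ i ∈ (univ : Finset (Fin r)).filter (fun i => y i = η), k i * mono xb (y i)
      = ∑ i ∈ (univ : Finset (Fin r)).filter (fun i => y' i = η), k i * mono xb (y i)) :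
    CBf y y' k xb := by
  classical
  intro f
  simp only [mul_sub, Finset.sum_sub_distrib, sub_eq_zero]
  set E : Finset (Fin n → ℕ) := univ.image y ∪ univ.image y'
  have h1 : ∀ z : Fin r → Fin n → ℕ, (∀ i, z i ∈ E) → ∑ i, k i * mono xb (y i) * f (z i) =
      ∑ η ∈ E, (∑ i ∈ (univ : Finset (Fin r)).filter (fun i => z i = η), k i * mono xb (y i)) * f η := by
    intro z hz
    rw [← Finset.sum_fiberwise_of_maps_to (s := univ) (t := E) (g := z) (fun i _ => hz i)]
    apply Finset.sum_congr rfl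
    intro η _
    rw [Finset.sum_mul]
    apply Finset.sum_congr rfl
    intro i hi
    rw [(Finset.mem_filter.1 hi).2]
  rw [h1 y' (fun i => by simp [E]), h1 y (fun i => by simp [E])]
  apply Finset.sum_congr rfl
  intro η _
  rw [h η]

/-- a positive point balanced reactionwise relative to a CB point is CB -/
lemma CBf_trans {y y' : Fin r → Fin n → ℕ} {k : Fin r → ℝ} {xb z : Fin n → ℝ}
    (hb : ∀ j, 0 < xb j) (h : CBf y y' k xb)
    (hz : ∀ i, mono z (y i) / mono xb (y i) = mono z (y' i) / mono xb (y' i)) :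
    CBf y y' k z := by
  intro f
  have := h (fun η => mono z η / mono xb η * f η)
  rw [← this]
  apply Finset.sum_congr rfl
  intro i _
  rw [← hz i]
  have := (mono_pos' hb (y i)).ne'
  field_simp

section Lyap
variable {y y' : Fin r → Fin n → ℕ} {k τ : Fin r → ℝ} {τm M : ℝ} {x : ℝ → Fin n → ℝ}
  {xh : Fin n → ℝ}

/-- backward flux -/
noncomputable def BB (xh : Fin n → ℝ) (η η' : Fin n → ℕ) (x : Fin n → ℝ) : ℝ :=
  mono x η' * mono xh η / mono xh η'

lemma BB_pos (hh : ∀ j, 0 < xh j) {u : Fin n → ℝ} (hu : ∀ j, 0 < u j) (η η' : Fin n → ℕ) :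
    0 < BB xh η η' u :=
  div_pos (mul_pos (mono_pos' hu _) (mono_pos' hh _)) (mono_pos' hh _)

/-- partial Lyapunov functional -/
noncomputable def VV (y : Fin r → Fin n → ℕ) (k τ : Fin r → ℝ) (x : ℝ → Fin n → ℝ)
    (xh : Fin n → ℝ) (W : Finset (Fin n)) (T : Finset (Fin r)) (t : ℝ) : ℝ :=
  ∑ j ∈ W, FF (x t j) (xh j) + ∑ i ∈ T, k i * Win (τ i)
    (fun s => FF (mono (x s) (y i)) (mono xh (y i))) t

/-- log ratio -/
noncomputable def ww (xh : Fin n → ℝ) (u : Fin n → ℝ) (j : Fin n) : ℝ :=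
  Real.log (u j) - Real.log (xh j)

lemma log_mono_ww (hh : ∀ j, 0 < xh j) {u : Fin n → ℝ} (hu : ∀ j, 0 < u j) (η : Fin n → ℕ) :
    Real.log (mono u η) = Real.log (mono xh η) + ∑ j, (η j : ℝ) * ww xh u j := by
  rw [log_mono hu, log_mono hh, ← Finset.sum_add_distrib]
  apply Finset.sum_congr rfl
  intro j _
  unfold ww; ring

lemma log_BB (hh : ∀ j, 0 < xh j) {u : Fin n → ℝ} (hu : ∀ j, 0 < u j) (η η' : Fin n → ℕ) :
    Real.log (BB xh η η' u) = Real.log (mono xh η) + ∑ j, (η' j : ℝ) * ww xh u j := by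
  unfold BB
  rw [Real.log_div (mul_pos (mono_pos' hu _) (mono_pos' hh _)).ne' (mono_pos' hh _).ne',
    Real.log_mul (mono_pos' hu _).ne' (mono_pos' hh _).ne', log_mono_ww hh hu η']
  ring

lemma BB_eq_exp (hh : ∀ j, 0 < xh j) {u : Fin n → ℝ} (hu : ∀ j, 0 < u j) (η η' : Fin n → ℕ) :
    BB xh η η' u = mono u η * Real.exp (∑ j, ((η' j : ℝ) - (η j : ℝ)) * ww xh u j) := by
  rw [← Real.exp_log (BB_pos hh hu η η'), ← Real.exp_log (mono_pos' hu η), ← Real.exp_add,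
    log_BB hh hu, log_mono_ww hh hu, add_assoc,
    ← Finset.sum_add_distrib]
  congr 2
  apply Finset.sum_congr rfl
  intro j _; ring

lemma Sys.VV_cont (S : Sys y y' k τ τm M x) (W : Finset (Fin n)) (T : Finset (Fin r)) :
    Continuous (VV y k τ x xh W T) := by
  unfold VV
  have h1 : ∀ j, Continuous (fun t => FF (x t j) (xh j)) := fun j =>
    (continuous_FF _).comp (S.contj j)
  have h2 : ∀ i, Continuous (Win (τ i) (fun s => FF (mono (x s) (y i)) (mono xh (y i)))) :=
    fun i => continuous_Win ((continuous_FF _).comp (S.contg _)) _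
  fun_prop

lemma hasDerivAt_FF {f : ℝ → ℝ} {f' t b : ℝ} (hf : HasDerivAt f f' t) (h0 : f t ≠ 0) :
    HasDerivAt (fun s => FF (f s) b) (f' * (Real.log (f t) - Real.log b)) t := by
  unfold FF
  have h1 := hf.mul (hf.log h0)
  have h2 := (((h1.sub (hf.mul_const (Real.log b))).sub hf).add_const b)
  refine h2.congr_deriv ?_
  field_simp
  ring

/-- main derivative identity -/
lemma Sys.VV_der (S : Sys y y' k τ τm M x) (hh : ∀ j, 0 < xh j)
    (W : Finset (Fin n)) (T : Finset (Fin r))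
    (hT : ∀ i ∉ T, ∀ j ∈ W, y i j = 0 ∧ y' i j = 0)
    (hB : ∀ t, ∑ i ∈ T, k i * (BB xh (y i) (y' i) (x t) - mono (x t) (y i)) = 0)
    (t : ℝ) (ht : τm < t) :
    HasDerivAt (VV y k τ x xh W T)
      (-(∑ i ∈ T, k i * FF (mono (x (t - τ i)) (y i)) (BB xh (y i) (y' i) (x t)))
       - ∑ j ∈ Wᶜ, ww xh (x t) j * ∑ i ∈ T, k i * (mono (x (t - τ i)) (y i) * (y' i j : ℝ)
          - mono (x t) (y i) * (y i j : ℝ))) t := by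
  have h1 : ∀ j ∈ W, HasDerivAt (fun t => FF (x t j) (xh j))
      ((∑ i, k i * (mono (x (t - τ i)) (y i) * (y' i j : ℝ) - mono (x t) (y i) * (y i j : ℝ))) *
        (ww xh (x t) j)) t := fun j _ => hasDerivAt_FF (S.der t ht j) (S.pos t j).ne'
  have h2 : ∀ i ∈ T, HasDerivAt
      (fun t => k i * Win (τ i) (fun s => FF (mono (x s) (y i)) (mono xh (y i))) t)
      (k i * (FF (mono (x t) (y i)) (mono xh (y i))
        - FF (mono (x (t - τ i)) (y i)) (mono xh (y i)))) t := fun i _ =>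
    (hasDerivAt_Win ((continuous_FF _).comp (S.contg (y i))) (τ i) t).const_mul _
  have h3 := (HasDerivAt.fun_sum h1).add (HasDerivAt.fun_sum h2)
  refine h3.congr_deriv ?_
  -- algebra
  have e1 : ∑ j ∈ W, (∑ i, k i * (mono (x (t - τ i)) (y i) * (y' i j : ℝ)
      - mono (x t) (y i) * (y i j : ℝ))) * ww xh (x t) j =
      ∑ j ∈ W, ww xh (x t) j * ∑ i ∈ T, k i * (mono (x (t - τ i)) (y i) * (y' i j : ℝ)
          - mono (x t) (y i) * (y i j : ℝ)) := by
    apply Finset.sum_congr rfl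
    intro j hj
    rw [mul_comm]
    congr 1
    symm
    apply Finset.sum_subset (Finset.subset_univ _)
    intro i _ hi
    simp [hT i hi j hj]
  rw [e1]
  have e2 := Finset.sum_add_sum_compl W (fun j => ww xh (x t) j * ∑ i ∈ T, k i *
    (mono (x (t - τ i)) (y i) * (y' i j : ℝ) - mono (x t) (y i) * (y i j : ℝ)))
  have e3 : ∑ j, ww xh (x t) j * ∑ i ∈ T, k i *
      (mono (x (t - τ i)) (y i) * (y' i j : ℝ) - mono (x t) (y i) * (y i j : ℝ)) =
      ∑ i ∈ T, k i * (mono (x (t - τ i)) (y i) * (∑ j, (y' i j : ℝ) * ww xh (x t) j)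
        - mono (x t) (y i) * (∑ j, (y i j : ℝ) * ww xh (x t) j)) := by
    simp only [Finset.mul_sum]
    rw [Finset.sum_comm]
    apply Finset.sum_congr rfl
    intro i _
    rw [← Finset.sum_sub_distrib, Finset.mul_sum]
    apply Finset.sum_congr rfl
    intro j _
    ring
  have e4 := hB t
  have e5 : ∀ i ∈ T, k i * (mono (x (t - τ i)) (y i) * (∑ j, (y' i j : ℝ) * ww xh (x t) j)
        - mono (x t) (y i) * (∑ j, (y i j : ℝ) * ww xh (x t) j)) +
        k i * (FF (mono (x t) (y i)) (mono xh (y i))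
        - FF (mono (x (t - τ i)) (y i)) (mono xh (y i))) =
      -(k i * FF (mono (x (t - τ i)) (y i)) (BB xh (y i) (y' i) (x t))) +
       k i * (BB xh (y i) (y' i) (x t) - mono (x t) (y i)) := by
    intro i _
    unfold FF
    rw [log_BB hh (S.pos t), log_mono_ww hh (S.pos t)]
    ring
  have e6 := Finset.sum_congr rfl e5
  rw [Finset.sum_add_distrib, Finset.sum_add_distrib, e4, Finset.sum_neg_distrib] at e6
  linarith

lemma CBf.hB (h : CBf y y' k xh) (hh : ∀ j, 0 < xh j) (u : Fin n → ℝ) :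
    ∑ i, k i * (BB xh (y i) (y' i) u - mono u (y i)) = 0 := by
  rw [← h (fun η => mono u η / mono xh η)]
  apply Finset.sum_congr rfl
  intro i _
  have h1 := (mono_pos' hh (y i)).ne'
  unfold BB
  field_simp

/-- balance restricted to reactions meeting W -/
lemma CBf.hBW (h : CBf y y' k xh) (hh : ∀ j, 0 < xh j) (W : Finset (Fin n)) (T : Finset (Fin r))
    (hT1 : ∀ i, i ∈ T ↔ ∃ j ∈ W, y i j ≠ 0) (hT2 : ∀ i, i ∈ T ↔ ∃ j ∈ W, y' i j ≠ 0)
    (u : Fin n → ℝ) :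
    ∑ i ∈ T, k i * (BB xh (y i) (y' i) u - mono u (y i)) = 0 := by
  classical
  rw [← h (fun η => if ∃ j ∈ W, η j ≠ 0 then mono u η / mono xh η else 0)]
  rw [← Finset.sum_subset (Finset.subset_univ T)]
  · apply Finset.sum_congr rfl
    intro i hi
    have h1 := (mono_pos' hh (y i)).ne'
    rw [if_pos ((hT1 i).1 hi), if_pos ((hT2 i).1 hi)]
    unfold BB
    field_simp
  · intro i _ hi
    rw [if_neg (fun h => hi ((hT1 i).2 h)), if_neg (fun h => hi ((hT2 i).2 h))]
    simp

/-- dissipation -/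
noncomputable def DD (y y' : Fin r → Fin n → ℕ) (k τ : Fin r → ℝ) (x : ℝ → Fin n → ℝ)
    (xh : Fin n → ℝ) (t : ℝ) : ℝ :=
  ∑ i, k i * FF (mono (x (t - τ i)) (y i)) (BB xh (y i) (y' i) (x t))

lemma Sys.V_der (S : Sys y y' k τ τm M x) (hh : ∀ j, 0 < xh j) (h : CBf y y' k xh)
    (t : ℝ) (ht : τm < t) :
    HasDerivAt (VV y k τ x xh univ univ) (-DD y y' k τ x xh t) t := by
  have := S.VV_der hh univ univ (by simp) (fun t => h.hB hh (x t)) t ht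
  simpa [DD] using this

lemma Sys.DD_term_nonneg (S : Sys y y' k τ τm M x) (hh : ∀ j, 0 < xh j) (t : ℝ) (i : Fin r) :
    0 ≤ k i * FF (mono (x (t - τ i)) (y i)) (BB xh (y i) (y' i) (x t)) :=
  mul_nonneg (S.hk i).le (FF_nonneg (S.gpos _ _) (BB_pos hh (S.pos t) _ _))

lemma Sys.DD_nonneg (S : Sys y y' k τ τm M x) (hh : ∀ j, 0 < xh j) (t : ℝ) :
    0 ≤ DD y y' k τ x xh t := Finset.sum_nonneg fun i _ => S.DD_term_nonneg hh t i

lemma Sys.le_DD (S : Sys y y' k τ τm M x) (hh : ∀ j, 0 < xh j) (t : ℝ) (i : Fin r) :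
    k i * FF (mono (x (t - τ i)) (y i)) (BB xh (y i) (y' i) (x t)) ≤ DD y y' k τ x xh t :=
  Finset.single_le_sum (f := fun i => k i * FF (mono (x (t - τ i)) (y i))
    (BB xh (y i) (y' i) (x t))) (fun i _ => S.DD_term_nonneg hh t i) (Finset.mem_univ i)

lemma Sys.V_anti (S : Sys y y' k τ τm M x) (hh : ∀ j, 0 < xh j) (h : CBf y y' k xh) :
    AntitoneOn (VV y k τ x xh univ univ) (Set.Ici τm) :=
  anti_of_deriv (S.VV_cont _ _) (fun t ht => S.V_der hh h t ht)
    (fun t _ => by have := S.DD_nonneg (y := y) (y' := y') hh t; linarith)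

lemma Sys.VV_nonneg (S : Sys y y' k τ τm M x) (hh : ∀ j, 0 < xh j)
    (W : Finset (Fin n)) (T : Finset (Fin r)) (t : ℝ) : 0 ≤ VV y k τ x xh W T t := by
  unfold VV
  apply add_nonneg
  · exact Finset.sum_nonneg fun j _ => FF_nonneg (S.pos t j) (hh j)
  · exact Finset.sum_nonneg fun i _ => mul_nonneg (S.hk i).le
      (Win_nonneg ((continuous_FF _).comp (S.contg (y i))) (S.hτ i)
        (fun s => FF_nonneg (S.gpos _ _) (mono_pos' hh _)))

lemma Sys.V_tendsto (S : Sys y y' k τ τm M x) (hh : ∀ j, 0 < xh j) (h : CBf y y' k xh) :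
    ∃ c, Tendsto (VV y k τ x xh univ univ) atTop (𝓝 c) ∧ ∀ t ≥ τm, c ≤ VV y k τ x xh univ univ t := by
  have ha := S.V_anti hh h
  set V := VV y k τ x xh univ univ
  have h1 : Antitone (fun t => V (max t τm)) := fun s t hst =>
    ha (Set.mem_Ici.2 (le_max_right _ _)) (Set.mem_Ici.2 (le_max_right _ _)) (max_le_max_right _ hst)
  have h2 := tendsto_atTop_ciInf h1 ⟨0, by rintro _ ⟨t, rfl⟩; exact S.VV_nonneg hh _ _ _⟩
  refine ⟨_, h2.congr' ?_, ?_⟩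
  · filter_upwards [eventually_ge_atTop τm] with t ht
    rw [max_eq_left ht]
  · intro t ht
    have := h1.le_of_tendsto h2 t
    rwa [max_eq_left ht] at this

/-- velocity bound by dissipation -/
lemma Sys.der_sq (S : Sys y y' k τ τm M x) (hh : ∀ j, 0 < xh j) (h : CBf y y' k xh) :
    ∃ C, 0 < C ∧ ∀ t, ∀ j, (∑ i, k i * (mono (x (t - τ i)) (y i) * (y' i j : ℝ)
      - mono (x t) (y i) * (y i j : ℝ)))^2 ≤ C * DD y y' k τ x xh t := by
  have hM0 : (0:ℝ) < M := by linarith [S.hM]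
  -- bound on fluxes
  have hbd : ∀ i, ∃ B, 0 < B ∧ ∀ t s, mono (x s) (y i) ≤ B ∧ BB xh (y i) (y' i) (x t) ≤ B := by
    intro i
    refine ⟨M ^ (∑ j, y i j) + M ^ (∑ j, y' i j) * mono xh (y i) / mono xh (y' i), ?_, ?_⟩
    · have := mono_pos' hh (y i); have := mono_pos' hh (y' i); positivity
    · intro t s
      have h1 := mono_le_pow (fun j => (S.pos s j).le) (S.bd s) (y i)
      have h2 := mono_le_pow (fun j => (S.pos t j).le) (S.bd t) (y' i)
      have a1 := mono_pos' hh (y i); have a2 := mono_pos' hh (y' i)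
      have h3 : BB xh (y i) (y' i) (x t) ≤ M ^ (∑ j, y' i j) * mono xh (y i) / mono xh (y' i) := by
        unfold BB; gcongr
      have h4 : 0 ≤ M ^ (∑ j, y' i j) * mono xh (y i) / mono xh (y' i) := by positivity
      have h5 : 0 ≤ M ^ (∑ j, y i j) := by positivity
      constructor <;> linarith
  choose B hB0 hB using hbd
  refine ⟨1 + ∑ j, (r : ℝ) * ∑ i, k i * (4 * B i) * (y' i j : ℝ)^2, ?_, ?_⟩
  · have : 0 ≤ ∑ j, (r : ℝ) * ∑ i, k i * (4 * B i) * (y' i j : ℝ)^2 := by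
      apply Finset.sum_nonneg; intro j _
      apply mul_nonneg (Nat.cast_nonneg _)
      apply Finset.sum_nonneg; intro i _
      have := S.hk i; have := hB0 i; positivity
    linarith
  · intro t j
    have e1 : ∑ i, k i * (mono (x (t - τ i)) (y i) * (y' i j : ℝ)
        - mono (x t) (y i) * (y i j : ℝ)) =
        ∑ i, k i * ((mono (x (t - τ i)) (y i) - BB xh (y i) (y' i) (x t)) * (y' i j : ℝ)) := by
      have := h (fun η => mono (x t) η / mono xh η * (η j : ℝ))
      rw [← sub_eq_zero, ← Finset.sum_sub_distrib, ← this]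
      apply Finset.sum_congr rfl
      intro i _
      have h1 := (mono_pos' hh (y i)).ne'
      unfold BB
      field_simp
      ring
    rw [e1]
    have hD := S.DD_nonneg (y := y) (y' := y') hh t
    have h1 := sq_sum_le_card_mul_sum_sq (s := (univ : Finset (Fin r)))
      (f := fun i => k i * ((mono (x (t - τ i)) (y i) - BB xh (y i) (y' i) (x t)) * (y' i j : ℝ)))
    have h2 : ∀ i ∈ (univ : Finset (Fin r)),
        (k i * ((mono (x (t - τ i)) (y i) - BB xh (y i) (y' i) (x t)) * (y' i j : ℝ)))^2
        ≤ k i * (4 * B i) * (y' i j : ℝ)^2 * DD y y' k τ x xh t := by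
      intro i _
      have f1 := FF_sq (S.gpos (y i) (t - τ i)) (BB_pos hh (S.pos t) (y i) (y' i))
        (hB i t (t - τ i)).1 (hB i t (t - τ i)).2
      have f2 := S.le_DD (y := y) (y' := y') hh t i
      have hki := S.hk i
      have hBi := hB0 i
      calc _ = k i * (y' i j : ℝ)^2 * (k i * (mono (x (t - τ i)) (y i) - BB xh (y i) (y' i) (x t))^2) := by ring
        _ ≤ k i * (y' i j : ℝ)^2 * (k i * (4 * B i * FF (mono (x (t - τ i)) (y i)) (BB xh (y i) (y' i) (x t)))) := by gcongr
        _ = k i * (4 * B i) * (y' i j : ℝ)^2 * (k i * FF (mono (x (t - τ i)) (y i)) (BB xh (y i) (y' i) (x t))) := by ring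
        _ ≤ _ := by gcongr
    have h3 := Finset.sum_le_sum h2
    rw [← Finset.sum_mul] at h3
    have hnn : ∀ j, 0 ≤ (r : ℝ) * ∑ i, k i * (4 * B i) * (y' i j : ℝ)^2 := fun j => by
      apply mul_nonneg (Nat.cast_nonneg _)
      apply Finset.sum_nonneg; intro i _
      have := S.hk i; have := hB0 i; positivity
    have h4 := Finset.single_le_sum (f := fun j => (r : ℝ) * ∑ i, k i * (4 * B i) * (y' i j : ℝ)^2)
      (fun j _ => hnn j) (Finset.mem_univ j)
    have h5 := mul_le_mul_of_nonneg_right h4 hD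
    simp only [Finset.card_univ, Fintype.card_fin] at h1
    have h6 := mul_le_mul_of_nonneg_left h3 (Nat.cast_nonneg (α := ℝ) r)
    nlinarith

/-- from derivative-square bound to Hölder bound -/
lemma holder_bound {f f' V D : ℝ → ℝ} {a C : ℝ} (hC : 0 < C) (hf : Continuous f) (hV : Continuous V)
    (hfd : ∀ t > a, HasDerivAt f (f' t) t) (hVd : ∀ t > a, HasDerivAt V (-D t) t)
    (hD : ∀ t > a, (f' t)^2 ≤ C * D t) {s t : ℝ} (hs : a ≤ s) (hst : s ≤ t) :
    (f t - f s)^2 ≤ C * (t - s) * (V s - V t) := by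
  have key : ∀ (σ : ℝ), σ^2 = 1 → ∀ l > 0, 2 * l * (σ * (f t - f s)) ≤ l^2 * (t - s) + C * (V s - V t) := by
    intro σ hσ l hl
    have hm := mono_of_deriv (f := fun u => l^2 * u - C * V u - 2 * l * (σ * f u)) (a := a)
      (f' := fun u => l^2 * 1 - C * (- D u) - 2 * l * (σ * f' u)) (by fun_prop)
      (fun u hu => ((((hasDerivAt_id u).const_mul (l^2)).sub ((hVd u hu).const_mul C)).sub
        (((hfd u hu).const_mul σ).const_mul (2*l))))
      (fun u hu => by
        have := hD u hu
        nlinarith [sq_nonneg (l - σ * f' u)])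
    have := hm (Set.mem_Ici.2 hs) (Set.mem_Ici.2 (hs.trans hst)) hst
    simp only at this
    linarith
  have habs : ∀ l > 0, 2 * l * |f t - f s| ≤ l^2 * (t - s) + C * (V s - V t) := by
    intro l hl
    rcases abs_choice (f t - f s) with h | h
    · rw [h]; simpa using key 1 (by norm_num) l hl
    · rw [h]; simpa using key (-1) (by norm_num) l hl
  rw [← sq_abs]
  set A := |f t - f s|
  have hA : 0 ≤ A := abs_nonneg _
  rcases hst.eq_or_lt with he | hlt
  · have : A = 0 := by simp [A, he]
    rw [this, he]; simp
  · rcases hA.eq_or_lt with h0 | h0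
    · rw [← h0]
      have hVV := anti_of_deriv hV hVd (fun t ht => by
        have := hD t ht; nlinarith [sq_nonneg (f' t)]) (Set.mem_Ici.2 hs)
          (Set.mem_Ici.2 (hs.trans hst)) hst
      have : 0 ≤ C * (t - s) * (V s - V t) := by
        apply mul_nonneg (mul_nonneg hC.le (by linarith)); linarith
      simpa using this
    · have h1 : 0 < t - s := by linarith
      have h2 := habs (A / (t - s)) (div_pos h0 h1)
      have h3 : 2 * (A / (t - s)) * A * (t - s) ≤ ((A / (t - s))^2 * (t - s) + C * (V s - V t)) * (t - s) :=
        mul_le_mul_of_nonneg_right h2 h1.le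
      have e1 : 2 * (A / (t - s)) * A * (t - s) = 2 * A^2 := by field_simp
      have e2 : ((A / (t - s))^2 * (t - s) + C * (V s - V t)) * (t - s) = A^2 + C * (V s - V t) * (t - s) := by
        field_simp
      rw [e1, e2] at h3
      linarith

lemma Sys.holder (S : Sys y y' k τ τm M x) (hh : ∀ j, 0 < xh j) (h : CBf y y' k xh) :
    ∃ C, 0 < C ∧ ∀ j s t, τm ≤ s → s ≤ t → (x t j - x s j)^2 ≤
      C * (t - s) * (VV y k τ x xh univ univ s - VV y k τ x xh univ univ t) := by
  obtain ⟨C, hC, hb⟩ := S.der_sq hh h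
  exact ⟨C, hC, fun j s t hs hst => holder_bound hC (S.contj j) (S.VV_cont univ univ)
    (fun u hu => S.der u hu j) (fun u hu => S.V_der hh h u hu) (fun u _ => hb u j) hs hst⟩

end Lyap
open Topology

section Omega
variable {y y' : Fin r → Fin n → ℕ} {k τ : Fin r → ℝ} {τm M : ℝ} {x : ℝ → Fin n → ℝ}
  {xb : Fin n → ℝ}

lemma Sys.box (S : Sys y y' k τ τm M x) (t : ℝ) : x t ∈ Set.Icc (0 : Fin n → ℝ) (fun _ => M) :=
  ⟨fun j => (S.pos t j).le, fun j => S.bd t j⟩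

lemma box_compact (M : ℝ) : IsCompact (Set.Icc (0 : Fin n → ℝ) (fun _ => M)) := isCompact_Icc

/-- energy drop over windows tends to zero -/
lemma Sys.drop_lim (S : Sys y y' k τ τm M x) (hb : ∀ j, 0 < xb j) (h : CBf y y' k xb) (T : ℝ) :
    Tendsto (fun t => VV y k τ x xb univ univ (t - T) - VV y k τ x xb univ univ t) atTop (𝓝 0) := by
  obtain ⟨c, hc, -⟩ := S.V_tendsto hb h
  have h1 : Tendsto (fun t : ℝ => t - T) atTop atTop := by
    simpa [sub_eq_add_neg] using tendsto_atTop_add_const_right atTop (-T) tendsto_id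
  simpa using (hc.comp h1).sub hc

/-- slow variation -/
lemma Sys.slow0 (S : Sys y y' k τ τm M x) (hb : ∀ j, 0 < xb j) (h : CBf y y' k xb) (T : ℝ)
    {δ : ℝ} (hδ : 0 < δ) : ∀ᶠ t in atTop, ∀ s ∈ Set.Icc (t - T) t, dist (x s) (x t) < δ := by
  obtain ⟨C, hC, hH⟩ := S.holder hb h
  rcases lt_or_ge T 0 with hT | hT
  · filter_upwards with t s hs
    have := hs.1.trans hs.2; linarith
  have h1 := (S.drop_lim hb h T)
  have h2 : 0 < (δ/2)^2 / (C * (T + 1)) := by positivity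
  filter_upwards [h1.eventually_lt_const h2, eventually_ge_atTop (T + τm)] with t ht htT s hs
  rw [dist_pi_lt_iff hδ]
  intro j
  have hsτ : τm ≤ s := by linarith [hs.1]
  have h3 := hH j s t hsτ hs.2
  have hanti := S.V_anti hb h
  have h4 : VV y k τ x xb univ univ s ≤ VV y k τ x xb univ univ (t - T) :=
    hanti (Set.mem_Ici.2 (by linarith)) (Set.mem_Ici.2 hsτ) hs.1
  have h5 : VV y k τ x xb univ univ t ≤ VV y k τ x xb univ univ s :=
    hanti (Set.mem_Ici.2 hsτ) (Set.mem_Ici.2 (by linarith [hs.2])) hs.2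
  rw [lt_div_iff₀ (by positivity)] at ht
  have h6 : C * (t - s) * (VV y k τ x xb univ univ s - VV y k τ x xb univ univ t) ≤
      C * (T + 1) * (VV y k τ x xb univ univ (t - T) - VV y k τ x xb univ univ t) := by
    apply mul_le_mul _ (by linarith) (by linarith) (by positivity)
    apply mul_le_mul_of_nonneg_left _ hC.le
    linarith [hs.1]
  have h7 : (x t j - x s j)^2 ≤ (δ/2)^2 := by linarith
  have h8 := abs_le_of_sq_le_sq h7 (by positivity)
  rw [Real.dist_eq, abs_sub_comm]
  linarith

lemma Sys.slow (S : Sys y y' k τ τm M x) (hb : ∀ j, 0 < xb j) (h : CBf y y' k xb)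
    {G : (Fin n → ℝ) → ℝ} (hG : Continuous G) (T : ℝ) {ε : ℝ} (hε : 0 < ε) :
    ∀ᶠ t in atTop, ∀ s ∈ Set.Icc (t - T) t, |G (x s) - G (x t)| < ε := by
  have huc := (box_compact (n := n) M).uniformContinuousOn_of_continuous hG.continuousOn
  rw [Metric.uniformContinuousOn_iff] at huc
  obtain ⟨δ, hδ, hd⟩ := huc ε hε
  filter_upwards [S.slow0 hb h T hδ] with t ht s hs
  have := hd _ (S.box s) _ (S.box t) (ht s hs)
  rwa [Real.dist_eq] at this

lemma Sys.delay_lim (S : Sys y y' k τ τm M x) (hb : ∀ j, 0 < xb j) (h : CBf y y' k xb)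
    {G : (Fin n → ℝ) → ℝ} (hG : Continuous G) {T : ℝ} (hT : 0 ≤ T) :
    Tendsto (fun t => G (x (t - T)) - G (x t)) atTop (𝓝 0) := by
  rw [Metric.tendsto_nhds]
  intro ε hε
  filter_upwards [S.slow hb h hG T hε] with t ht
  rw [Real.dist_eq, sub_zero]
  exact ht _ ⟨le_rfl, by linarith⟩

lemma Sys.win_lim0 (S : Sys y y' k τ τm M x) (hb : ∀ j, 0 < xb j) (h : CBf y y' k xb)
    {G : (Fin n → ℝ) → ℝ} (hG : Continuous G) {T : ℝ} (hT : 0 ≤ T) :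
    Tendsto (fun t => Win T (fun s => G (x s)) t - T * G (x t)) atTop (𝓝 0) := by
  rw [Metric.tendsto_nhds]
  intro ε hε
  have h1 : 0 < ε / (T + 1) := by positivity
  filter_upwards [S.slow hb h hG T h1] with t ht
  rw [Real.dist_eq, sub_zero]
  have := Win_sub_abs (hG.comp S.cont) hT (t := t) (c := G (x t)) (e := ε / (T+1))
    (fun s hs => (ht s hs).le)
  refine lt_of_le_of_lt this ?_
  rw [mul_div_assoc', div_lt_iff₀ (by positivity)]
  nlinarith

lemma Sys.win_lim (S : Sys y y' k τ τm M x) (hb : ∀ j, 0 < xb j) (h : CBf y y' k xb)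
    {G : (Fin n → ℝ) → ℝ} (hG : Continuous G) {T : ℝ} (hT : 0 ≤ T) {U : Filter ℝ} (hU : U ≤ atTop)
    {z : Fin n → ℝ} (hz : Tendsto x U (𝓝 z)) :
    Tendsto (fun t => Win T (fun s => G (x s)) t) U (𝓝 (T * G z)) := by
  have h1 := (S.win_lim0 hb h hG hT).mono_left hU
  have h2 : Tendsto (fun t => T * G (x t)) U (𝓝 (T * G z)) :=
    ((hG.tendsto z).comp hz).const_mul T
  simpa using h1.add h2

lemma Sys.VV_lim (S : Sys y y' k τ τm M x) (hb : ∀ j, 0 < xb j) (h : CBf y y' k xb)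
    (xh : Fin n → ℝ) (W : Finset (Fin n)) (T : Finset (Fin r)) {U : Filter ℝ} (hU : U ≤ atTop)
    {z : Fin n → ℝ} (hz : Tendsto x U (𝓝 z)) :
    Tendsto (VV y k τ x xh W T) U (𝓝 (∑ j ∈ W, FF (z j) (xh j) +
      ∑ i ∈ T, k i * (τ i * FF (mono z (y i)) (mono xh (y i))))) := by
  unfold VV
  apply Tendsto.add
  · apply tendsto_finsetSum
    intro j _
    exact ((continuous_FF _).tendsto _).comp ((tendsto_pi_nhds.1 hz) j)
  · apply tendsto_finsetSum
    intro i _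
    exact (S.win_lim hb h (G := fun u => FF (mono u (y i)) (mono xh (y i)))
      ((continuous_FF _).comp (continuous_mono _)) (S.hτ i) hU hz).const_mul _

lemma Sys.XX_lim (S : Sys y y' k τ τm M x) (hb : ∀ j, 0 < xb j) (h : CBf y y' k xb)
    {U : Filter ℝ} (hU : U ≤ atTop)
    {z : Fin n → ℝ} (hz : Tendsto x U (𝓝 z)) (j : Fin n) :
    Tendsto (fun t => XX y k τ x t j) U
      (𝓝 (z j + ∑ i, k i * (y i j : ℝ) * (τ i * mono z (y i)))) := by
  unfold XX
  apply Tendsto.add ((tendsto_pi_nhds.1 hz) j)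
  apply tendsto_finsetSum
  intro i _
  exact (S.win_lim hb h (continuous_mono (y i)) (S.hτ i) hU hz).const_mul _

lemma Sys.mvt (S : Sys y y' k τ τm M x) (hb : ∀ j, 0 < xb j) (h : CBf y y' k xb) (t : ℝ)
    (ht : τm ≤ t - 1) : ∃ t' ∈ Set.Icc (t-1) t, DD y y' k τ x xb t' =
      VV y k τ x xb univ univ (t-1) - VV y k τ x xb univ univ t := by
  obtain ⟨c, hc, he⟩ := exists_hasDerivAt_eq_slope (VV y k τ x xb univ univ)
    (fun t => -DD y y' k τ x xb t) (show t - 1 < t by linarith) (S.VV_cont _ _).continuousOn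
    (fun u hu => S.V_der hb h u (by linarith [hu.1]))
  refine ⟨c, ⟨hc.1.le, hc.2.le⟩, ?_⟩
  have : t - (t - 1) = 1 := by ring
  rw [this, div_one] at he
  linarith

lemma continuous_BB (xh : Fin n → ℝ) (η η' : Fin n → ℕ) : Continuous (BB xh η η') := by
  unfold BB
  have := continuous_mono η'
  fun_prop

/-- flux bounds -/
lemma Sys.flux_bd (S : Sys y y' k τ τm M x) (hb : ∀ j, 0 < xb j) :
    ∃ B, 0 < B ∧ ∀ i t s, mono (x s) (y i) ≤ B ∧ BB xb (y i) (y' i) (x t) ≤ B := by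
  have hM0 : (0:ℝ) < M := by linarith [S.hM]
  have hp : ∀ i, 0 ≤ M ^ (∑ j, y i j) + M ^ (∑ j, y' i j) * mono xb (y i) / mono xb (y' i) := by
    intro i
    have := mono_pos' hb (y i); have := mono_pos' hb (y' i); positivity
  refine ⟨1 + ∑ i, (M ^ (∑ j, y i j) + M ^ (∑ j, y' i j) * mono xb (y i) / mono xb (y' i)), ?_, ?_⟩
  · have := Finset.sum_nonneg (s := univ) fun i _ => hp i
    linarith
  · intro i t s
    have h1 := mono_le_pow (fun j => (S.pos s j).le) (S.bd s) (y i)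
    have h2 := mono_le_pow (fun j => (S.pos t j).le) (S.bd t) (y' i)
    have a1 := mono_pos' hb (y i); have a2 := mono_pos' hb (y' i)
    have h3 : BB xb (y i) (y' i) (x t) ≤ M ^ (∑ j, y' i j) * mono xb (y i) / mono xb (y' i) := by
      unfold BB; gcongr
    have h4 : 0 ≤ M ^ (∑ j, y' i j) * mono xb (y i) / mono xb (y' i) := by positivity
    have h5 : 0 ≤ M ^ (∑ j, y i j) := by positivity
    have h6 := Finset.single_le_sum (f := fun i => M ^ (∑ j, y i j) +
      M ^ (∑ j, y' i j) * mono xb (y i) / mono xb (y' i)) (fun i _ => hp i) (Finset.mem_univ i)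
    constructor <;> linarith

/-- pointwise flux imbalance at MVT times -/
lemma Sys.imb (S : Sys y y' k τ τm M x) (hb : ∀ j, 0 < xb j) (h : CBf y y' k xb) :
    ∃ C, 0 < C ∧ ∀ t, τm ≤ t - 1 → ∃ t' ∈ Set.Icc (t-1) t, ∀ i,
      (mono (x (t' - τ i)) (y i) - BB xb (y i) (y' i) (x t'))^2 ≤
        C * (VV y k τ x xb univ univ (t-1) - VV y k τ x xb univ univ t) := by
  obtain ⟨B, hB0, hB⟩ := S.flux_bd hb
  have hp : ∀ i, 0 ≤ 4 * B / k i := fun i => by have := S.hk i; positivity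
  refine ⟨1 + ∑ i, 4 * B / k i, ?_, ?_⟩
  · have := Finset.sum_nonneg (s := univ) fun i _ => hp i
    linarith
  · intro t ht
    obtain ⟨t', ht', he⟩ := S.mvt hb h t ht
    refine ⟨t', ht', fun i => ?_⟩
    have f1 := FF_sq (S.gpos (y i) (t' - τ i)) (BB_pos hb (S.pos t') (y i) (y' i))
        (hB i t' (t' - τ i)).1 (hB i t' (t' - τ i)).2
    have f2 := S.le_DD (y := y) (y' := y') hb t' i
    rw [← he]
    have h6 := Finset.single_le_sum (f := fun i => 4 * B / k i) (fun i _ => hp i) (Finset.mem_univ i)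
    have hD := S.DD_nonneg (y := y) (y' := y') hb t'
    have hki := S.hk i
    calc _ ≤ _ := f1
      _ = 4 * B / k i * (k i * FF (mono (x (t' - τ i)) (y i)) (BB xb (y i) (y' i) (x t'))) := by
        field_simp
      _ ≤ (1 + ∑ i, 4 * B / k i) * DD y y' k τ x xb t' := by
        apply mul_le_mul (by linarith) f2 (S.DD_term_nonneg hb t' i)
        have := hp i; linarith

lemma Sys.balance_lim (S : Sys y y' k τ τm M x) (hb : ∀ j, 0 < xb j) (h : CBf y y' k xb)
    (i : Fin r) :
    Tendsto (fun t => mono (x t) (y i) - BB xb (y i) (y' i) (x t)) atTop (𝓝 0) := by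
  obtain ⟨C, hC, hI⟩ := S.imb hb h
  rw [Metric.tendsto_nhds]
  intro ε hε
  have h3 : 0 < (ε/4)^2 / C := by positivity
  filter_upwards [S.slow hb h (continuous_mono (y i)) (1 + τm) (show 0 < ε/4 by positivity),
    S.slow hb h (continuous_BB xb (y i) (y' i)) 1 (show 0 < ε/4 by positivity),
    (S.drop_lim hb h 1).eventually_lt_const h3, eventually_ge_atTop (τm + 1)] with t h1 h2 h3 h4
  obtain ⟨t', ht', hi⟩ := hI t (by linarith)
  have h5 := hi i
  rw [lt_div_iff₀ hC] at h3
  have h6 : (mono (x (t' - τ i)) (y i) - BB xb (y i) (y' i) (x t'))^2 ≤ (ε/4)^2 := by linarith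
  have h7 := abs_le.1 (abs_le_of_sq_le_sq h6 (by positivity))
  have h8 := abs_lt.1 (h1 (t' - τ i) ⟨by linarith [ht'.1, S.hτm i], by linarith [ht'.2, S.hτ i]⟩)
  have h9 := abs_lt.1 (h2 t' ht')
  rw [Real.dist_eq, sub_zero, abs_lt]
  constructor <;> linarith

/-- omega limit set -/
def Om (x : ℝ → Fin n → ℝ) : Set (Fin n → ℝ) := {z | MapClusterPt z atTop x}

lemma Om_ultra {z : Fin n → ℝ} (hz : z ∈ Om x) :
    ∃ U : Filter ℝ, U.NeBot ∧ U ≤ atTop ∧ Tendsto x U (𝓝 z) := by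
  obtain ⟨U, hU, hx⟩ := mapClusterPt_iff_ultrafilter.1 hz
  exact ⟨U, inferInstance, hU, hx⟩

lemma Om_of {z : Fin n → ℝ} {U : Filter ℝ} [U.NeBot] (hU : U ≤ atTop) (hx : Tendsto x U (𝓝 z)) :
    z ∈ Om x := by
  have : MapClusterPt z U x := hx.mapClusterPt
  exact this.mono hU

lemma Sys.Om_nonneg (S : Sys y y' k τ τm M x) {z : Fin n → ℝ} (hz : z ∈ Om x) (j : Fin n) :
    0 ≤ z j := by
  obtain ⟨U, hn, hU, hx⟩ := Om_ultra hz
  exact ge_of_tendsto ((tendsto_pi_nhds.1 hx) j) (Eventually.of_forall fun t => (S.pos t j).le)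

lemma Sys.Om_exists (S : Sys y y' k τ τm M x) : ∃ z, z ∈ Om x := by
  obtain ⟨z, -, hz⟩ := (box_compact (n := n) M).exists_mapClusterPt (f := atTop) (u := x)
    (by rw [Filter.map_le_iff_le_comap, Filter.comap_principal, le_principal_iff]
        exact Filter.univ_mem' S.box)
  exact ⟨z, hz⟩

lemma Sys.Om_freq (S : Sys y y' k τ τm M x) {K : Set (Fin n → ℝ)} (hK : IsClosed K)
    (hf : ∃ᶠ t in atTop, x t ∈ K) : ∃ z ∈ Om x, z ∈ K := by
  have hc : IsCompact (K ∩ Set.Icc (0 : Fin n → ℝ) (fun _ => M)) :=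
    (box_compact (n := n) M).inter_left hK
  obtain ⟨z, hz, hz'⟩ := hc.exists_mapClusterPt_of_frequently
    (hf.mono fun t ht => ⟨ht, S.box t⟩)
  exact ⟨z, hz', hz.1⟩

lemma Sys.Om_bal (S : Sys y y' k τ τm M x) (hb : ∀ j, 0 < xb j) (h : CBf y y' k xb)
    {z : Fin n → ℝ} (hz : z ∈ Om x) (i : Fin r) :
    mono z (y i) = BB xb (y i) (y' i) z := by
  obtain ⟨U, hn, hU, hx⟩ := Om_ultra hz
  have h1 := (S.balance_lim hb h i).mono_left hU
  have h2 : Tendsto (fun t => mono (x t) (y i) - BB xb (y i) (y' i) (x t)) U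
      (𝓝 (mono z (y i) - BB xb (y i) (y' i) z)) :=
    (((continuous_mono (y i)).tendsto z).comp hx).sub (((continuous_BB xb _ _).tendsto z).comp hx)
  have := tendsto_nhds_unique h2 h1
  linarith

lemma Sys.Om_sym (S : Sys y y' k τ τm M x) (hb : ∀ j, 0 < xb j) (h : CBf y y' k xb)
    {z : Fin n → ℝ} (hz : z ∈ Om x) (i : Fin r) :
    (∃ j, z j = 0 ∧ y i j ≠ 0) ↔ (∃ j, z j = 0 ∧ y' i j ≠ 0) := by
  rw [← mono_eq_zero, ← mono_eq_zero, S.Om_bal hb h hz i, BB]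
  have h1 := (mono_pos' hb (y i)).ne'
  have h2 := (mono_pos' hb (y' i)).ne'
  simp [h1, h2]

/-- a positive omega limit point yields persistence -/
lemma Sys.interior (S : Sys y y' k τ τm M x) (hb : ∀ j, 0 < xb j) (h : CBf y y' k xb)
    {z : Fin n → ℝ} (hz : z ∈ Om x) (hpos : ∀ j, 0 < z j) (j : Fin n) :
    ∃ c > 0, ∀ᶠ t in atTop, c ≤ x t j := by
  have hcz : CBf y y' k z := CBf_trans hb h (fun i => by
    have := S.Om_bal hb h hz i
    unfold BB at this
    rw [this]
    have := (mono_pos' hb (y i)).ne'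
    field_simp)
  obtain ⟨U, hn, hU, hx⟩ := Om_ultra hz
  have h1 := S.VV_lim hb h z univ univ hU hx
  have e : ∑ j ∈ univ, FF (z j) (z j) +
      ∑ i ∈ univ, k i * (τ i * FF (mono z (y i)) (mono z (y i))) = 0 := by
    simp [FF]
  rw [e] at h1
  obtain ⟨c, hc, -⟩ := S.V_tendsto hpos hcz
  have : c = 0 := tendsto_nhds_unique (hc.mono_left hU) h1
  subst this
  refine ⟨z j / 4, by have := hpos j; positivity, ?_⟩
  filter_upwards [hc.eventually_lt_const (show 0 < z j / 4 by have := hpos j; positivity)] with t ht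
  have h2 : FF (x t j) (z j) ≤ VV y k τ x z univ univ t := by
    have h3 := S.VV_nonneg hpos (∅ : Finset (Fin n)) univ t
    unfold VV at h3 ⊢
    have h4 := Finset.single_le_sum (f := fun j => FF (x t j) (z j))
      (fun j _ => FF_nonneg (S.pos t j) (hpos j)) (Finset.mem_univ j)
    simp only [Finset.sum_empty] at h3
    linarith
  have h3 := FF_sqrt (S.pos t j) (hpos j)
  have e1 := Real.sq_sqrt (S.pos t j).le
  have e2 := Real.sq_sqrt (hpos j).le
  have p1 := Real.sqrt_pos.2 (S.pos t j)
  have p2 := Real.sqrt_pos.2 (hpos j)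
  have h4 : (√(x t j) - √(z j))^2 < (√(z j) / 2)^2 := by
    have : (√(z j) / 2)^2 = z j / 4 := by rw [div_pow, e2]; norm_num
    linarith
  have h5 := abs_lt.1 (abs_lt_of_sq_lt_sq h4 (by positivity))
  have h6 : √(z j) / 2 ≤ √(x t j) := by linarith [h5.1]
  have h7 : (√(z j) / 2)^2 ≤ √(x t j)^2 := pow_le_pow_left₀ (by positivity) h6 2
  rw [e1, div_pow, e2] at h7
  linarith

end Omega
open Topology

/-- reaction vector -/
def vv (y y' : Fin r → Fin n → ℕ) (i : Fin r) (j : Fin n) : ℝ := (y' i j : ℝ) - (y i j : ℝ)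

open Classical in
/-- zero set -/
noncomputable def ZZ (z : Fin n → ℝ) : Finset (Fin n) := univ.filter (fun j => z j = 0)

open Classical in
/-- reactions balanced off the zero set -/
noncomputable def eqset (y y' : Fin r → Fin n → ℕ) (xb z : Fin n → ℝ) : Finset (Fin r) :=
  univ.filter (fun i => (∀ j, z j = 0 → vv y y' i j = 0) ∧ ∑ j, vv y y' i j * ww xb z j = 0)

open Classical in
/-- reactions meeting W -/
noncomputable def TT (y : Fin r → Fin n → ℕ) (W : Finset (Fin n)) : Finset (Fin r) :=
  univ.filter (fun i => ∃ j ∈ W, y i j ≠ 0)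

lemma mem_ZZ {z : Fin n → ℝ} {j : Fin n} : j ∈ ZZ z ↔ z j = 0 := by simp [ZZ]

lemma mem_TT {y : Fin r → Fin n → ℕ} {W : Finset (Fin n)} {i : Fin r} :
    i ∈ TT y W ↔ ∃ j ∈ W, y i j ≠ 0 := by simp [TT]

section Sel
variable {y y' : Fin r → Fin n → ℕ} {k τ : Fin r → ℝ} {τm M : ℝ} {x : ℝ → Fin n → ℝ}
  {xb : Fin n → ℝ}

lemma Sys.mem_TT' (S : Sys y y' k τ τm M x) (hb : ∀ j, 0 < xb j) (h : CBf y y' k xb)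
    {z : Fin n → ℝ} (hz : z ∈ Om x) (i : Fin r) :
    i ∈ TT y (ZZ z) ↔ ∃ j ∈ ZZ z, y' i j ≠ 0 := by
  rw [mem_TT]
  simpa [mem_ZZ] using S.Om_sym hb h hz i

lemma sum_ww_cont {z : Fin n → ℝ} (i : Fin r) (h1 : ∀ j, z j = 0 → vv y y' i j = 0) :
    ContinuousAt (fun u => ∑ j, vv y y' i j * ww xb u j) z := by
  have : ∀ j, ContinuousAt (fun u : Fin n → ℝ => vv y y' i j * ww xb u j) z := by
    intro j
    by_cases hj : z j = 0
    · simp only [h1 j hj, zero_mul]; exact continuousAt_const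
    · unfold ww
      have h2 : ContinuousAt (fun u : Fin n → ℝ => Real.log (u j)) z :=
        (continuous_apply j).continuousAt.log hj
      exact continuousAt_const.mul (h2.sub continuousAt_const)
  exact tendsto_finsetSum _ (fun j _ => this j)

lemma Sys.select (S : Sys y y' k τ τm M x) (xb : Fin n → ℝ) : ∃ z ∈ Om x,
    (∀ z' ∈ Om x, (ZZ z).card ≤ (ZZ z').card) ∧
    ∃ ε > 0, ∀ z' ∈ Om x, dist z' z ≤ ε → ZZ z' = ZZ z ∧ eqset y y' xb z' = eqset y y' xb z := by
  classical
  let μ : (Fin n → ℝ) → ℕ := fun z => (ZZ z).card * (r + 1) + (eqset y y' xb z).card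
  have hex : ∃ m, ∃ z ∈ Om x, μ z = m := by
    obtain ⟨z, hz⟩ := S.Om_exists
    exact ⟨μ z, z, hz, rfl⟩
  obtain ⟨z, hz, hzm⟩ := Nat.find_spec hex
  have hmin : ∀ z' ∈ Om x, μ z ≤ μ z' := fun z' hz' => by
    rw [hzm]; exact Nat.find_min' hex ⟨z', hz', rfl⟩
  have hle : ∀ z', (eqset y y' xb z').card ≤ r := fun z' => by
    have := Finset.card_le_univ (eqset y y' xb z'); simpa using this
  have hcard : ∀ z' ∈ Om x, (ZZ z).card ≤ (ZZ z').card := by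
    intro z' hz'
    have h1 := hmin z' hz'
    simp only [μ] at h1
    by_contra hlt
    push Not at hlt
    have h2 := hle z'
    have h3 : ((ZZ z').card + 1) * (r + 1) ≤ (ZZ z).card * (r + 1) := Nat.mul_le_mul_right _ hlt
    nlinarith
  refine ⟨z, hz, hcard, ?_⟩
  have hev : ∀ᶠ z' in 𝓝 z, (∀ j, z j ≠ 0 → z' j ≠ 0) ∧
      ∀ i, (∀ j, z j = 0 → vv y y' i j = 0) → ∑ j, vv y y' i j * ww xb z j ≠ 0 →
        ∑ j, vv y y' i j * ww xb z' j ≠ 0 := by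
    apply Filter.Eventually.and
    · rw [Filter.eventually_all]
      intro j
      by_cases hj : z j = 0
      · simp [hj]
      · filter_upwards [(continuous_apply j).continuousAt.eventually_ne hj] with u hu _
        exact hu
    · rw [Filter.eventually_all]
      intro i
      by_cases h1 : (∀ j, z j = 0 → vv y y' i j = 0) ∧ ∑ j, vv y y' i j * ww xb z j ≠ 0
      · filter_upwards [(sum_ww_cont i h1.1).eventually_ne h1.2] with u hu _ _
        exact hu
      · filter_upwards with u h2 h3
        exact absurd ⟨h2, h3⟩ h1
  obtain ⟨ε, hε, hball⟩ := Metric.eventually_nhds_iff.1 hev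
  refine ⟨ε / 2, by positivity, fun z' hz' hd => ?_⟩
  obtain ⟨h1, h2⟩ := hball (lt_of_le_of_lt hd (by linarith))
  have hsub : ZZ z' ⊆ ZZ z := by
    intro j hj
    rw [mem_ZZ] at hj ⊢
    by_contra hne
    exact h1 j hne hj
  have hZ : ZZ z' = ZZ z := Finset.eq_of_subset_of_card_le hsub (hcard z' hz')
  refine ⟨hZ, ?_⟩
  have hzero : ∀ j, z' j = 0 ↔ z j = 0 := fun j => by rw [← mem_ZZ, hZ, mem_ZZ]
  apply Finset.eq_of_subset_of_card_le
  · intro i hi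
    simp only [eqset, Finset.mem_filter, Finset.mem_univ, true_and, hzero] at hi ⊢
    refine ⟨hi.1, ?_⟩
    by_contra hne
    exact h2 i hi.1 hne hi.2
  · have := hmin z' hz'
    simp only [μ, hZ] at this
    omega

/-- if all omega-limit points near z vanish on W then x_W is small near z -/
lemma Sys.small (S : Sys y y' k τ τm M x) {z : Fin n → ℝ} {ε : ℝ}
    (hZ : ∀ z' ∈ Om x, dist z' z ≤ ε → ZZ z' = ZZ z) {η : ℝ} (hη : 0 < η) :
    ∀ᶠ t in atTop, dist (x t) z ≤ ε → ∀ j ∈ ZZ z, x t j < η := by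
  by_contra hne
  rw [Filter.not_eventually] at hne
  have hcl : IsClosed {u : Fin n → ℝ | dist u z ≤ ε ∧ ∃ j ∈ ZZ z, η ≤ u j} := by
    apply IsClosed.inter
    · exact Metric.isClosed_closedBall (x := z) (ε := ε)
    · have : {u : Fin n → ℝ | ∃ j ∈ ZZ z, η ≤ u j} = ⋃ j ∈ ZZ z, {u | η ≤ u j} := by
        ext u; simp
      show IsClosed {u : Fin n → ℝ | ∃ j ∈ ZZ z, η ≤ u j}
      rw [this]
      exact isClosed_biUnion_finset fun j _ => isClosed_le continuous_const (continuous_apply j)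
  obtain ⟨z', hz', hK⟩ := S.Om_freq hcl (hne.mono fun t ht => by
    push Not at ht; exact ht)
  obtain ⟨hd, j, hj, hηj⟩ := hK
  have := hZ z' hz' hd
  rw [← this, mem_ZZ] at hj
  linarith

/-- lower bound on the boundary part of the Lyapunov functional -/
lemma Sys.Y_bound (S : Sys y y' k τ τm M x) {xh : Fin n → ℝ} (hh : ∀ j, 0 < xh j)
    (W : Finset (Fin n)) (T : Finset (Fin r)) (hT : ∀ i ∈ T, ∃ j ∈ W, y i j ≠ 0)
    (hW : ∀ j ∈ W, Tendsto (fun t => x t j) atTop (𝓝 0)) (L : ℝ) :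
    ∀ᶠ t in atTop, VV y k τ x xh W T t + L * ∑ j ∈ W, x t j ≤
      ∑ j ∈ W, xh j + ∑ i ∈ T, k i * (τ i * mono xh (y i)) := by
  have h1 : ∀ᶠ t in atTop, ∀ j ∈ W, FF (x t j) (xh j) + L * x t j ≤ xh j := by
    rw [Filter.eventually_all_finset]
    intro j hj
    have hp : 0 < Real.exp (Real.log (xh j) + 1 - L) := Real.exp_pos _
    filter_upwards [(hW j hj).eventually_lt_const hp] with t ht
    have h2 : Real.log (x t j) ≤ Real.log (xh j) + 1 - L := by
      rw [Real.log_le_iff_le_exp (S.pos t j)]; exact ht.le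
    unfold FF
    have := mul_le_mul_of_nonneg_left h2 (S.pos t j).le
    linarith
  have h2 : ∀ᶠ t in atTop, ∀ i ∈ T, mono (x t) (y i) ≤ mono xh (y i) := by
    rw [Filter.eventually_all_finset]
    intro i hi
    obtain ⟨j, hj, hij⟩ := hT i hi
    have : Tendsto (fun t => M ^ (∑ j, y i j) * x t j) atTop (𝓝 0) := by
      simpa using (hW j hj).const_mul (M ^ (∑ j, y i j))
    filter_upwards [this.eventually_lt_const (mono_pos' hh (y i))] with t ht
    exact (mono_le_mul S.hM (fun j => (S.pos t j).le) (S.bd t) (y i) j hij).trans ht.le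
  obtain ⟨t0, ht0⟩ := Filter.eventually_atTop.1 h2
  filter_upwards [h1, eventually_ge_atTop (t0 + τm)] with t ht htt
  unfold VV
  have e1 : ∑ j ∈ W, FF (x t j) (xh j) + L * ∑ j ∈ W, x t j ≤ ∑ j ∈ W, xh j := by
    rw [Finset.mul_sum, ← Finset.sum_add_distrib]
    exact Finset.sum_le_sum ht
  have e2 : ∑ i ∈ T, k i * Win (τ i) (fun s => FF (mono (x s) (y i)) (mono xh (y i))) t ≤
      ∑ i ∈ T, k i * (τ i * mono xh (y i)) := by
    apply Finset.sum_le_sum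
    intro i hi
    apply mul_le_mul_of_nonneg_left _ (S.hk i).le
    apply Win_le ((continuous_FF _).comp (S.contg _)) (S.hτ i)
    intro s hs
    have h3 := ht0 s (by linarith [hs.1, S.hτm i]) i hi
    have h4 := Real.log_le_log (S.gpos (y i) s) h3
    have h5 := mul_le_mul_of_nonneg_left h4 (S.gpos (y i) s).le
    have h6 := S.gpos (y i) s
    simp only [FF, Function.comp_apply]
    linarith
  linarith

lemma bdry_val {z xh : Fin n → ℝ} {W : Finset (Fin n)} (hzW : ∀ j ∈ W, z j = 0)
    {T : Finset (Fin r)} (hT : ∀ i ∈ T, ∃ j ∈ W, y i j ≠ 0) :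
    ∑ j ∈ W, FF (z j) (xh j) + ∑ i ∈ T, k i * (τ i * FF (mono z (y i)) (mono xh (y i))) =
      ∑ j ∈ W, xh j + ∑ i ∈ T, k i * (τ i * mono xh (y i)) := by
  congr 1
  · exact Finset.sum_congr rfl fun j hj => by simp [FF, hzW j hj]
  · apply Finset.sum_congr rfl
    intro i hi
    obtain ⟨j, hj, hij⟩ := hT i hi
    have : mono z (y i) = 0 := mono_eq_zero.2 ⟨j, hzW j hj, hij⟩
    simp [FF, this]

/-- the origin cannot be the limit -/
lemma Sys.not_origin (S : Sys y y' k τ τm M x) (hb : ∀ j, 0 < xb j) (h : CBf y y' k xb)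
    {z : Fin n → ℝ} (hz : z ∈ Om x) (hn : (ZZ z).Nonempty)
    (hcard : ∀ z' ∈ Om x, (ZZ z).card ≤ (ZZ z').card) : ZZ z ≠ univ := by
  intro hU
  have hlim : ∀ j, Tendsto (fun t => x t j) atTop (𝓝 0) := by
    intro j
    rw [Metric.tendsto_nhds]
    intro ε hε
    by_contra hne
    rw [Filter.not_eventually] at hne
    obtain ⟨z', hz', hK⟩ := S.Om_freq (K := {u | ε ≤ u j})
      (isClosed_le continuous_const (continuous_apply j)) (hne.mono fun t ht => by
        rw [Real.dist_eq, sub_zero, abs_of_pos (S.pos t j)] at ht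
        push Not at ht; exact ht)
    have h1 := hcard z' hz'
    rw [hU] at h1
    have h2 : ZZ z' = univ := by
      apply Finset.eq_of_subset_of_card_le (Finset.subset_univ _) h1
    have h3 : j ∈ ZZ z' := by rw [h2]; exact Finset.mem_univ _
    rw [mem_ZZ] at h3
    have : ε ≤ z' j := hK
    linarith
  have hx : Tendsto x atTop (𝓝 0) := tendsto_pi_nhds.2 (fun j => hlim j)
  have hT1 : ∀ i ∈ TT y univ, ∃ j ∈ (univ : Finset (Fin n)), y i j ≠ 0 := fun i hi => mem_TT.1 hi
  have hT2 : ∀ i, i ∈ TT y univ ↔ ∃ j ∈ (univ : Finset (Fin n)), y' i j ≠ 0 := by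
    intro i
    have := S.mem_TT' hb h hz i
    rwa [hU] at this
  have hlimV := S.VV_lim hb h xb univ (TT y univ) le_rfl hx
  rw [bdry_val (z := 0) (fun j _ => rfl) hT1] at hlimV
  have hanti : AntitoneOn (VV y k τ x xb univ (TT y univ)) (Set.Ici τm) := by
    refine anti_of_deriv (S.VV_cont _ _) (fun t ht => S.VV_der hb univ (TT y univ) ?_ ?_ t ht) ?_
    · intro i hi j _
      constructor
      · by_contra h0; exact hi (mem_TT.2 ⟨j, Finset.mem_univ _, h0⟩)
      · by_contra h0; exact hi ((hT2 i).2 ⟨j, Finset.mem_univ _, h0⟩)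
    · intro t
      exact h.hBW hb univ _ (fun i => mem_TT) hT2 (x t)
    · intro t _
      have : 0 ≤ ∑ i ∈ TT y univ, k i * FF (mono (x (t - τ i)) (y i)) (BB xb (y i) (y' i) (x t)) :=
        Finset.sum_nonneg fun i _ => S.DD_term_nonneg hb t i
      simp only [Finset.compl_univ, Finset.sum_empty]
      linarith
  have hY := S.Y_bound hb univ (TT y univ) hT1 (fun j _ => hlim j) 1
  obtain ⟨t0, h0, h1⟩ := (hY.and (eventually_ge_atTop τm)).exists
  have h2 : ∑ j, xb j + ∑ i ∈ TT y univ, k i * (τ i * mono xb (y i)) ≤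
      VV y k τ x xb univ (TT y univ) t0 := by
    apply le_of_tendsto hlimV
    filter_upwards [eventually_ge_atTop t0] with t ht
    exact hanti (Set.mem_Ici.2 h1) (Set.mem_Ici.2 (h1.trans ht)) ht
  obtain ⟨j, hj⟩ := hn
  have h3 : 0 < ∑ j, x t0 j := Finset.sum_pos (fun j _ => S.pos t0 j) ⟨j, Finset.mem_univ j⟩
  linarith

end Sel
open Topology

section LinAlg
variable {l : ℕ} {y y' : Fin r → Fin n → ℕ} {Sp : Fin l → Set (Fin n)} {grp : Fin r → Fin l}
  {W : Finset (Fin n)}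

lemma vv_mem (i : Fin r) : vv y y' i ∈ stoichOn y y' (Rgrp grp (grp i)) := by
  apply Submodule.subset_span
  exact ⟨i, by simp [Rgrp], rfl⟩

/-- mask to W -/
noncomputable def mask (W : Finset (Fin n)) : (Fin n → ℝ) →ₗ[ℝ] (Fin n → ℝ) where
  toFun v := fun j => if j ∈ W then v j else 0
  map_add' u v := by ext j; by_cases h : j ∈ W <;> simp [h]
  map_smul' c v := by ext j; by_cases h : j ∈ W <;> simp [h]

lemma mask_apply (v : Fin n → ℝ) (j : Fin n) : mask W v j = if j ∈ W then v j else 0 := rfl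

lemma edge_dir {p : Fin l} (h2 : Module.finrank ℝ (stoichOn y y' (Rgrp grp p)) = 2)
    (hv : ¬ VertexType (stoichOn y y' (Rgrp grp p)) (W : Set (Fin n))) :
    ∃ u : Fin n → ℝ, ∀ i, grp i = p → ∃ β : ℝ, ∀ j ∈ W, vv y y' i j = β * u j := by
  set V := stoichOn y y' (Rgrp grp p)
  unfold VertexType at hv
  push Not at hv
  obtain ⟨v0, hv0, hv0W, hne⟩ := hv
  set f := (mask W).domRestrict V
  have h1 := f.finrank_range_add_finrank_ker
  have h3 : 0 < Module.finrank ℝ (LinearMap.ker f) := by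
    refine Submodule.one_le_finrank_iff.2 (fun hbot => hne ?_)
    have hm : (⟨v0, hv0⟩ : V) ∈ LinearMap.ker f := by
      rw [LinearMap.mem_ker]
      ext j
      simp only [f, LinearMap.domRestrict_apply, mask_apply]
      split_ifs with hj
      · exact hv0W j hj
      · rfl
    rw [hbot, Submodule.mem_bot] at hm
    simpa using congrArg (fun a : V => (a : Fin n → ℝ)) hm
  have h4 : Module.finrank ℝ (LinearMap.range f) ≤ 1 := by omega
  rw [finrank_le_one_iff] at h4
  obtain ⟨u, hu⟩ := h4
  refine ⟨u, fun i hi => ?_⟩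
  have hm : vv y y' i ∈ V := by
    have := vv_mem (y := y) (y' := y') (grp := grp) i
    rwa [hi] at this
  obtain ⟨c, hc⟩ := hu ⟨f ⟨vv y y' i, hm⟩, LinearMap.mem_range_self _ _⟩
  refine ⟨c, fun j hj => ?_⟩
  have := congrArg (fun a : LinearMap.range f => (a : Fin n → ℝ) j) hc
  simp only [f, Submodule.coe_smul, Pi.smul_apply, smul_eq_mul, LinearMap.domRestrict_apply,
    mask_apply, if_pos hj] at this
  exact this.symm

lemma vertex_dual {p : Fin l} (hv : VertexType (stoichOn y y' (Rgrp grp p)) (W : Set (Fin n)))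
    (q : Fin n → ℝ) : ∃ m : Fin n → ℝ, ∀ v ∈ stoichOn y y' (Rgrp grp p),
      ∑ j ∈ W, m j * v j + ∑ j ∈ Wᶜ, q j * v j = 0 := by
  set V := stoichOn y y' (Rgrp grp p)
  set f := (mask W).domRestrict V
  have hker : LinearMap.ker f = ⊥ := by
    rw [LinearMap.ker_eq_bot']
    intro v hv'
    have : (v : Fin n → ℝ) = 0 := hv v v.2 (fun j hj => by
      have := congrFun hv' j
      simp only [f, LinearMap.domRestrict_apply, mask_apply] at this
      rw [if_pos (by exact_mod_cast hj)] at this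
      exact this)
    exact Subtype.ext this
  obtain ⟨g, hg⟩ := f.exists_leftInverse_of_injective hker
  let lam : (Fin n → ℝ) →ₗ[ℝ] ℝ := ∑ j ∈ Wᶜ, (-q j) • LinearMap.proj j
  let m := lam ∘ₗ V.subtype ∘ₗ g
  refine ⟨fun j => m (Pi.single j 1), fun v hvV => ?_⟩
  have h1 : m (mask W v) = lam v := by
    have : g (f ⟨v, hvV⟩) = ⟨v, hvV⟩ := LinearMap.congr_fun hg _
    have e : f ⟨v, hvV⟩ = mask W v := rfl
    simp only [m, LinearMap.comp_apply]
    rw [← e, this]; rfl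
  have h2 : m (mask W v) = ∑ j ∈ W, m (Pi.single j 1) * v j := by
    have e : mask W v = ∑ j, (mask W v j) • (Pi.single j (1:ℝ) : Fin n → ℝ) :=
      pi_eq_sum_univ' _
    rw [e, map_sum]
    simp only [map_smul, smul_eq_mul, mask_apply]
    simp only [ite_mul, zero_mul]
    rw [← Finset.sum_filter]
    simp [mul_comm]
  have h3 : lam v = - ∑ j ∈ Wᶜ, q j * v j := by
    simp [lam, LinearMap.sum_apply, Finset.sum_neg_distrib]
  rw [← h2, h1, h3]; ring

/-- Lemma Q -/
lemma lemmaQ (hcov : ∀ j, ∃ p, j ∈ Sp p) (hS : ∀ i j, (y i j ≠ 0 ∨ y' i j ≠ 0) → j ∈ Sp (grp i))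
    (hWc : ∀ j ∈ W, ∀ p q, j ∈ Sp p → j ∈ Sp q → p = q) (q : Fin n → ℝ) :
    ∃ qh : Fin n → ℝ, (∀ j ∉ W, qh j = q j) ∧ ∀ i,
      VertexType (stoichOn y y' (Rgrp grp (grp i))) (W : Set (Fin n)) →
        ∑ j, qh j * vv y y' i j = 0 := by
  classical
  have h1 : ∀ p : Fin l, ∃ m : Fin n → ℝ,
      VertexType (stoichOn y y' (Rgrp grp p)) (W : Set (Fin n)) →
      ∀ v ∈ stoichOn y y' (Rgrp grp p), ∑ j ∈ W, m j * v j + ∑ j ∈ Wᶜ, q j * v j = 0 := by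
    intro p
    by_cases hv : VertexType (stoichOn y y' (Rgrp grp p)) (W : Set (Fin n))
    · obtain ⟨m, hm⟩ := vertex_dual hv q
      exact ⟨m, fun _ => hm⟩
    · exact ⟨0, fun h => absurd h hv⟩
  choose m hm using h1
  choose pj hpj using hcov
  refine ⟨fun j => if j ∈ W then m (pj j) j else q j, fun j hj => by simp [hj], fun i hv => ?_⟩
  have h2 := hm (grp i) hv (vv y y' i) (vv_mem i)
  rw [← Finset.sum_add_sum_compl W, ← h2]
  congr 1
  · apply Finset.sum_congr rfl
    intro j hj
    beta_reduce
    rw [if_pos hj]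
    by_cases h0 : vv y y' i j = 0
    · simp [h0]
    · have : j ∈ Sp (grp i) := by
        apply hS
        by_contra hc
        push Not at hc
        exact h0 (by simp [vv, hc.1, hc.2])
      rw [hWc j hj _ _ (hpj j) this]
  · apply Finset.sum_congr rfl
    intro j hj
    beta_reduce
    rw [if_neg (Finset.mem_compl.1 hj)]

end LinAlg

section Edge
variable {l : ℕ} {y y' : Fin r → Fin n → ℕ} {Sp : Fin l → Set (Fin n)} {grp : Fin r → Fin l}
variable {k τ : Fin r → ℝ} {τm M : ℝ} {x : ℝ → Fin n → ℝ} {xb : Fin n → ℝ}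

lemma Sys.XX_zero (S : Sys y y' k τ τm M x) (hb : ∀ j, 0 < xb j) (h : CBf y y' k xb)
    {U : Filter ℝ} (hU : U ≤ atTop) {z : Fin n → ℝ} (hz : Tendsto x U (𝓝 z)) {j : Fin n}
    (hj : z j = 0) : Tendsto (fun t => XX y k τ x t j) U (𝓝 0) := by
  have h1 := S.XX_lim hb h hU hz j
  have e : z j + ∑ i, k i * (y i j : ℝ) * (τ i * mono z (y i)) = 0 := by
    rw [hj, zero_add]
    apply Finset.sum_eq_zero
    intro i _
    by_cases hij : y i j = 0
    · simp [hij]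
    · rw [mono_eq_zero.2 ⟨j, hj, hij⟩]; ring
  rwa [e] at h1

/-- linear combination of XX with vanishing production stays zero if it tends to zero -/
lemma Sys.XX_conserved (S : Sys y y' k τ τm M x) (hb : ∀ j, 0 < xb j) (h : CBf y y' k xb)
    {z : Fin n → ℝ} (hz : z ∈ Om x) {j j' : Fin n} (hj : z j = 0) (hj' : z j' = 0) {a b : ℝ}
    (hv : ∀ i, a * vv y y' i j + b * vv y y' i j' = 0) {t : ℝ} (ht : τm ≤ t) :
    a * XX y k τ x t j + b * XX y k τ x t j' = 0 := by
  obtain ⟨U, hn, hU, hx⟩ := Om_ultra hz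
  set F : ℝ → ℝ := fun t => a * XX y k τ x t j + b * XX y k τ x t j'
  have hd : ∀ t > τm, HasDerivAt F 0 t := by
    intro t ht
    have := ((S.XX_der j t ht).const_mul a).add ((S.XX_der j' t ht).const_mul b)
    refine this.congr_deriv ?_
    rw [Finset.mul_sum, Finset.mul_sum, ← Finset.sum_add_distrib]
    apply Finset.sum_eq_zero
    intro i _
    have := hv i
    unfold vv at this
    calc _ = k i * mono (x (t - τ i)) (y i) * (a * ((y' i j : ℝ) - (y i j : ℝ)) +
          b * ((y' i j' : ℝ) - (y i j' : ℝ))) := by ring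
      _ = 0 := by rw [this, mul_zero]
  have hc : Continuous F := by
    have h1 := S.XX_cont j
    have h2 := S.XX_cont j'
    fun_prop
  have h1 := mono_of_deriv hc hd (fun _ _ => le_rfl)
  have h2 := anti_of_deriv hc hd (fun _ _ => le_rfl)
  have hlim : Tendsto F U (𝓝 0) := by
    simpa using ((S.XX_zero hb h hU hx hj).const_mul a).add ((S.XX_zero hb h hU hx hj').const_mul b)
  have hconst : Tendsto F U (𝓝 (F t)) := by
    apply tendsto_const_nhds.congr'
    filter_upwards [hU (eventually_ge_atTop t)] with s hs
    exact le_antisymm (h1 (Set.mem_Ici.2 ht) (Set.mem_Ici.2 (ht.trans hs)) hs)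
      (h2 (Set.mem_Ici.2 ht) (Set.mem_Ici.2 (ht.trans hs)) hs)
  exact tendsto_nhds_unique hconst hlim

/-- structure of edge-type groups -/
lemma Sys.edge_data (S : Sys y y' k τ τm M x) (hb : ∀ j, 0 < xb j) (h : CBf y y' k xb)
    {z : Fin n → ℝ} (hz : z ∈ Om x)
    (hS : ∀ i j, (y i j ≠ 0 ∨ y' i j ≠ 0) → j ∈ Sp (grp i))
    (hWc : ∀ j ∈ ZZ z, ∀ p q, j ∈ Sp p → j ∈ Sp q → p = q) {p : Fin l}
    (h2 : Module.finrank ℝ (stoichOn y y' (Rgrp grp p)) = 2)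
    (hv : ¬ VertexType (stoichOn y y' (Rgrp grp p)) (ZZ z : Set (Fin n))) :
    ∃ u : Fin n → ℝ, (∀ i, grp i = p → ∃ β : ℝ, ∀ j ∈ ZZ z, vv y y' i j = β * u j) ∧
      (∀ j ∈ ZZ z, ∀ j' ∈ ZZ z, j ∈ Sp p → j' ∈ Sp p → 0 < u j * u j' ∧
        ∀ t, τm ≤ t → u j' * XX y k τ x t j = u j * XX y k τ x t j') := by
  obtain ⟨u, hu⟩ := edge_dir h2 hv
  have hzero : ∀ j ∈ ZZ z, j ∈ Sp p → ∀ i, grp i ≠ p → vv y y' i j = 0 := by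
    intro j hj hjp i hi
    by_contra h0
    apply hi
    apply hWc j hj _ _ _ hjp
    apply hS
    by_contra hc
    push Not at hc
    exact h0 (by simp [vv, hc.1, hc.2])
  have hXpos : ∀ t j, 0 < XX y k τ x t j := fun t j => (S.pos t j).trans_le (S.le_XX j t)
  have hrel : ∀ j ∈ ZZ z, ∀ j' ∈ ZZ z, j ∈ Sp p → j' ∈ Sp p → ∀ t, τm ≤ t →
      u j' * XX y k τ x t j = u j * XX y k τ x t j' := by
    intro j hj j' hj' hjp hjp' t ht
    have := S.XX_conserved hb h hz (mem_ZZ.1 hj) (mem_ZZ.1 hj') (a := u j') (b := -u j)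
      (fun i => by
        by_cases hi : grp i = p
        · obtain ⟨β, hβ⟩ := hu i hi
          rw [hβ j hj, hβ j' hj']; ring
        · rw [hzero j hj hjp i hi, hzero j' hj' hjp' i hi]; ring) ht
    linarith
  have hne : ∀ j ∈ ZZ z, j ∈ Sp p → u j ≠ 0 := by
    intro j hj hjp h0
    have := S.XX_conserved hb h hz (mem_ZZ.1 hj) (mem_ZZ.1 hj) (a := 1) (b := 0)
      (fun i => by
        by_cases hi : grp i = p
        · obtain ⟨β, hβ⟩ := hu i hi
          rw [hβ j hj, h0]; ring
        · rw [hzero j hj hjp i hi]; ring) (le_refl τm)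
    have := hXpos τm j
    linarith
  refine ⟨u, hu, fun j hj j' hj' hjp hjp' => ⟨?_, hrel j hj j' hj' hjp hjp'⟩⟩
  have h3 := hrel j hj j' hj' hjp hjp' τm le_rfl
  have h4 : (u j * u j') * XX y k τ x τm j = u j ^ 2 * XX y k τ x τm j' := by
    rw [mul_assoc, h3]; ring
  have h5 : 0 < u j ^ 2 * XX y k τ x τm j' := by
    have := hne j hj hjp
    have := hXpos τm j'
    positivity
  rw [← h4] at h5
  exact (pos_iff_pos_of_mul_pos h5).2 (hXpos τm j)

lemma Sys.edge_sign (S : Sys y y' k τ τm M x) (hb : ∀ j, 0 < xb j) (h : CBf y y' k xb)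
    {z : Fin n → ℝ} (hz : z ∈ Om x)
    (hS : ∀ i j, (y i j ≠ 0 ∨ y' i j ≠ 0) → j ∈ Sp (grp i))
    (hWc : ∀ j ∈ ZZ z, ∀ p q, j ∈ Sp p → j ∈ Sp q → p = q) {i : Fin r}
    (h2 : Module.finrank ℝ (stoichOn y y' (Rgrp grp (grp i))) = 2)
    (hv : ¬ VertexType (stoichOn y y' (Rgrp grp (grp i))) (ZZ z : Set (Fin n))) :
    (∀ j ∈ ZZ z, 0 ≤ vv y y' i j) ∨ (∀ j ∈ ZZ z, vv y y' i j ≤ 0) := by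
  obtain ⟨u, hu, hr⟩ := S.edge_data hb h hz hS hWc h2 hv
  by_contra hc
  push Not at hc
  obtain ⟨⟨j, hj, h1⟩, j', hj', h1'⟩ := hc
  have hm : ∀ j, vv y y' i j ≠ 0 → j ∈ Sp (grp i) := by
    intro j h0
    apply hS
    by_contra hc
    push Not at hc
    exact h0 (by simp [vv, hc.1, hc.2])
  obtain ⟨β, hβ⟩ := hu i rfl
  have h3 := (hr j hj j' hj' (hm j h1.ne) (hm j' h1'.ne')).1
  rw [hβ j hj] at h1
  rw [hβ j' hj'] at h1'
  have h4 := mul_neg_of_neg_of_pos h1 h1'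
  have : β * u j * (β * u j') = β^2 * (u j * u j') := by ring
  rw [this] at h4
  have : 0 ≤ β^2 * (u j * u j') := by positivity
  linarith

lemma Sys.edge_comp (S : Sys y y' k τ τm M x) (hb : ∀ j, 0 < xb j) (h : CBf y y' k xb)
    {z : Fin n → ℝ} (hz : z ∈ Om x)
    (hS : ∀ i j, (y i j ≠ 0 ∨ y' i j ≠ 0) → j ∈ Sp (grp i))
    (hWc : ∀ j ∈ ZZ z, ∀ p q, j ∈ Sp p → j ∈ Sp q → p = q) {p : Fin l}
    (h2 : Module.finrank ℝ (stoichOn y y' (Rgrp grp p)) = 2)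
    (hv : ¬ VertexType (stoichOn y y' (Rgrp grp p)) (ZZ z : Set (Fin n)))
    {j j' : Fin n} (hj : j ∈ ZZ z) (hj' : j' ∈ ZZ z) (hjp : j ∈ Sp p) (hjp' : j' ∈ Sp p) :
    ∃ C > 0, ∀ t, 2 * τm ≤ t → x t j ≤ C * x t j' := by
  obtain ⟨u, hu, hr⟩ := S.edge_data hb h hz hS hWc h2 hv
  obtain ⟨C, hC1, hC⟩ := S.XX_le
  obtain ⟨h3, h4⟩ := hr j hj j' hj' hjp hjp'
  have hne : u j' ≠ 0 := by rintro h0; rw [h0] at h3; simp at h3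
  have hq : 0 < u j / u j' := by
    have : u j / u j' = (u j * u j') / (u j')^2 := by field_simp
    rw [this]; positivity
  refine ⟨u j / u j' * C, by positivity, fun t ht => ?_⟩
  have h5 := h4 t (by linarith [S.hτm0])
  have h6 : XX y k τ x t j = u j / u j' * XX y k τ x t j' := by
    field_simp; linarith
  calc x t j ≤ XX y k τ x t j := S.le_XX j t
    _ = u j / u j' * XX y k τ x t j' := h6
    _ ≤ u j / u j' * (C * x t j') := mul_le_mul_of_nonneg_left (hC j' t ht) hq.le
    _ = _ := by ring

end Edge
open Topology

lemma log_mono0 {x : Fin n → ℝ} {y : Fin n → ℕ} (hx : ∀ j, x j = 0 → y j = 0) :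
    Real.log (mono x y) = ∑ j, (y j : ℝ) * Real.log (x j) := by
  unfold mono
  rw [Real.log_prod]
  · exact Finset.sum_congr rfl fun j _ => by rw [Real.log_pow]
  · intro j _
    by_cases h : x j = 0
    · rw [hx j h]; simp
    · exact pow_ne_zero _ h

lemma ww_atBot {xb z : Fin n → ℝ} (hb : ∀ j, 0 < xb j) (v : Fin n → ℝ)
    (hv : ∀ j, z j = 0 → 0 ≤ v j) {j1 : Fin n} (hz1 : z j1 = 0) (hv1 : 0 < v j1) :
    ∀ᶠ u in 𝓝 z, (∀ j, 0 < u j) → ∑ j, v j * ww xb u j ≤ -1 := by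
  classical
  have h1 : ∀ j, ∃ B : ℝ, ∀ᶠ u in 𝓝 z, (∀ j, 0 < u j) → v j * ww xb u j ≤ B := by
    intro j
    by_cases hj : z j = 0
    · refine ⟨0, ?_⟩
      have hc : Tendsto (fun u : Fin n → ℝ => u j) (𝓝 z) (𝓝 (z j)) := (continuous_apply j).tendsto z
      rw [hj] at hc
      filter_upwards [hc.eventually_lt_const (hb j)] with u hu hp
      have := Real.log_le_log (hp j) hu.le
      have h2 : ww xb u j ≤ 0 := by unfold ww; linarith
      exact mul_nonpos_of_nonneg_of_nonpos (hv j hj) h2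
    · refine ⟨v j * ww xb z j + 1, ?_⟩
      have h2 : ContinuousAt (fun u : Fin n → ℝ => Real.log (u j)) z :=
        (continuous_apply j).continuousAt.log hj
      have h3 : ContinuousAt (fun u : Fin n → ℝ => v j * ww xb u j) z :=
        continuousAt_const.mul (h2.sub continuousAt_const)
      filter_upwards [h3.eventually_lt_const (lt_add_one (v j * ww xb z j))] with u hu _
      exact hu.le
  choose B hB using h1
  have hc : Tendsto (fun u : Fin n → ℝ => u j1) (𝓝 z) (𝓝 (z j1)) := (continuous_apply j1).tendsto z
  rw [hz1] at hc
  set E := Real.exp ((-1 - ∑ j ∈ univ.erase j1, B j) / v j1 + Real.log (xb j1))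
  filter_upwards [hc.eventually_lt_const (Real.exp_pos _ : 0 < E), Filter.eventually_all.2 hB]
    with u hu hB' hp
  rw [← Finset.add_sum_erase _ _ (Finset.mem_univ j1)]
  have h4 : ∑ j ∈ univ.erase j1, v j * ww xb u j ≤ ∑ j ∈ univ.erase j1, B j :=
    Finset.sum_le_sum fun j _ => hB' j hp
  have h5 : ww xb u j1 ≤ (-1 - ∑ j ∈ univ.erase j1, B j) / v j1 := by
    have := (Real.log_le_iff_le_exp (hp j1)).2 hu.le
    unfold ww; linarith
  have h6 := mul_le_mul_of_nonneg_left h5 hv1.le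
  rw [mul_div_cancel₀ _ hv1.ne'] at h6
  linarith

section Trap
variable {l : ℕ} {y y' : Fin r → Fin n → ℕ} {Sp : Fin l → Set (Fin n)} {grp : Fin r → Fin l}
variable {k τ : Fin r → ℝ} {τm M : ℝ} {x : ℝ → Fin n → ℝ} {xb : Fin n → ℝ}

lemma mem_eqset {z : Fin n → ℝ} {i : Fin r} : i ∈ eqset y y' xb z ↔
    (∀ j, z j = 0 → vv y y' i j = 0) ∧ ∑ j, vv y y' i j * ww xb z j = 0 := by
  simp [eqset]

lemma Sys.eq_of_not_TT (S : Sys y y' k τ τm M x) (hb : ∀ j, 0 < xb j) (h : CBf y y' k xb)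
    {z : Fin n → ℝ} (hz : z ∈ Om x) {i : Fin r} (hi : i ∉ TT y (ZZ z)) :
    i ∈ eqset y y' xb z := by
  have h1 : ∀ j, z j = 0 → y i j = 0 := fun j hj => by
    by_contra h0; exact hi (mem_TT.2 ⟨j, mem_ZZ.2 hj, h0⟩)
  have h2 : ∀ j, z j = 0 → y' i j = 0 := fun j hj => by
    by_contra h0; exact hi ((S.mem_TT' hb h hz i).2 ⟨j, mem_ZZ.2 hj, h0⟩)
  rw [mem_eqset]
  refine ⟨fun j hj => by simp [vv, h1 j hj, h2 j hj], ?_⟩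
  have hbal := S.Om_bal hb h hz i
  have hne : mono z (y' i) ≠ 0 := by
    intro h0
    obtain ⟨j, hj, hj'⟩ := mono_eq_zero.1 h0
    exact hj' (h2 j hj)
  have e1 := mono_pos' hb (y i)
  have e2 := mono_pos' hb (y' i)
  have hl := congrArg Real.log hbal
  unfold BB at hl
  rw [Real.log_div (by positivity) e2.ne', Real.log_mul hne e1.ne', log_mono0 h1, log_mono0 h2,
    log_mono hb, log_mono hb] at hl
  have : ∑ j, vv y y' i j * ww xb z j = ∑ j, (y' i j : ℝ) * Real.log (z j)
      - ∑ j, (y i j : ℝ) * Real.log (z j) + ∑ j, (y i j : ℝ) * Real.log (xb j)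
      - ∑ j, (y' i j : ℝ) * Real.log (xb j) := by
    rw [← Finset.sum_sub_distrib, ← Finset.sum_add_distrib, ← Finset.sum_sub_distrib]
    apply Finset.sum_congr rfl
    intro j _
    unfold vv ww; ring
  rw [this]; linarith

/-- gap -/
lemma gap_of {z : Fin n → ℝ} (hb : ∀ j, 0 < xb j) (i : Fin r) {a : ℝ} (ha : 0 < a)
    (h : (∀ᶠ u in 𝓝 z, (∀ j, 0 < u j) → ∑ j, vv y y' i j * ww xb u j ≤ -a) ∨
      (∀ᶠ u in 𝓝 z, (∀ j, 0 < u j) → a ≤ ∑ j, vv y y' i j * ww xb u j)) :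
    ∃ R : ℝ, 0 < R ∧ R ≠ 1 ∧ ∀ᶠ u in 𝓝 z, (∀ j, 0 < u j) →
      (1 ≤ R ∧ R * mono u (y i) ≤ BB xb (y i) (y' i) u) ∨
        (R ≤ 1 ∧ BB xb (y i) (y' i) u ≤ R * mono u (y i)) := by
  rcases h with h | h
  · refine ⟨Real.exp (-a), Real.exp_pos _, (show Real.exp (-a) < 1 from Real.exp_zero ▸ Real.exp_lt_exp.2 (by linarith)).ne, ?_⟩
    filter_upwards [h] with u hu hp
    refine Or.inr ⟨(show Real.exp (-a) < 1 from Real.exp_zero ▸ Real.exp_lt_exp.2 (by linarith)).le, ?_⟩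
    rw [BB_eq_exp hb hp, mul_comm]
    exact mul_le_mul_of_nonneg_right (Real.exp_le_exp.2 (hu hp)) (mono_pos' hp _).le
  · refine ⟨Real.exp a, Real.exp_pos _, (Real.one_lt_exp_iff.2 ha).ne', ?_⟩
    filter_upwards [h] with u hu hp
    refine Or.inl ⟨(Real.one_lt_exp_iff.2 ha).le, ?_⟩
    rw [BB_eq_exp hb hp, mul_comm (mono u (y i))]
    exact mul_le_mul_of_nonneg_right (Real.exp_le_exp.2 (hu hp)) (mono_pos' hp _).le

lemma Sys.gap (S : Sys y y' k τ τm M x) (hb : ∀ j, 0 < xb j) (h : CBf y y' k xb)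
    {z : Fin n → ℝ} (hz : z ∈ Om x)
    (hS : ∀ i j, (y i j ≠ 0 ∨ y' i j ≠ 0) → j ∈ Sp (grp i))
    (hWc : ∀ j ∈ ZZ z, ∀ p q, j ∈ Sp p → j ∈ Sp q → p = q) {i : Fin r}
    (h2 : Module.finrank ℝ (stoichOn y y' (Rgrp grp (grp i))) = 2)
    (hv : ¬ VertexType (stoichOn y y' (Rgrp grp (grp i))) (ZZ z : Set (Fin n)))
    (hi : i ∉ eqset y y' xb z) :
    ∃ R : ℝ, 0 < R ∧ R ≠ 1 ∧ ∀ᶠ u in 𝓝 z, (∀ j, 0 < u j) →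
      (1 ≤ R ∧ R * mono u (y i) ≤ BB xb (y i) (y' i) u) ∨
        (R ≤ 1 ∧ BB xb (y i) (y' i) u ≤ R * mono u (y i)) := by
  by_cases h0 : ∀ j, z j = 0 → vv y y' i j = 0
  · have hc := sum_ww_cont (xb := xb) i h0
    have hne : ∑ j, vv y y' i j * ww xb z j ≠ 0 := fun h1 => hi (mem_eqset.2 ⟨h0, h1⟩)
    rcases lt_or_gt_of_ne hne with hlt | hgt
    · refine gap_of hb i (a := -(∑ j, vv y y' i j * ww xb z j) / 2) (by linarith) (Or.inl ?_)
      filter_upwards [hc.eventually_lt_const (show ∑ j, vv y y' i j * ww xb z j <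
        (∑ j, vv y y' i j * ww xb z j) / 2 by linarith)] with u hu _
      linarith
    · refine gap_of hb i (a := (∑ j, vv y y' i j * ww xb z j) / 2) (by linarith) (Or.inr ?_)
      filter_upwards [hc.eventually_const_lt (show (∑ j, vv y y' i j * ww xb z j) / 2 <
        (∑ j, vv y y' i j * ww xb z j) by linarith)] with u hu _
      linarith
  · push Not at h0
    obtain ⟨j1, hj1, hne⟩ := h0
    rcases S.edge_sign hb h hz hS hWc h2 hv with hs | hs
    · refine gap_of hb i one_pos (Or.inl ?_)
      exact ww_atBot hb _ (fun j hj => hs j (mem_ZZ.2 hj)) hj1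
        (lt_of_le_of_ne (hs j1 (mem_ZZ.2 hj1)) hne.symm)
    · refine gap_of hb i one_pos (Or.inr ?_)
      have := ww_atBot hb (fun j => - vv y y' i j) (fun j hj => by
        have := hs j (mem_ZZ.2 hj); simp only [Left.nonneg_neg_iff]; exact this) hj1
        (by have := lt_of_le_of_ne (hs j1 (mem_ZZ.2 hj1)) hne; simp only [Left.neg_pos_iff]; exact this)
      filter_upwards [this] with u hu hp
      have := hu hp
      simp only [neg_mul, Finset.sum_neg_distrib] at this
      linarith

lemma escape {x : ℝ → Fin n → ℝ} (hc : Continuous x) {z : Fin n → ℝ} (hz : z ∈ Om x) {ε : ℝ}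
    (hε : 0 < ε) (hf : ¬ ∀ᶠ t in atTop, dist (x t) z < ε) (N : ℕ) :
    ∃ t0 t1 : ℝ, (N : ℝ) ≤ t0 ∧ t0 ≤ t1 ∧ dist (x t0) z < 1 / ((N : ℝ) + 1) ∧ dist (x t1) z = ε ∧
      ∀ t ∈ Set.Icc t0 t1, dist (x t) z ≤ ε := by
  have hδ : 0 < min ε (1 / ((N : ℝ) + 1)) := lt_min hε (by positivity)
  have h1 : ∃ᶠ t in atTop, dist (x t) z < min ε (1 / ((N : ℝ) + 1)) :=
    (mapClusterPt_iff_frequently.1 hz) _ (Metric.ball_mem_nhds z hδ)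
  obtain ⟨t0, ht0, hN⟩ := (h1.and_eventually (eventually_ge_atTop (N : ℝ))).exists
  rw [Filter.not_eventually] at hf
  obtain ⟨t2, ht2, h02⟩ := (hf.and_eventually (eventually_ge_atTop t0)).exists
  push Not at ht2
  have hcd : Continuous (fun t => dist (x t) z) := hc.dist continuous_const
  have hK : IsCompact (Set.Icc t0 t2 ∩ {t | ε ≤ dist (x t) z}) :=
    isCompact_Icc.inter_right (isClosed_le continuous_const hcd)
  obtain ⟨t1, ⟨⟨h01, h12⟩, hε1⟩, hleast⟩ := hK.exists_isLeast ⟨t2, ⟨h02, le_rfl⟩, ht2⟩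
  have hε1 : ε ≤ dist (x t1) z := hε1
  have hlt0 : dist (x t0) z < ε := ht0.trans_le (min_le_left _ _)
  obtain ⟨s, hs, hse⟩ := intermediate_value_Icc h01 hcd.continuousOn ⟨hlt0.le, hε1⟩
  have hs1 : t1 ≤ s := hleast ⟨⟨hs.1, hs.2.trans h12⟩, hse.ge⟩
  have : s = t1 := le_antisymm hs.2 hs1
  subst this
  refine ⟨t0, s, hN, h01, ht0.trans_le (min_le_right _ _), hse, fun t ht => ?_⟩
  by_contra hgt
  push Not at hgt
  have h3 : s ≤ t := hleast ⟨⟨ht.1, ht.2.trans h12⟩, hgt.le⟩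
  have : t = s := le_antisymm ht.2 h3
  subst this
  have : dist (x t) z = ε := hse
  linarith

end Trap
open Topology
section Trap2
variable {l : ℕ} {y y' : Fin r → Fin n → ℕ} {Sp : Fin l → Set (Fin n)} {grp : Fin r → Fin l}
variable {k τ : Fin r → ℝ} {τm M : ℝ} {x : ℝ → Fin n → ℝ} {xb : Fin n → ℝ}

lemma Sys.G_est (S : Sys y y' k τ τm M x) (hb : ∀ j, 0 < xb j) (h : CBf y y' k xb)
    (qh : Fin n → ℝ) (Bad : Finset (Fin r)) (R : Fin r → ℝ)
    (hq : ∀ i ∉ Bad, ∑ j, qh j * vv y y' i j = 0) (hR : ∀ i ∈ Bad, 0 < R i ∧ R i ≠ 1)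
    {t0 t1 : ℝ} (h0 : τm ≤ t0) (h01 : t0 ≤ t1)
    (hg : ∀ t ∈ Set.Icc t0 t1, ∀ i ∈ Bad,
      (1 ≤ R i ∧ R i * mono (x t) (y i) ≤ BB xb (y i) (y' i) (x t)) ∨
        (R i ≤ 1 ∧ BB xb (y i) (y' i) (x t) ≤ R i * mono (x t) (y i))) :
    ∑ j, qh j * XX y k τ x t1 j - ∑ j, qh j * XX y k τ x t0 j ≤
      (∑ i ∈ Bad, |∑ j, qh j * vv y y' i j| / (R i - 1 - Real.log (R i))) *
        (VV y k τ x xb univ univ t0 - VV y k τ x xb univ univ t1) +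
      ∑ i ∈ Bad, (|∑ j, qh j * vv y y' i j| / (R i - 1 - Real.log (R i))) * (k i * (R i - 1)) *
        (Win (τ i) (fun s => mono (x s) (y i)) t0 - Win (τ i) (fun s => mono (x s) (y i)) t1) := by
  set κ : Fin r → ℝ := fun i => |∑ j, qh j * vv y y' i j| / (R i - 1 - Real.log (R i)) with hκ
  have hκ0 : ∀ i ∈ Bad, 0 ≤ κ i := fun i hi =>
    div_nonneg (abs_nonneg _) (gap_pos (hR i hi).1 (hR i hi).2).le
  set H : ℝ → ℝ := fun t => -(∑ i ∈ Bad, κ i) * VV y k τ x xb univ univ t -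
    ∑ i ∈ Bad, κ i * (k i * (R i - 1)) * Win (τ i) (fun s => mono (x s) (y i)) t -
    ∑ j, qh j * XX y k τ x t j with hH
  have hc : Continuous H := by
    have h1 := S.VV_cont (xh := xb) univ univ
    have h2 : ∀ i, Continuous (Win (τ i) (fun s => mono (x s) (y i))) := fun i =>
      continuous_Win (S.contg _) _
    have h3 := S.XX_cont
    fun_prop
  have hd : ∀ t, t0 < t → t < t1 → HasDerivAt H ((∑ i ∈ Bad, κ i) * DD y y' k τ x xb t -
      ∑ i ∈ Bad, κ i * (k i * (R i - 1)) * (mono (x t) (y i) - mono (x (t - τ i)) (y i)) -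
      ∑ j, qh j * ∑ i, k i * mono (x (t - τ i)) (y i) * ((y' i j : ℝ) - (y i j : ℝ))) t := by
    intro t ht _
    have h1 := (S.V_der hb h t (by linarith)).const_mul (-(∑ i ∈ Bad, κ i))
    have h2 : HasDerivAt (fun t => ∑ i ∈ Bad, κ i * (k i * (R i - 1)) *
        Win (τ i) (fun s => mono (x s) (y i)) t) (∑ i ∈ Bad, κ i * (k i * (R i - 1)) *
        (mono (x t) (y i) - mono (x (t - τ i)) (y i))) t :=
      HasDerivAt.fun_sum fun i _ => (hasDerivAt_Win (S.contg (y i)) (τ i) t).const_mul _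
    have h3 : HasDerivAt (fun t => ∑ j, qh j * XX y k τ x t j)
        (∑ j, qh j * ∑ i, k i * mono (x (t - τ i)) (y i) * ((y' i j : ℝ) - (y i j : ℝ))) t :=
      HasDerivAt.fun_sum fun j _ => (S.XX_der j t (by linarith)).const_mul _
    refine ((h1.sub h2).sub h3).congr_deriv ?_
    ring
  have hmain := mono_of_deriv_Icc h01 hc hd (fun t ht ht1 => by
    have e1 : ∑ j, qh j * ∑ i, k i * mono (x (t - τ i)) (y i) * ((y' i j : ℝ) - (y i j : ℝ)) =
        ∑ i, k i * mono (x (t - τ i)) (y i) * ∑ j, qh j * vv y y' i j := by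
      simp_rw [Finset.mul_sum]
      rw [Finset.sum_comm]
      apply Finset.sum_congr rfl; intro i _
      apply Finset.sum_congr rfl; intro j _
      unfold vv; ring
    have e2 : ∑ i, k i * mono (x (t - τ i)) (y i) * ∑ j, qh j * vv y y' i j =
        ∑ i ∈ Bad, k i * mono (x (t - τ i)) (y i) * ∑ j, qh j * vv y y' i j := by
      symm
      apply Finset.sum_subset (Finset.subset_univ _)
      intro i _ hi
      rw [hq i hi, mul_zero]
    rw [e1, e2, Finset.sum_mul, ← Finset.sum_sub_distrib, ← Finset.sum_sub_distrib]
    apply Finset.sum_nonneg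
    intro i hi
    have hgp := gap_pos (hR i hi).1 (hR i hi).2
    have h1 := FF_gap (S.gpos (y i) (t - τ i)) (BB_pos hb (S.pos t) (y i) (y' i)) (hR i hi).1
      (hg t ⟨ht.le, ht1.le⟩ i hi)
    have h2 := S.le_DD hb (y' := y') t i
    have h3 := mul_le_mul_of_nonneg_left h1 (S.hk i).le
    have h4 := mul_le_mul_of_nonneg_left (h3.trans h2) (hκ0 i hi)
    have h5 : κ i * (k i * ((R i - 1 - Real.log (R i)) * mono (x (t - τ i)) (y i))) =
        k i * mono (x (t - τ i)) (y i) * |∑ j, qh j * vv y y' i j| := by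
      simp only [hκ]; field_simp
    have h6 : k i * mono (x (t - τ i)) (y i) * ∑ j, qh j * vv y y' i j ≤
        k i * mono (x (t - τ i)) (y i) * |∑ j, qh j * vv y y' i j| :=
      mul_le_mul_of_nonneg_left (le_abs_self _) (mul_nonneg (S.hk i).le (S.gpos _ _).le)
    have h7 : κ i * (k i * ((R i - 1 - Real.log (R i)) * mono (x (t - τ i)) (y i) +
        (R i - 1) * (mono (x t) (y i) - mono (x (t - τ i)) (y i)))) =
        κ i * (k i * ((R i - 1 - Real.log (R i)) * mono (x (t - τ i)) (y i))) +
        κ i * (k i * (R i - 1)) * (mono (x t) (y i) - mono (x (t - τ i)) (y i)) := by ring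
    linarith)
  simp only [hH] at hmain
  have e3 : ∑ i ∈ Bad, κ i * (k i * (R i - 1)) *
      (Win (τ i) (fun s => mono (x s) (y i)) t0 - Win (τ i) (fun s => mono (x s) (y i)) t1) =
      ∑ i ∈ Bad, κ i * (k i * (R i - 1)) * Win (τ i) (fun s => mono (x s) (y i)) t0 -
      ∑ i ∈ Bad, κ i * (k i * (R i - 1)) * Win (τ i) (fun s => mono (x s) (y i)) t1 := by
    rw [← Finset.sum_sub_distrib]
    exact Finset.sum_congr rfl fun i _ => by ring
  change _ ≤ (∑ i ∈ Bad, κ i) * _ + ∑ i ∈ Bad, κ i * (k i * (R i - 1)) *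
      (Win (τ i) (fun s => mono (x s) (y i)) t0 - Win (τ i) (fun s => mono (x s) (y i)) t1)
  rw [e3]
  linarith

lemma log_prod_nonneg {a b : ℝ} (ha : 0 < a) (hb : 0 < b) :
    0 ≤ (a - b) * (Real.log a - Real.log b) := by
  rcases le_total a b with h | h
  · exact mul_nonneg_of_nonpos_of_nonpos (by linarith) (by linarith [Real.log_le_log ha h])
  · exact mul_nonneg (by linarith) (by linarith [Real.log_le_log hb h])

lemma log_prod_pos {a b : ℝ} (ha : 0 < a) (hb : 0 < b) (hab : a ≠ b) :
    0 < (a - b) * (Real.log a - Real.log b) := by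
  rcases lt_or_gt_of_ne hab with h | h
  · exact mul_pos_of_neg_of_neg (by linarith) (by linarith [Real.log_lt_log ha h])
  · exact mul_pos (by linarith) (by linarith [Real.log_lt_log hb h])

lemma Sys.trap (S : Sys y y' k τ τm M x) (hb : ∀ j, 0 < xb j) (h : CBf y y' k xb)
    (hcov : ∀ j, ∃ p, j ∈ Sp p) (hS : ∀ i j, (y i j ≠ 0 ∨ y' i j ≠ 0) → j ∈ Sp (grp i))
    (h2d : ∀ p, Module.finrank ℝ (stoichOn y y' (Rgrp grp p)) = 2)
    {z : Fin n → ℝ} (hz : z ∈ Om x)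
    (hWc : ∀ j ∈ ZZ z, ∀ p q, j ∈ Sp p → j ∈ Sp q → p = q)
    {ε1 : ℝ} (hε1 : 0 < ε1) (hsel : ∀ z' ∈ Om x, dist z' z ≤ ε1 →
      ZZ z' = ZZ z ∧ eqset y y' xb z' = eqset y y' xb z) : Tendsto x atTop (𝓝 z) := by
  classical
  set Bad : Finset (Fin r) := univ.filter (fun i =>
    ¬ VertexType (stoichOn y y' (Rgrp grp (grp i))) (ZZ z : Set (Fin n)) ∧
      i ∉ eqset y y' xb z) with hBad
  have hgap : ∀ i, ∃ R : ℝ, i ∈ Bad → (0 < R ∧ R ≠ 1 ∧ ∀ᶠ u in 𝓝 z, (∀ j, 0 < u j) →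
      (1 ≤ R ∧ R * mono u (y i) ≤ BB xb (y i) (y' i) u) ∨
        (R ≤ 1 ∧ BB xb (y i) (y' i) u ≤ R * mono u (y i))) := by
    intro i
    by_cases hi : i ∈ Bad
    · have hi' := hi
      rw [hBad, Finset.mem_filter] at hi'
      obtain ⟨R, hR⟩ := S.gap hb h hz hS hWc (h2d (grp i)) hi'.2.1 hi'.2.2
      exact ⟨R, fun _ => hR⟩
    · exact ⟨0, fun h => absurd h hi⟩
  choose R hR using hgap
  have hBadT : ∀ i ∈ Bad, i ∈ TT y (ZZ z) := by
    intro i hi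
    by_contra hT
    rw [hBad, Finset.mem_filter] at hi
    exact hi.2.2 (S.eq_of_not_TT hb h hz hT)
  have hgap2 : ∀ᶠ u in 𝓝 z, ∀ i ∈ Bad, (∀ j, 0 < u j) →
      (1 ≤ R i ∧ R i * mono u (y i) ≤ BB xb (y i) (y' i) u) ∨
        (R i ≤ 1 ∧ BB xb (y i) (y' i) u ≤ R i * mono u (y i)) := by
    rw [Filter.eventually_all_finset]
    exact fun i hi => (hR i hi).2.2
  obtain ⟨ε2, hε2, hball⟩ := Metric.eventually_nhds_iff.1 hgap2
  rw [Metric.tendsto_nhds]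
  intro ε0 hε0
  set ε := min ε0 (min ε1 (ε2 / 2)) with hεdef
  have hε : 0 < ε := by positivity
  have hεle1 : ε ≤ ε1 := (min_le_right _ _).trans (min_le_left _ _)
  have hεlt2 : ε < ε2 := lt_of_le_of_lt ((min_le_right _ _).trans (min_le_right _ _)) (by linarith)
  suffices hs : ∀ᶠ t in atTop, dist (x t) z < ε from
    hs.mono fun t ht => ht.trans_le (min_le_left _ _)
  by_contra hne
  choose t0 t1 hN h01 hd0 hd1 hin using escape S.cont hz hε hne
  obtain ⟨z', hz'K, φ, hφ, hlim1⟩ := (box_compact M).tendsto_subseq (x := fun N => x (t1 N))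
    (fun N => S.box _)
  have ht0 : Tendsto (fun N => t0 (φ N)) atTop atTop :=
    (tendsto_atTop_mono hN tendsto_natCast_atTop_atTop).comp hφ.tendsto_atTop
  have ht1 : Tendsto (fun N => t1 (φ N)) atTop atTop :=
    tendsto_atTop_mono (fun N => h01 (φ N)) ht0
  have hlim0 : Tendsto (fun N => x (t0 (φ N))) atTop (𝓝 z) := by
    have : Tendsto (fun N => x (t0 N)) atTop (𝓝 z) := by
      rw [tendsto_iff_dist_tendsto_zero]
      exact squeeze_zero (fun _ => dist_nonneg) (fun N => (hd0 N).le)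
        tendsto_one_div_add_atTop_nhds_zero_nat
    exact this.comp hφ.tendsto_atTop
  have hU0 : Filter.map (fun N => t0 (φ N)) atTop ≤ atTop := ht0
  have hU1 : Filter.map (fun N => t1 (φ N)) atTop ≤ atTop := ht1
  have hx0 : Tendsto x (Filter.map (fun N => t0 (φ N)) atTop) (𝓝 z) := tendsto_map'_iff.2 hlim0
  have hx1 : Tendsto x (Filter.map (fun N => t1 (φ N)) atTop) (𝓝 z') := tendsto_map'_iff.2 hlim1
  have hz' : z' ∈ Om x := Om_of hU1 hx1
  have hdz : dist z' z = ε := by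
    have h1 : Tendsto (fun N => dist (x (t1 (φ N))) z) atTop (𝓝 (dist z' z)) :=
      hlim1.dist tendsto_const_nhds
    have h2 : Tendsto (fun N => dist (x (t1 (φ N))) z) atTop (𝓝 ε) := by
      simp only [hd1]; exact tendsto_const_nhds
    exact tendsto_nhds_unique h1 h2
  obtain ⟨hZ, hEq⟩ := hsel z' hz' (hdz.le.trans hεle1)
  have hzero : ∀ j, z' j = 0 ↔ z j = 0 := fun j => by rw [← mem_ZZ, hZ, mem_ZZ]
  obtain ⟨qh, hqh, hqv⟩ := lemmaQ (y := y) (y' := y') (grp := grp) hcov hS hWc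
    (fun j => Real.log (z' j) - Real.log (z j))
  have hq : ∀ i ∉ Bad, ∑ j, qh j * vv y y' i j = 0 := by
    intro i hi
    by_cases hv : VertexType (stoichOn y y' (Rgrp grp (grp i))) (ZZ z : Set (Fin n))
    · exact hqv i hv
    · have he : i ∈ eqset y y' xb z := by
        by_contra hE
        exact hi (by rw [hBad, Finset.mem_filter]; exact ⟨Finset.mem_univ _, hv, hE⟩)
      have he' := he
      rw [← hEq] at he'
      rw [mem_eqset] at he he'
      calc ∑ j, qh j * vv y y' i j = ∑ j, (vv y y' i j * ww xb z' j - vv y y' i j * ww xb z j) := by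
            apply Finset.sum_congr rfl
            intro j _
            by_cases hj : z j = 0
            · rw [he.1 j hj]; ring
            · rw [hqh j (fun hm => hj (mem_ZZ.1 hm))]; unfold ww; ring
        _ = 0 := by rw [Finset.sum_sub_distrib, he.2, he'.2, sub_zero]
  -- limits
  have hWin0 : ∀ (t : ℕ → ℝ) (w : Fin n → ℝ), Filter.map t atTop ≤ atTop →
      Tendsto x (Filter.map t atTop) (𝓝 w) → ∀ i, Tendsto (fun N => Win (τ i)
        (fun s => mono (x s) (y i)) (t N)) atTop (𝓝 (τ i * mono w (y i))) := by
    intro t w hU hx i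
    exact tendsto_map'_iff.1 (S.win_lim hb h (continuous_mono (y i)) (S.hτ i) hU hx)
  have hmono0 : ∀ i ∈ Bad, mono z (y i) = 0 ∧ mono z' (y i) = 0 := by
    intro i hi
    obtain ⟨j, hj, hij⟩ := mem_TT.1 (hBadT i hi)
    rw [mem_ZZ] at hj
    exact ⟨mono_eq_zero.2 ⟨j, hj, hij⟩, mono_eq_zero.2 ⟨j, (hzero j).2 hj, hij⟩⟩
  obtain ⟨c, hVc, _⟩ := S.V_tendsto hb h
  have hV0 := (hVc.comp ht0).sub (hVc.comp ht1)
  rw [sub_self] at hV0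
  set κ : Fin r → ℝ := fun i => |∑ j, qh j * vv y y' i j| / (R i - 1 - Real.log (R i)) with hκ
  have hRHS : Tendsto (fun N => (∑ i ∈ Bad, κ i) *
      (VV y k τ x xb univ univ (t0 (φ N)) - VV y k τ x xb univ univ (t1 (φ N))) +
      ∑ i ∈ Bad, κ i * (k i * (R i - 1)) *
        (Win (τ i) (fun s => mono (x s) (y i)) (t0 (φ N)) -
          Win (τ i) (fun s => mono (x s) (y i)) (t1 (φ N)))) atTop (𝓝 0) := by
    have h1 : Tendsto (fun N => ∑ i ∈ Bad, κ i * (k i * (R i - 1)) *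
        (Win (τ i) (fun s => mono (x s) (y i)) (t0 (φ N)) -
          Win (τ i) (fun s => mono (x s) (y i)) (t1 (φ N)))) atTop
          (𝓝 (∑ i ∈ Bad, κ i * (k i * (R i - 1)) * (τ i * mono z (y i) - τ i * mono z' (y i)))) :=
      tendsto_finsetSum _ fun i _ => ((hWin0 _ _ hU0 hx0 i).sub (hWin0 _ _ hU1 hx1 i)).const_mul _
    have h2 : ∑ i ∈ Bad, κ i * (k i * (R i - 1)) * (τ i * mono z (y i) - τ i * mono z' (y i)) = 0 :=
      Finset.sum_eq_zero fun i hi => by rw [(hmono0 i hi).1, (hmono0 i hi).2]; ring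
    rw [h2] at h1
    simpa using (hV0.const_mul (∑ i ∈ Bad, κ i)).add h1
  have hXl : ∀ (t : ℕ → ℝ) (w : Fin n → ℝ), Filter.map t atTop ≤ atTop →
      Tendsto x (Filter.map t atTop) (𝓝 w) → Tendsto (fun N => ∑ j, qh j * XX y k τ x (t N) j) atTop
        (𝓝 (∑ j, qh j * (w j + ∑ i, k i * (y i j : ℝ) * (τ i * mono w (y i))))) := by
    intro t w hU hx
    exact tendsto_finsetSum _ fun j _ =>
      (tendsto_map'_iff.1 (S.XX_lim hb h hU hx j)).const_mul _
  have hLHS := (hXl _ _ hU1 hx1).sub (hXl _ _ hU0 hx0)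
  have hfin := le_of_tendsto_of_tendsto hLHS hRHS (by
    filter_upwards [ht0.eventually_ge_atTop τm] with N hN
    exact S.G_est hb h qh Bad R hq (fun i hi => ⟨(hR i hi).1, (hR i hi).2.1⟩) hN (h01 _)
      (fun t ht i hi => hball ((hin (φ N) t ht).trans_lt hεlt2) i hi (S.pos t)))
  -- compute
  have hcomp : ∑ j, qh j * (z' j + ∑ i, k i * (y i j : ℝ) * (τ i * mono z' (y i))) -
      ∑ j, qh j * (z j + ∑ i, k i * (y i j : ℝ) * (τ i * mono z (y i))) =
      ∑ j, qh j * (z' j - z j) + ∑ i, k i * τ i * ((mono z' (y i) - mono z (y i)) *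
        ∑ j, qh j * (y i j : ℝ)) := by
    rw [← Finset.sum_sub_distrib]
    simp_rw [Finset.mul_sum]
    rw [Finset.sum_comm, ← Finset.sum_add_distrib]
    apply Finset.sum_congr rfl
    intro j _
    have : ∑ i, k i * τ i * ((mono z' (y i) - mono z (y i)) * (qh j * (y i j : ℝ))) =
        qh j * (∑ i, k i * (y i j : ℝ) * (τ i * mono z' (y i)) -
          ∑ i, k i * (y i j : ℝ) * (τ i * mono z (y i))) := by
      rw [← Finset.sum_sub_distrib, Finset.mul_sum]
      apply Finset.sum_congr rfl
      intro i _; ring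
    rw [this]; ring
  rw [hcomp] at hfin
  have hzpos : ∀ j, z j ≠ 0 → 0 < z j ∧ 0 < z' j := fun j hj =>
    ⟨lt_of_le_of_ne (S.Om_nonneg hz j) (Ne.symm hj),
      lt_of_le_of_ne (S.Om_nonneg hz' j) (Ne.symm (fun h0 => hj ((hzero j).1 h0)))⟩
  have hterm2 : ∀ i, 0 ≤ k i * τ i * ((mono z' (y i) - mono z (y i)) *
        ∑ j, qh j * (y i j : ℝ)) := by
    intro i
    apply mul_nonneg (mul_nonneg (S.hk i).le (S.hτ i))
    by_cases hi : ∃ j, z j = 0 ∧ y i j ≠ 0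
    · obtain ⟨j, hj, hij⟩ := hi
      rw [mono_eq_zero.2 ⟨j, hj, hij⟩, mono_eq_zero.2 ⟨j, (hzero j).2 hj, hij⟩]; simp
    · push Not at hi
      have hp : 0 < mono z (y i) := lt_of_le_of_ne (mono_nonneg' (S.Om_nonneg hz) _)
        (fun h0 => by obtain ⟨j, hj, hij⟩ := mono_eq_zero.1 h0.symm; exact hij (hi j hj))
      have hp' : 0 < mono z' (y i) := lt_of_le_of_ne (mono_nonneg' (S.Om_nonneg hz') _)
        (fun h0 => by
          obtain ⟨j, hj, hij⟩ := mono_eq_zero.1 h0.symm; exact hij (hi j ((hzero j).1 hj)))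
      have e : ∑ j, qh j * (y i j : ℝ) = Real.log (mono z' (y i)) - Real.log (mono z (y i)) := by
        rw [log_mono0 hi, log_mono0 (fun j hj => hi j ((hzero j).1 hj)), ← Finset.sum_sub_distrib]
        apply Finset.sum_congr rfl
        intro j _
        by_cases hj : z j = 0
        · rw [hi j hj]; simp
        · rw [hqh j (fun hm => hj (mem_ZZ.1 hm))]; ring
      rw [e]
      exact log_prod_nonneg hp' hp
  have hterm1 : ∀ j, 0 ≤ qh j * (z' j - z j) := by
    intro j
    by_cases hj : z j = 0
    · rw [hj, (hzero j).2 hj]; simp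
    · rw [hqh j (fun hm => hj (mem_ZZ.1 hm)), mul_comm]
      exact log_prod_nonneg (hzpos j hj).2 (hzpos j hj).1
  have hne' : ∃ j, z' j ≠ z j := by
    by_contra hall
    push Not at hall
    have : z' = z := funext hall
    rw [this, dist_self] at hdz
    linarith
  obtain ⟨j, hj⟩ := hne'
  have hjz : z j ≠ 0 := fun h0 => hj (by rw [h0, (hzero j).2 h0])
  have hpos1 : 0 < ∑ j, qh j * (z' j - z j) := by
    apply Finset.sum_pos' (fun j _ => hterm1 j) ⟨j, Finset.mem_univ j, ?_⟩
    rw [hqh j (fun hm => hjz (mem_ZZ.1 hm)), mul_comm]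
    exact log_prod_pos (hzpos j hjz).2 (hzpos j hjz).1 hj
  have hpos2 := Finset.sum_nonneg (s := univ) (fun i _ => hterm2 i)
  linarith

end Trap2
open Topology

lemma geom_cmp_up {α : ℝ} (h0 : 0 < α) (h1 : α ≤ 1) {d d' : ℕ} (hd : d ≤ d') :
    ∑ e ∈ range d', α ^ e - ∑ e ∈ range d, α ^ e ≤ ((d' : ℝ) - d) * α ^ d ∧
    ((d' : ℝ) - d) * α ^ d' ≤ α * (∑ e ∈ range d', α ^ e - ∑ e ∈ range d, α ^ e) := by
  induction d', hd using Nat.le_induction with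
  | base => simp
  | succ m hm ih =>
    rw [Finset.sum_range_succ]
    push_cast
    have e1 : α ^ m ≤ α ^ d := pow_le_pow_of_le_one h0.le h1 hm
    have e2 : α ^ (m + 1) = α * α ^ m := by ring
    have e3 : 0 ≤ ((m : ℝ) - d) := by
      have : (d : ℝ) ≤ m := by exact_mod_cast hm
      linarith
    have e4 : α * α ^ m ≤ α ^ m := by
      have : 0 < α ^ m := by positivity
      nlinarith
    have e5 := mul_le_mul_of_nonneg_left e4 e3
    constructor
    · nlinarith [ih.1]
    · rw [e2]
      nlinarith [ih.2]

lemma geom_cmp {α D ρ : ℝ} (h0 : 0 < α) (h1 : α ≤ 1) (hD : 1 ≤ D) (hαD : α * D ^ 2 ≤ 1)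
    {d d' : ℕ} (hl : D⁻¹ * α ^ d ≤ ρ) (hu : ρ ≤ D * α ^ d) :
    D⁻¹ * ∑ e ∈ range d', α ^ e - D⁻¹ * ∑ e ∈ range d, α ^ e ≤ ρ * ((d' : ℝ) - d) := by
  have hDi : 0 < D⁻¹ := by positivity
  rcases le_total d d' with hd | hd
  · have h2 := (geom_cmp_up h0 h1 hd).1
    have hd' : 0 ≤ (d' : ℝ) - d := by
      have : (d : ℝ) ≤ d' := by exact_mod_cast hd
      linarith
    have h3 := mul_le_mul_of_nonneg_left h2 hDi.le
    have h4 := mul_le_mul_of_nonneg_right hl hd'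
    nlinarith
  · have h2 := (geom_cmp_up h0 h1 hd).2
    have hd' : 0 ≤ (d : ℝ) - d' := by
      have : (d' : ℝ) ≤ d := by exact_mod_cast hd
      linarith
    have h4 := mul_le_mul_of_nonneg_right hu hd'
    set G := ∑ e ∈ range d, α ^ e - ∑ e ∈ range d', α ^ e with hG
    have hG0 : 0 ≤ G := by
      have : 0 ≤ α * G := le_trans (by positivity) h2
      exact (mul_nonneg_iff_of_pos_left h0).1 this
    have h5 : D * (((d : ℝ) - d') * α ^ d) ≤ D * (α * G) :=
      mul_le_mul_of_nonneg_left h2 (by linarith)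
    have h6 : D * (α * G) ≤ D⁻¹ * G := by
      have : D * α ≤ D⁻¹ := by
        rw [le_inv_comm₀ (by positivity) (by positivity), inv_eq_one_div,
          le_div_iff₀ (by positivity)]
        nlinarith
      nlinarith
    have : D⁻¹ * ∑ e ∈ range d', α ^ e - D⁻¹ * ∑ e ∈ range d, α ^ e = - (D⁻¹ * G) := by
      rw [hG]; ring
    rw [this]
    nlinarith

lemma prod_ite_pow {α : ℝ} (P : Finset (Fin n)) (η : Fin n → ℕ) :
    ∏ j, (if j ∈ P then α else 1) ^ η j = α ^ (∑ j ∈ P, η j) := by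
  classical
  rw [← Finset.prod_pow_eq_pow_sum]
  rw [← Finset.prod_subset (Finset.subset_univ P)]
  · exact Finset.prod_congr rfl fun j hj => by rw [if_pos hj]
  · intro j _ hj; rw [if_neg hj, one_pow]

lemma mono_cmp {α C : ℝ} (hα : 0 < α) (hC : 1 ≤ C) (P : Finset (Fin n)) {u : Fin n → ℝ}
    {η : Fin n → ℕ} (hu : ∀ j, η j ≠ 0 →
      C⁻¹ * (if j ∈ P then α else 1) ≤ u j ∧ u j ≤ C * (if j ∈ P then α else 1)) :
    (C ^ (∑ j, η j))⁻¹ * α ^ (∑ j ∈ P, η j) ≤ mono u η ∧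
    mono u η ≤ C ^ (∑ j, η j) * α ^ (∑ j ∈ P, η j) := by
  have hC0 : 0 < C := by linarith
  have hif : ∀ j, 0 < (if j ∈ P then α else 1) := fun j => by split_ifs <;> linarith
  have e1 : (C ^ (∑ j, η j))⁻¹ * α ^ (∑ j ∈ P, η j) =
      ∏ j, (C⁻¹ * (if j ∈ P then α else 1)) ^ η j := by
    simp_rw [mul_pow]
    rw [Finset.prod_mul_distrib, prod_ite_pow, Finset.prod_pow_eq_pow_sum, inv_pow]
  have e2 : C ^ (∑ j, η j) * α ^ (∑ j ∈ P, η j) =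
      ∏ j, (C * (if j ∈ P then α else 1)) ^ η j := by
    simp_rw [mul_pow]
    rw [Finset.prod_mul_distrib, prod_ite_pow, Finset.prod_pow_eq_pow_sum]
  rw [e1, e2]
  unfold mono
  constructor
  · apply Finset.prod_le_prod
    · intro j _; have := hif j; positivity
    · intro j _
      by_cases hj : η j = 0
      · simp [hj]
      · have := hif j
        exact pow_le_pow_left₀ (by positivity) (hu j hj).1 _
  · apply Finset.prod_le_prod
    · intro j _
      by_cases hj : η j = 0
      · simp [hj]
      · have := hif j
        have h1 : 0 ≤ C⁻¹ * (if j ∈ P then α else 1) := by positivity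
        exact pow_nonneg (h1.trans (hu j hj).1) _
    · intro j _
      by_cases hj : η j = 0
      · simp [hj]
      · have := hif j
        have h1 : 0 ≤ C⁻¹ * (if j ∈ P then α else 1) := by positivity
        exact pow_le_pow_left₀ (h1.trans (hu j hj).1) (hu j hj).2 _

section NoEdge
variable {l : ℕ} {y y' : Fin r → Fin n → ℕ} {Sp : Fin l → Set (Fin n)} {grp : Fin r → Fin l}
variable {k τ : Fin r → ℝ} {τm M : ℝ} {x : ℝ → Fin n → ℝ} {xb : Fin n → ℝ}

lemma Sys.no_edge (S : Sys y y' k τ τm M x) (hb : ∀ j, 0 < xb j) (h : CBf y y' k xb)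
    (hS : ∀ i j, (y i j ≠ 0 ∨ y' i j ≠ 0) → j ∈ Sp (grp i))
    {z : Fin n → ℝ} (hx : Tendsto x atTop (𝓝 z))
    (hWc : ∀ j ∈ ZZ z, ∀ p q, j ∈ Sp p → j ∈ Sp q → p = q) {p : Fin l}
    (h2 : Module.finrank ℝ (stoichOn y y' (Rgrp grp p)) = 2)
    (hv : ¬ VertexType (stoichOn y y' (Rgrp grp p)) (ZZ z : Set (Fin n)))
    {j0 : Fin n} (hj0 : j0 ∈ ZZ z) (hj0p : j0 ∈ Sp p) : False := by
  classical
  have hz : z ∈ Om x := Om_of le_rfl hx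
  set P : Finset (Fin n) := (ZZ z).filter (fun j => j ∈ Sp p) with hP
  have hmemP : ∀ j, j ∈ P ↔ z j = 0 ∧ j ∈ Sp p := fun j => by rw [hP, Finset.mem_filter, mem_ZZ]
  have hxj : ∀ j, Tendsto (fun t => x t j) atTop (𝓝 (z j)) := fun j =>
    ((continuous_apply j).tendsto z).comp hx
  -- A
  set A : ℝ → ℝ := fun t => ∑ j ∈ P, (x t j + ∑ i, k i * (y' i j : ℝ) *
    Win (τ i) (fun s => mono (x s) (y i)) t) with hA
  have hAc : Continuous A := by
    have h1 := S.contj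
    have h2 : ∀ i, Continuous (Win (τ i) (fun s => mono (x s) (y i))) := fun i =>
      continuous_Win (S.contg _) _
    fun_prop
  have hAlim : Tendsto A atTop (𝓝 0) := by
    have : Tendsto A atTop (𝓝 (∑ j ∈ P, (z j + ∑ i, k i * (y' i j : ℝ) *
        (τ i * mono z (y i))))) :=
      tendsto_finsetSum _ fun j _ => (hxj j).add (tendsto_finsetSum _ fun i _ =>
        (S.win_lim hb h (continuous_mono (y i)) (S.hτ i) le_rfl hx).const_mul _)
    have e : ∑ j ∈ P, (z j + ∑ i, k i * (y' i j : ℝ) * (τ i * mono z (y i))) = 0 := by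
      apply Finset.sum_eq_zero
      intro j hj
      have hzj := ((hmemP j).1 hj).1
      rw [hzj, zero_add]
      apply Finset.sum_eq_zero
      intro i _
      by_cases hij : y' i j = 0
      · simp [hij]
      · obtain ⟨j', hj', hij'⟩ := (S.Om_sym hb h hz i).2 ⟨j, hzj, hij⟩
        rw [mono_eq_zero.2 ⟨j', hj', hij'⟩]; ring
    rwa [e] at this
  have hApos : ∀ t, 0 < A t := by
    intro t
    apply Finset.sum_pos
    · intro j _
      apply add_pos_of_pos_of_nonneg (S.pos t j)
      apply Finset.sum_nonneg
      intro i _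
      have := S.hk i
      have := Win_nonneg (S.contg (y i)) (t := t) (S.hτ i) (fun s => (S.gpos _ s).le)
      positivity
    · exact ⟨j0, (hmemP j0).2 ⟨mem_ZZ.1 hj0, hj0p⟩⟩
  have hAd : ∀ t, τm < t → HasDerivAt A (∑ i, k i * mono (x t) (y i) *
      (((∑ j ∈ P, y' i j : ℕ) : ℝ) - ((∑ j ∈ P, y i j : ℕ) : ℝ))) t := by
    intro t ht
    have h1 : HasDerivAt A (∑ j ∈ P, ((∑ i, k i * (mono (x (t - τ i)) (y i) * (y' i j : ℝ)
        - mono (x t) (y i) * (y i j : ℝ))) + ∑ i, k i * (y' i j : ℝ) *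
          (mono (x t) (y i) - mono (x (t - τ i)) (y i)))) t :=
      HasDerivAt.fun_sum fun j _ => (S.der t ht j).add (HasDerivAt.fun_sum fun i _ =>
        (hasDerivAt_Win (S.contg (y i)) (τ i) t).const_mul _)
    refine h1.congr_deriv ?_
    simp_rw [← Finset.sum_add_distrib]
    rw [Finset.sum_comm]
    apply Finset.sum_congr rfl
    intro i _
    push_cast
    rw [← Finset.sum_sub_distrib, Finset.mul_sum]
    apply Finset.sum_congr rfl
    intro j _; ring
  -- comparability
  have hcomp : ∀ j, ∀ᶠ C : ℝ in atTop, ∀ᶠ t in atTop, (z j = 0 → j ∈ Sp p) →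
      C⁻¹ * (if j ∈ P then x t j0 else 1) ≤ x t j ∧ x t j ≤ C * (if j ∈ P then x t j0 else 1) := by
    intro j
    by_cases hj : j ∈ P
    · have hj' := (hmemP j).1 hj
      obtain ⟨C1, hC1, h1⟩ := S.edge_comp hb h hz hS hWc h2 hv (mem_ZZ.2 hj'.1) hj0 hj'.2 hj0p
      obtain ⟨C2, hC2, h2'⟩ := S.edge_comp hb h hz hS hWc h2 hv hj0 (mem_ZZ.2 hj'.1) hj0p hj'.2
      filter_upwards [eventually_ge_atTop C1, eventually_ge_atTop C2] with C hCC1 hCC2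
      filter_upwards [eventually_ge_atTop (2 * τm)] with t ht _
      rw [if_pos hj]
      have p1 := S.pos t j0
      have p2 := S.pos t j
      have hCp : 0 < C := by linarith
      constructor
      · rw [inv_mul_le_iff₀ hCp]
        exact (h2' t ht).trans (mul_le_mul_of_nonneg_right hCC2 p2.le)
      · exact (h1 t ht).trans (mul_le_mul_of_nonneg_right hCC1 p1.le)
    · by_cases hzj : z j = 0
      · refine Filter.Eventually.of_forall fun C => Filter.Eventually.of_forall fun t hh => ?_
        exact absurd ((hmemP j).2 ⟨hzj, hh hzj⟩) hj
      · have hzp : 0 < z j := lt_of_le_of_ne (S.Om_nonneg hz j) (Ne.symm hzj)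
        filter_upwards [eventually_ge_atTop (2 * z j), eventually_ge_atTop (2 / z j)] with C hC1 hC2
        filter_upwards [(hxj j).eventually_lt_const (show z j < 2 * z j by linarith),
          (hxj j).eventually_const_lt (show z j / 2 < z j by linarith)] with t ht1 ht2 _
        rw [if_neg hj, mul_one, mul_one]
        have : 0 < 2 / z j := by positivity
        refine ⟨?_, by linarith⟩
        have : C⁻¹ ≤ (2 / z j)⁻¹ := inv_anti₀ this hC2
        rw [inv_div] at this
        linarith
  obtain ⟨C, hC, hC1⟩ := ((Filter.eventually_all.2 hcomp).and (eventually_ge_atTop (1:ℝ))).exists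
  have hDD : ∀ i, ∀ᶠ D : ℝ in atTop, C ^ (∑ j, y i j) * mono xb (y i) ≤ D ∧
      C ^ (∑ j, y i j) / mono xb (y i) ≤ D := fun i =>
    (eventually_ge_atTop _).and (eventually_ge_atTop _)
  obtain ⟨D, hD, hD1⟩ := ((Filter.eventually_all.2 hDD).and (eventually_ge_atTop (1:ℝ))).exists
  have hD0 : 0 < D := by linarith
  have hα : ∀ᶠ t in atTop, x t j0 < (D ^ 2)⁻¹ := by
    have := hxj j0
    rw [mem_ZZ.1 hj0] at this
    exact this.eventually_lt_const (by positivity)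
  have hA' : ∀ᶠ t in atTop, 0 ≤ ∑ i, k i * mono (x t) (y i) *
      (((∑ j ∈ P, y' i j : ℕ) : ℝ) - ((∑ j ∈ P, y i j : ℕ) : ℝ)) := by
    filter_upwards [Filter.eventually_all.2 hC, hα] with t ht hαt
    set α := x t j0
    have hαp : 0 < α := S.pos t j0
    have hαD : α * D ^ 2 ≤ 1 := by
      have := mul_le_mul_of_nonneg_right hαt.le (show 0 ≤ D ^ 2 by positivity)
      rwa [inv_mul_cancel₀ (by positivity)] at this
    have hα1 : α ≤ 1 := by
      have : 1 ≤ D ^ 2 := one_le_pow₀ hD1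
      nlinarith
    have hcb := h (fun η => D⁻¹ * ∑ e ∈ range (∑ j ∈ P, η j), α ^ e)
    rw [← hcb]
    apply Finset.sum_le_sum
    intro i _
    have hm := mono_pos' hb (y i)
    have hki := S.hk i
    by_cases hi : grp i = p
    · have hb1 := mono_cmp hαp hC1 P (u := x t) (η := y i) (fun j hj => ht j (fun _ => by
        rw [← hi]; exact hS i j (Or.inl hj)))
      have hd := hD i
      have hCp : 0 < C ^ (∑ j, y i j) := by positivity
      have hap : 0 < α ^ (∑ j ∈ P, y i j) := by positivity
      have h3 := geom_cmp (d := ∑ j ∈ P, y i j) (d' := ∑ j ∈ P, y' i j) hαp hα1 hD1 hαD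
        (ρ := mono (x t) (y i) / mono xb (y i))
        (by
          rw [le_div_iff₀ hm]
          refine le_trans ?_ hb1.1
          have : D⁻¹ * mono xb (y i) ≤ (C ^ (∑ j, y i j))⁻¹ := by
            rw [inv_mul_le_iff₀ hD0, ← div_eq_mul_inv, le_div_iff₀ hCp, mul_comm]
            exact hd.1
          nlinarith)
        (by
          rw [div_le_iff₀ hm]
          refine hb1.2.trans ?_
          have : C ^ (∑ j, y i j) ≤ D * mono xb (y i) := by
            rw [← div_le_iff₀ hm]; exact hd.2
          nlinarith)
      have h4 := mul_le_mul_of_nonneg_left h3 (mul_pos hki hm).le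
      refine h4.trans (le_of_eq ?_)
      field_simp
    · have hz1 : ∀ j ∈ P, y i j = 0 ∧ y' i j = 0 := by
        intro j hj
        have hj' := (hmemP j).1 hj
        by_contra hc
        apply hi
        apply hWc j (mem_ZZ.2 hj'.1) _ _ _ hj'.2
        apply hS
        by_contra hcc
        push Not at hcc
        exact hc hcc
      rw [Finset.sum_eq_zero (fun j hj => (hz1 j hj).1),
        Finset.sum_eq_zero (fun j hj => (hz1 j hj).2)]
      simp
  obtain ⟨t0, ht0⟩ := Filter.eventually_atTop.1 hA'
  have hmono := mono_of_deriv (a := max t0 τm) hAc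
    (fun t ht => hAd t (lt_of_le_of_lt (le_max_right _ _) ht))
    (fun t ht => ht0 t ((le_max_left _ _).trans (le_of_lt ht)))
  have hle : A (max t0 τm) ≤ 0 := by
    apply ge_of_tendsto hAlim
    filter_upwards [eventually_ge_atTop (max t0 τm)] with t ht
    exact hmono Set.self_mem_Ici ht ht
  linarith [hApos (max t0 τm)]

end NoEdge
open Topology

lemma ginv (v : Fin r → Fin n → ℝ) : ∃ G : Fin r → Fin n → ℝ, ∀ (q : Fin n → ℝ) (i : Fin r),
    ∑ j, (∑ i', (∑ j', q j' * v i' j') * G i' j) * v i j = ∑ j, q j * v i j := by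
  classical
  let A : (Fin n → ℝ) →ₗ[ℝ] (Fin r → ℝ) :=
    { toFun := fun q i => ∑ j, q j * v i j
      map_add' := fun a b => by
        ext i; simp only [Pi.add_apply, add_mul, Finset.sum_add_distrib]
      map_smul' := fun c a => by
        ext i; simp only [Pi.smul_apply, smul_eq_mul, RingHom.id_apply, Finset.mul_sum, mul_assoc] }
  have hA : ∀ q i, A q i = ∑ j, q j * v i j := fun _ _ => rfl
  obtain ⟨g, hg⟩ := A.rangeRestrict.exists_rightInverse_of_surjective A.range_rangeRestrict
  obtain ⟨g', hg'⟩ := g.exists_extend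
  refine ⟨fun i' j => g' (Pi.single i' 1) j, fun q i => ?_⟩
  have h1 : ∀ b : Fin r → ℝ, ∀ j, g' b j = ∑ i', b i' * g' (Pi.single i' 1) j := by
    intro b j
    conv_lhs => rw [pi_eq_sum_univ' b]
    simp [map_sum]
  have h2 : A (g' (A q)) = A q := by
    have e1 : g' (A q) = g (A.rangeRestrict q) := by
      rw [← hg']; rfl
    rw [e1]
    have := LinearMap.congr_fun hg (A.rangeRestrict q)
    exact congrArg Subtype.val this
  have h3 := congrFun h2 i
  rw [hA, hA] at h3
  rw [← h3]
  apply Finset.sum_congr rfl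
  intro j _
  rw [h1]
  rfl

section Fin1
variable {l : ℕ} {y y' : Fin r → Fin n → ℕ} {Sp : Fin l → Set (Fin n)} {grp : Fin r → Fin l}
variable {k τ : Fin r → ℝ} {τm M : ℝ} {x : ℝ → Fin n → ℝ} {xb : Fin n → ℝ}

lemma Sys.conserved (S : Sys y y' k τ τm M x) (hb : ∀ j, 0 < xb j) (h : CBf y y' k xb)
    {z : Fin n → ℝ} (hx : Tendsto x atTop (𝓝 z)) {u : Fin n → ℝ}
    (hu : ∀ i, ∑ j, u j * vv y y' i j = 0) {t : ℝ} (ht : τm ≤ t) :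
    ∑ j, u j * XX y k τ x t j =
      ∑ j, u j * (z j + ∑ i, k i * (y i j : ℝ) * (τ i * mono z (y i))) := by
  have h0 : ∀ {t : ℝ} (u : Fin n → ℝ), τm ≤ t → (∀ i, ∑ j, u j * vv y y' i j = 0) →
      ∑ j, u j * XX y k τ x t j ≤
      ∑ j, u j * (z j + ∑ i, k i * (y i j : ℝ) * (τ i * mono z (y i))) := by
    intro t u ht hu
    have hc : Continuous (fun t => ∑ j, u j * XX y k τ x t j) := by
      have := S.XX_cont
      fun_prop
    have hd : ∀ t > τm, HasDerivAt (fun t => ∑ j, u j * XX y k τ x t j) 0 t := by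
      intro t ht
      have h3 : HasDerivAt (fun t => ∑ j, u j * XX y k τ x t j)
          (∑ j, u j * ∑ i, k i * mono (x (t - τ i)) (y i) * ((y' i j : ℝ) - (y i j : ℝ))) t :=
        HasDerivAt.fun_sum fun j _ => (S.XX_der j t ht).const_mul _
      refine h3.congr_deriv ?_
      simp_rw [Finset.mul_sum]
      rw [Finset.sum_comm]
      apply Finset.sum_eq_zero
      intro i _
      have := hu i
      calc _ = k i * mono (x (t - τ i)) (y i) * ∑ j, u j * vv y y' i j := by
            rw [Finset.mul_sum]
            exact Finset.sum_congr rfl fun j _ => by unfold vv; ring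
        _ = 0 := by rw [this, mul_zero]
    have hm := mono_of_deriv hc hd (fun _ _ => le_rfl)
    have hl : Tendsto (fun t => ∑ j, u j * XX y k τ x t j) atTop
        (𝓝 (∑ j, u j * (z j + ∑ i, k i * (y i j : ℝ) * (τ i * mono z (y i))))) :=
      tendsto_finsetSum _ fun j _ => (S.XX_lim hb h le_rfl hx j).const_mul _
    apply ge_of_tendsto hl
    filter_upwards [eventually_ge_atTop t] with s hs
    exact hm ht (ht.trans hs) hs
  apply le_antisymm (h0 u ht hu)
  have := h0 (fun j => - u j) ht (fun i => by
    simp only [neg_mul, Finset.sum_neg_distrib, hu i, neg_zero])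
  simp only [neg_mul, Finset.sum_neg_distrib] at this
  linarith

/-- dual vectors, when all groups meeting W are of vertex type -/
lemma Sys.dual (hcov : ∀ j, ∃ p, j ∈ Sp p)
    (hS : ∀ i j, (y i j ≠ 0 ∨ y' i j ≠ 0) → j ∈ Sp (grp i)) {W : Finset (Fin n)}
    (hWc : ∀ j ∈ W, ∀ p q, j ∈ Sp p → j ∈ Sp q → p = q)
    (hvt : ∀ p, ∀ j ∈ W, j ∈ Sp p → VertexType (stoichOn y y' (Rgrp grp p)) (W : Set (Fin n)))
    (q : Fin n → ℝ) : ∃ qh : Fin n → ℝ, (∀ j ∉ W, qh j = q j) ∧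
      ∀ i ∈ TT y W, ∑ j, qh j * vv y y' i j = 0 := by
  obtain ⟨qh, h1, h2⟩ := lemmaQ (y := y) (y' := y') (grp := grp) hcov hS hWc q
  refine ⟨qh, h1, fun i hi => h2 i ?_⟩
  obtain ⟨j, hj, hij⟩ := mem_TT.1 hi
  exact hvt _ j hj (hS i j (Or.inl hij))

lemma Sys.exists_xh (S : Sys y y' k τ τm M x) (hb : ∀ j, 0 < xb j) (h : CBf y y' k xb)
    {z : Fin n → ℝ} (hz : z ∈ Om x)
    (hdual : ∀ q : Fin n → ℝ, ∃ qh : Fin n → ℝ, (∀ j ∉ ZZ z, qh j = q j) ∧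
      ∀ i ∈ TT y (ZZ z), ∑ j, qh j * vv y y' i j = 0) :
    ∃ xh : Fin n → ℝ, (∀ j, 0 < xh j) ∧ CBf y y' k xh ∧ ∀ j ∉ ZZ z, xh j = z j := by
  obtain ⟨qh, h1, h2⟩ := hdual (fun j => Real.log (z j) - Real.log (xb j))
  have h3 : ∀ i, ∑ j, qh j * vv y y' i j = 0 := by
    intro i
    by_cases hi : i ∈ TT y (ZZ z)
    · exact h2 i hi
    · have he := mem_eqset.1 (S.eq_of_not_TT hb h hz hi)
      rw [← he.2]
      apply Finset.sum_congr rfl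
      intro j _
      by_cases hj : z j = 0
      · rw [he.1 j hj]; ring
      · rw [h1 j (fun hm => hj (mem_ZZ.1 hm))]; unfold ww; ring
  have hm : ∀ η : Fin n → ℕ, mono (fun j => xb j * Real.exp (qh j)) η / mono xb η =
      Real.exp (∑ j, qh j * (η j : ℝ)) := by
    intro η
    rw [div_eq_iff (mono_pos' hb η).ne']
    unfold mono
    rw [Real.exp_sum, ← Finset.prod_mul_distrib]
    apply Finset.prod_congr rfl
    intro j _
    rw [mul_pow, ← Real.exp_nat_mul]
    ring_nf
  refine ⟨fun j => xb j * Real.exp (qh j), fun j => mul_pos (hb j) (Real.exp_pos _), ?_, ?_⟩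
  · apply CBf_trans hb h
    intro i
    rw [hm, hm]
    congr 1
    have := h3 i
    have e : ∑ j, qh j * vv y y' i j = ∑ j, qh j * (y' i j : ℝ) - ∑ j, qh j * (y i j : ℝ) := by
      rw [← Finset.sum_sub_distrib]
      exact Finset.sum_congr rfl fun j _ => by unfold vv; ring
    linarith
  · intro j hj
    have hzp : 0 < z j := lt_of_le_of_ne (S.Om_nonneg hz j) (fun h0 => hj (mem_ZZ.2 h0.symm))
    beta_reduce
    rw [h1 j hj, Real.exp_sub, Real.exp_log hzp, Real.exp_log (hb j)]
    have := hb j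
    field_simp

end Fin1
open Topology

lemma mono_lip (z : Fin n → ℝ) (η : Fin n → ℕ) : ∃ K : ℝ, 0 ≤ K ∧ ∃ U ∈ 𝓝 z, ∀ u ∈ U, ∀ v ∈ U,
    |mono u η - mono v η| ≤ K * ‖u - v‖ := by
  have h : ContDiffAt ℝ 1 (fun u : Fin n → ℝ => mono u η) z := by
    unfold mono
    apply ContDiff.contDiffAt
    fun_prop
  obtain ⟨K, U, hU, hL⟩ := h.exists_lipschitzOnWith
  refine ⟨K, K.2, U, hU, fun u hu v hv => ?_⟩
  have := hL.norm_sub_le hu hv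
  simpa using this

/-- square root of the drop of the functional -/
noncomputable def oo (y : Fin r → Fin n → ℕ) (k τ : Fin r → ℝ) (τm : ℝ) (x : ℝ → Fin n → ℝ)
    (xh : Fin n → ℝ) (t : ℝ) : ℝ :=
  √(VV y k τ x xh univ univ (t - (τm + 1)) - VV y k τ x xh univ univ t)

section Qb
variable {y y' : Fin r → Fin n → ℕ}
variable {k τ : Fin r → ℝ} {τm M : ℝ} {x : ℝ → Fin n → ℝ} {xh z : Fin n → ℝ}

lemma Sys.osc (S : Sys y y' k τ τm M x) (hh : ∀ j, 0 < xh j) (h : CBf y y' k xh) :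
    ∃ K, 0 ≤ K ∧ ∀ᶠ t in atTop, ∀ s ∈ Set.Icc (t - (τm + 1)) t,
      ‖x s - x t‖ ≤ K * oo y k τ τm x xh t := by
  obtain ⟨C, hC, hc⟩ := S.holder hh h
  have ht0 := S.hτm0
  refine ⟨√(C * (τm + 1)), Real.sqrt_nonneg _, ?_⟩
  filter_upwards [eventually_ge_atTop (τm + (τm + 1))] with t ht s hs
  have hK : 0 ≤ C * (τm + 1) := by positivity
  unfold oo
  rw [← Real.sqrt_mul hK]
  rw [pi_norm_le_iff_of_nonneg (Real.sqrt_nonneg _)]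
  intro j
  rw [Real.norm_eq_abs]
  apply Real.abs_le_sqrt
  have h1 := hc j s t (by linarith [hs.1]) hs.2
  have h2 : VV y k τ x xh univ univ s ≤ VV y k τ x xh univ univ (t - (τm+1)) :=
    S.V_anti hh h (show τm ≤ _ by linarith) (show τm ≤ _ by linarith [hs.1]) hs.1
  have h3 : VV y k τ x xh univ univ t ≤ VV y k τ x xh univ univ s :=
    S.V_anti hh h (show τm ≤ _ by linarith [hs.1]) (show τm ≤ _ by linarith) hs.2
  have h4 : C * (t - s) * (VV y k τ x xh univ univ s - VV y k τ x xh univ univ t) ≤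
      C * (τm + 1) * (VV y k τ x xh univ univ (t - (τm+1)) - VV y k τ x xh univ univ t) := by
    apply mul_le_mul _ (by linarith) (by linarith) hK
    exact mul_le_mul_of_nonneg_left (by linarith [hs.1]) hC.le
  have e : (x s - x t) j = x s j - x t j := rfl
  rw [e]
  nlinarith

lemma Sys.osc_mono (S : Sys y y' k τ τm M x) (hh : ∀ j, 0 < xh j) (h : CBf y y' k xh)
    (hx : Tendsto x atTop (𝓝 z)) (η : Fin n → ℕ) :
    ∃ K, 0 ≤ K ∧ ∀ᶠ t in atTop, ∀ s ∈ Set.Icc (t - (τm + 1)) t,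
      |mono (x s) η - mono (x t) η| ≤ K * oo y k τ τm x xh t := by
  obtain ⟨K, hK, U, hU, hL⟩ := mono_lip z η
  obtain ⟨K2, hK2, h2⟩ := S.osc hh h
  obtain ⟨T, hT⟩ := eventually_atTop.1 (hx.eventually hU)
  have ht0 := S.hτm0
  refine ⟨K * K2, by positivity, ?_⟩
  filter_upwards [h2, eventually_ge_atTop (T + (τm+1))] with t h2 ht s hs
  calc _ ≤ K * ‖x s - x t‖ := hL _ (hT s (by linarith [hs.1])) _ (hT t (by linarith))
    _ ≤ K * (K2 * oo y k τ τm x xh t) := mul_le_mul_of_nonneg_left (h2 s hs) hK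
    _ = _ := by ring

lemma Sys.win_osc (S : Sys y y' k τ τm M x) (hh : ∀ j, 0 < xh j) (h : CBf y y' k xh)
    (hx : Tendsto x atTop (𝓝 z)) (i : Fin r) :
    (fun t => Win (τ i) (fun s => mono (x s) (y i)) t - τ i * mono (x t) (y i))
      =O[atTop] oo y k τ τm x xh := by
  obtain ⟨K, hK, h1⟩ := S.osc_mono hh h hx (y i)
  apply Asymptotics.IsBigO.of_bound (τ i * K)
  filter_upwards [h1] with t h1
  rw [Real.norm_eq_abs, Real.norm_eq_abs, abs_of_nonneg (show 0 ≤ oo y k τ τm x xh t from Real.sqrt_nonneg _)]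
  rw [mul_assoc]
  apply Win_sub_abs (S.contg _) (S.hτ i)
  intro s hs
  exact h1 s ⟨by linarith [S.hτm i, hs.1], hs.2⟩

lemma Sys.bal_osc (S : Sys y y' k τ τm M x) (hh : ∀ j, 0 < xh j) (h : CBf y y' k xh)
    (hx : Tendsto x atTop (𝓝 z)) (i : Fin r) :
    (fun t => BB xh (y i) (y' i) (x t) - mono (x t) (y i)) =O[atTop] oo y k τ τm x xh := by
  obtain ⟨K, hK, h1⟩ := S.osc_mono hh h hx (y i)
  obtain ⟨K', hK', h1'⟩ := S.osc_mono hh h hx (y' i)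
  obtain ⟨C, hC, hc⟩ := S.imb hh h
  have ht0 := S.hτm0
  have hr : 0 < mono xh (y i) / mono xh (y' i) := div_pos (mono_pos' hh _) (mono_pos' hh _)
  apply Asymptotics.IsBigO.of_bound (K + K' * (mono xh (y i) / mono xh (y' i)) + √C)
  filter_upwards [h1, h1', eventually_ge_atTop (τm + (τm+1))] with t h1 h1' ht
  have ho : 0 ≤ oo y k τ τm x xh t := Real.sqrt_nonneg _
  rw [Real.norm_eq_abs, Real.norm_eq_abs, abs_of_nonneg ho]
  obtain ⟨t', ht', hi⟩ := hc t (by linarith)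
  have h2 := h1 (t' - τ i) ⟨by linarith [S.hτm i, ht'.1], by linarith [S.hτ i, ht'.2]⟩
  have h3 := h1' t' ⟨by linarith [ht'.1], ht'.2⟩
  have h4 : |mono (x (t' - τ i)) (y i) - BB xh (y i) (y' i) (x t')| ≤ √C * oo y k τ τm x xh t := by
    unfold oo
    rw [← Real.sqrt_mul hC.le]
    apply Real.abs_le_sqrt
    refine (hi i).trans (mul_le_mul_of_nonneg_left ?_ hC.le)
    have : VV y k τ x xh univ univ (t - 1) ≤ VV y k τ x xh univ univ (t - (τm+1)) :=
      S.V_anti hh h (show τm ≤ _ by linarith) (show τm ≤ _ by linarith) (by linarith)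
    linarith
  have e : ∀ u, BB xh (y i) (y' i) u = mono u (y' i) * (mono xh (y i) / mono xh (y' i)) := by
    intro u; unfold BB; ring
  rw [e] at h4 ⊢
  have h5 : |mono (x t') (y' i) * (mono xh (y i) / mono xh (y' i)) -
      mono (x t) (y' i) * (mono xh (y i) / mono xh (y' i))| ≤
      K' * oo y k τ τm x xh t * (mono xh (y i) / mono xh (y' i)) := by
    rw [← sub_mul, abs_mul, abs_of_pos hr]
    exact mul_le_mul_of_nonneg_right h3 hr.le
  rw [abs_le] at *
  constructor <;> nlinarith

lemma Sys.D_osc (S : Sys y y' k τ τm M x) (hh : ∀ j, 0 < xh j) (h : CBf y y' k xh)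
    (hx : Tendsto x atTop (𝓝 z)) (hz0 : ∀ j, 0 ≤ z j) (hoff : ∀ j ∉ ZZ z, xh j = z j)
    (hT' : ∀ i, i ∈ TT y (ZZ z) ↔ ∃ j ∈ ZZ z, y' i j ≠ 0) {i : Fin r} (hi : i ∉ TT y (ZZ z)) :
    (fun t => ∑ j, vv y y' i j * ww xh (x t) j) =O[atTop] oo y k τ τm x xh := by
  have hme : ∀ η : Fin n → ℕ, (∀ j ∈ ZZ z, η j = 0) → mono z η = mono xh η := by
    intro η hη
    unfold mono
    apply Finset.prod_congr rfl
    intro j _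
    by_cases hj : j ∈ ZZ z
    · rw [hη j hj]; simp
    · rw [hoff j hj]
  have e1 := hme (y i) (fun j hj => by by_contra h0; exact hi (mem_TT.2 ⟨j, hj, h0⟩))
  have e2 := hme (y' i) (fun j hj => by by_contra h0; exact hi ((hT' i).2 ⟨j, hj, h0⟩))
  have hg := mono_pos' hh (y i)
  have l1 : Tendsto (fun t => mono (x t) (y i)) atTop (𝓝 (mono xh (y i))) := by
    rw [← e1]; exact ((continuous_mono _).tendsto z).comp hx
  have l2 : Tendsto (fun t => BB xh (y i) (y' i) (x t)) atTop (𝓝 (mono xh (y i))) := by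
    have : mono xh (y i) = BB xh (y i) (y' i) z := by
      unfold BB; rw [e2]; have := (mono_pos' hh (y' i)).ne'; field_simp
    rw [this]; exact ((continuous_BB _ _ _).tendsto z).comp hx
  have hlog := (Real.hasStrictDerivAt_log hg.ne').hasStrictFDerivAt.isBigO_sub.comp_tendsto
    (l2.prodMk_nhds l1)
  refine ((hlog.trans (S.bal_osc hh h hx i))).congr_left ?_
  intro t
  simp only [Function.comp]
  rw [log_BB hh (S.pos t), log_mono_ww hh (S.pos t)]
  have : ∑ j, vv y y' i j * ww xh (x t) j =
    ∑ j, (y' i j : ℝ) * ww xh (x t) j - ∑ j, (y i j : ℝ) * ww xh (x t) j := by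
    rw [← Finset.sum_sub_distrib]
    exact Finset.sum_congr rfl fun j _ => by unfold vv; ring
  linarith

end Qb
open Topology

section Qc
variable {y y' : Fin r → Fin n → ℕ}
variable {k τ : Fin r → ℝ} {τm M : ℝ} {x : ℝ → Fin n → ℝ} {xh z : Fin n → ℝ}

/-- deviation off the zero set -/
noncomputable def ee (x : ℝ → Fin n → ℝ) (z : Fin n → ℝ) (t : ℝ) : ℝ :=
  ∑ j ∈ (ZZ z)ᶜ, |x t j - z j|

/-- mass on the zero set -/
noncomputable def mm (x : ℝ → Fin n → ℝ) (z : Fin n → ℝ) (t : ℝ) : ℝ :=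
  ∑ j ∈ ZZ z, x t j

lemma ee_nonneg (t : ℝ) : 0 ≤ ee x z t := Finset.sum_nonneg fun _ _ => abs_nonneg _

lemma Sys.mm_nonneg (S : Sys y y' k τ τm M x) (t : ℝ) : 0 ≤ mm x z t :=
  Finset.sum_nonneg fun _ _ => (S.pos _ _).le

lemma oo_nonneg (t : ℝ) : 0 ≤ oo y k τ τm x xh t := Real.sqrt_nonneg _

lemma Sys.le_mm (S : Sys y y' k τ τm M x) (t : ℝ) {j : Fin n} (hj : j ∈ ZZ z) :
    x t j ≤ mm x z t :=
  Finset.single_le_sum (f := fun j => x t j) (fun j _ => (S.pos t j).le) hj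

lemma le_ee (t : ℝ) {j : Fin n} (hj : j ∉ ZZ z) : |x t j - z j| ≤ ee x z t :=
  Finset.single_le_sum (f := fun j => |x t j - z j|) (fun j _ => abs_nonneg _)
    (Finset.mem_compl.2 hj)

lemma Sys.dev_le (S : Sys y y' k τ τm M x) (t : ℝ) (j : Fin n) :
    |x t j - z j| ≤ ee x z t + mm x z t := by
  by_cases hj : j ∈ ZZ z
  · have := S.le_mm (z := z) t hj
    rw [mem_ZZ.1 hj, sub_zero, abs_of_pos (S.pos t j)]
    linarith [ee_nonneg (x := x) (z := z) t]
  · linarith [le_ee (x := x) t hj, S.mm_nonneg (z := z) t]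

lemma Sys.norm_dev (S : Sys y y' k τ τm M x) :
    (fun t => x t - z) =O[atTop] (fun t => ee x z t + mm x z t) := by
  apply Asymptotics.IsBigO.of_bound 1
  refine Eventually.of_forall fun t => ?_
  have h0 : 0 ≤ ee x z t + mm x z t := add_nonneg (ee_nonneg t) (S.mm_nonneg t)
  rw [one_mul, Real.norm_eq_abs, abs_of_nonneg h0, pi_norm_le_iff_of_nonneg h0]
  intro j
  exact S.dev_le t j

lemma Sys.mono_dev (S : Sys y y' k τ τm M x) (hx : Tendsto x atTop (𝓝 z)) (η : Fin n → ℕ) :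
    (fun t => mono (x t) η - mono z η) =O[atTop] (fun t => ee x z t + mm x z t) := by
  have h : DifferentiableAt ℝ (fun u : Fin n → ℝ => mono u η) z := by
    unfold mono
    fun_prop
  exact (h.isBigO_sub.comp_tendsto hx).trans S.norm_dev

lemma Sys.ww_dev (S : Sys y y' k τ τm M x) (hh : ∀ j, 0 < xh j)
    (hx : Tendsto x atTop (𝓝 z)) (hoff : ∀ j ∉ ZZ z, xh j = z j) {j : Fin n} (hj : j ∉ ZZ z) :
    (fun t => ww xh (x t) j) =O[atTop] ee x z := by
  have hz := hoff j hj
  have l : Tendsto (fun t => x t j) atTop (𝓝 (xh j)) := by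
    rw [hz]; exact (tendsto_pi_nhds.1 hx j)
  have := (Real.hasDerivAt_log (hh j).ne').isBigO_sub.comp_tendsto l
  refine this.trans ?_
  apply Asymptotics.IsBigO.of_bound 1
  refine Eventually.of_forall fun t => ?_
  rw [one_mul, Real.norm_eq_abs, Real.norm_eq_abs, abs_of_nonneg (ee_nonneg t)]
  simp only [Function.comp, hz]
  exact le_ee t hj

/-- deviation of the conserved quantity -/
noncomputable def xi (y : Fin r → Fin n → ℕ) (k τ : Fin r → ℝ) (x : ℝ → Fin n → ℝ)
    (z : Fin n → ℝ) (t : ℝ) (j : Fin n) : ℝ :=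
  (x t j - z j) + ∑ i, k i * (y i j : ℝ) *
    (Win (τ i) (fun s => mono (x s) (y i)) t - τ i * mono z (y i))

lemma xi_eq (t : ℝ) (j : Fin n) : xi y k τ x z t j =
    XX y k τ x t j - (z j + ∑ i, k i * (y i j : ℝ) * (τ i * mono z (y i))) := by
  unfold xi XX
  simp only [mul_sub, Finset.sum_sub_distrib]
  ring

lemma Sys.win_dev (S : Sys y y' k τ τm M x) (hh : ∀ j, 0 < xh j) (h : CBf y y' k xh)
    (hx : Tendsto x atTop (𝓝 z)) (i : Fin r) :
    (fun t => Win (τ i) (fun s => mono (x s) (y i)) t - τ i * mono z (y i))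
      =O[atTop] (fun t => ee x z t + mm x z t + oo y k τ τm x xh t) := by
  have h1 := S.win_osc hh h hx i
  have h2 := (S.mono_dev hx (y i)).const_mul_left (τ i)
  have a1 : (oo y k τ τm x xh) =O[atTop] (fun t => ee x z t + mm x z t + oo y k τ τm x xh t) := by
    apply Asymptotics.IsBigO.of_bound 1
    refine Eventually.of_forall fun t => ?_
    have := oo_nonneg (y := y) (k := k) (τ := τ) (τm := τm) (x := x) (xh := xh) t
    have := ee_nonneg (x := x) (z := z) t
    have := S.mm_nonneg (z := z) t
    rw [one_mul, Real.norm_eq_abs, Real.norm_eq_abs, abs_of_nonneg (by assumption), abs_of_nonneg (by positivity)]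
    linarith
  have a2 : (fun t => ee x z t + mm x z t) =O[atTop] (fun t => ee x z t + mm x z t + oo y k τ τm x xh t) := by
    apply Asymptotics.IsBigO.of_bound 1
    refine Eventually.of_forall fun t => ?_
    have := oo_nonneg (y := y) (k := k) (τ := τ) (τm := τm) (x := x) (xh := xh) t
    have := ee_nonneg (x := x) (z := z) t
    have := S.mm_nonneg (z := z) t
    rw [one_mul, Real.norm_eq_abs, Real.norm_eq_abs, abs_of_nonneg (by positivity), abs_of_nonneg (by positivity)]
    linarith
  refine ((h1.trans a1).add (h2.trans a2)).congr_left fun t => ?_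
  ring

lemma Sys.xi_dev (S : Sys y y' k τ τm M x) (hh : ∀ j, 0 < xh j) (h : CBf y y' k xh)
    (hx : Tendsto x atTop (𝓝 z)) (j : Fin n) :
    (fun t => xi y k τ x z t j)
      =O[atTop] (fun t => ee x z t + mm x z t + oo y k τ τm x xh t) := by
  unfold xi
  apply Asymptotics.IsBigO.add
  · apply Asymptotics.IsBigO.of_bound 1
    refine Eventually.of_forall fun t => ?_
    have := oo_nonneg (y := y) (k := k) (τ := τ) (τm := τm) (x := x) (xh := xh) t
    have := ee_nonneg (x := x) (z := z) t
    have := S.mm_nonneg (z := z) t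
    have := S.dev_le (z := z) t j
    rw [one_mul, Real.norm_eq_abs, Real.norm_eq_abs, abs_of_nonneg (a := _ + _) (by positivity)]
    linarith
  · exact Asymptotics.IsBigO.fun_sum fun i _ => (S.win_dev hh h hx i).const_mul_left _

lemma mono_z_zero {i : Fin r} (hi : i ∈ TT y (ZZ z)) : mono z (y i) = 0 := by
  obtain ⟨j, hj, hij⟩ := mem_TT.1 hi
  exact mono_eq_zero.2 ⟨j, mem_ZZ.1 hj, hij⟩

lemma Sys.xi_W (S : Sys y y' k τ τm M x) {j : Fin n} (hj : j ∈ ZZ z) :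
    (fun t => xi y k τ x z t j) =O[atTop] mm x z := by
  obtain ⟨C, hC, hc⟩ := S.XX_le
  apply Asymptotics.IsBigO.of_bound C
  filter_upwards [eventually_ge_atTop (2*τm)] with t ht
  have e : xi y k τ x z t j = XX y k τ x t j := by
    rw [xi_eq, mem_ZZ.1 hj, Finset.sum_eq_zero, add_zero, sub_zero]
    intro i _
    by_cases hij : y i j = 0
    · simp [hij]
    · rw [mono_z_zero (mem_TT.2 ⟨j, hj, hij⟩)]; ring
  have h1 := S.le_XX j t
  have h2 := S.pos t j
  rw [e, Real.norm_eq_abs, Real.norm_eq_abs, abs_of_nonneg (by linarith), abs_of_nonneg (S.mm_nonneg t)]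
  exact (hc j t ht).trans (mul_le_mul_of_nonneg_left (S.le_mm t hj) (by linarith))

lemma Sys.win_T (S : Sys y y' k τ τm M x) {i : Fin r} (hi : i ∈ TT y (ZZ z)) :
    (fun t => Win (τ i) (fun s => mono (x s) (y i)) t - τ i * mono z (y i)) =O[atTop] mm x z := by
  obtain ⟨C, hC, hc⟩ := S.Win_le_mul
  obtain ⟨j, hj, hij⟩ := mem_TT.1 hi
  apply Asymptotics.IsBigO.of_bound C
  filter_upwards [eventually_ge_atTop (2*τm)] with t ht
  have h0 : 0 ≤ Win (τ i) (fun s => mono (x s) (y i)) t :=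
    Win_nonneg (S.contg _) (S.hτ i) (fun s => (S.gpos _ _).le)
  rw [mono_z_zero hi, mul_zero, sub_zero, Real.norm_eq_abs, Real.norm_eq_abs, abs_of_nonneg h0,
    abs_of_nonneg (S.mm_nonneg t)]
  exact ((hc i j t ht hij).2).trans (mul_le_mul_of_nonneg_left (S.le_mm t hj) hC)

end Qc
open Topology

section Qd
variable {y y' : Fin r → Fin n → ℕ}
variable {k τ : Fin r → ℝ} {τm M : ℝ} {x : ℝ → Fin n → ℝ} {xh z : Fin n → ℝ}

lemma sum_compl_split (W : Finset (Fin n)) (f : Fin n → ℝ) :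
    ∑ j, f j = ∑ j ∈ Wᶜ, f j + ∑ j ∈ W, f j := by
  rw [add_comm]; exact (Finset.sum_add_sum_compl W f).symm

lemma mono_off (hoff : ∀ j ∉ ZZ z, xh j = z j) (η : Fin n → ℕ) (hη : ∀ j ∈ ZZ z, η j = 0) :
    mono z η = mono xh η := by
  unfold mono
  apply Finset.prod_congr rfl
  intro j _
  by_cases hj : j ∈ ZZ z
  · rw [hη j hj]; simp
  · rw [hoff j hj]

lemma not_TT {i : Fin r} {W : Finset (Fin n)} (hi : i ∉ TT y W) : ∀ j ∈ W, y i j = 0 :=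
  fun j hj => by by_contra h0; exact hi (mem_TT.2 ⟨j, hj, h0⟩)

lemma Sys.esq (S : Sys y y' k τ τm M x) (hh : ∀ j, 0 < xh j) (h : CBf y y' k xh)
    (hx : Tendsto x atTop (𝓝 z)) (hz0 : ∀ j, 0 ≤ z j) (hoff : ∀ j ∉ ZZ z, xh j = z j)
    (hT' : ∀ i, i ∈ TT y (ZZ z) ↔ ∃ j ∈ ZZ z, y' i j ≠ 0)
    (hdual : ∀ q : Fin n → ℝ, ∃ qh : Fin n → ℝ, (∀ j ∉ ZZ z, qh j = q j) ∧
      ∀ i ∈ TT y (ZZ z), ∑ j, qh j * vv y y' i j = 0) :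
    ∃ f g : ℝ → ℝ, f =O[atTop] (fun t => ee x z t * mm x z t + oo y k τ τm x xh t * ee x z t) ∧
      g =O[atTop] (fun t => oo y k τ τm x xh t * (ee x z t + mm x z t + oo y k τ τm x xh t)) ∧
      ∀ᶠ t in atTop, ∑ j ∈ (ZZ z)ᶜ, ww xh (x t) j * (x t j - z j) ≤ g t - f t := by
  classical
  choose E hE1 hE2 using fun j0 : Fin n => hdual (Pi.single j0 1)
  obtain ⟨G, hG⟩ := ginv (vv y y')
  set qh : ℝ → Fin n → ℝ := fun t j => ∑ j0 ∈ (ZZ z)ᶜ, ww xh (x t) j0 * E j0 j with hqh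
  have hA : ∀ t, ∀ j ∉ ZZ z, qh t j = ww xh (x t) j := by
    intro t j hj
    rw [hqh]
    beta_reduce
    rw [Finset.sum_eq_single_of_mem j (Finset.mem_compl.2 hj)]
    · rw [hE1 j j hj]; simp
    · intro b _ hb
      rw [hE1 b j hj, Pi.single_eq_of_ne (Ne.symm hb)]; ring
  have hB : ∀ t, ∀ i ∈ TT y (ZZ z), ∑ j, qh t j * vv y y' i j = 0 := by
    intro t i hi
    simp only [hqh, Finset.sum_mul]
    rw [Finset.sum_comm]
    apply Finset.sum_eq_zero
    intro j0 _
    have := hE2 j0 i hi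
    simp only [mul_assoc]
    rw [← Finset.mul_sum, this, mul_zero]
  have hC : ∀ t, ∀ i ∉ TT y (ZZ z), ∑ j, qh t j * vv y y' i j =
      ∑ j, vv y y' i j * ww xh (x t) j := by
    intro t i hi
    apply Finset.sum_congr rfl
    intro j _
    by_cases hj : j ∈ ZZ z
    · have h1 := not_TT hi j hj
      have h2 : y' i j = 0 := by
        by_contra h0; exact hi ((hT' i).2 ⟨j, hj, h0⟩)
      have : vv y y' i j = 0 := by unfold vv; rw [h1, h2]; simp
      rw [this]; ring
    · rw [hA t j hj]; ring
  have hwe : ∀ {j}, j ∉ ZZ z → (fun t => ww xh (x t) j) =O[atTop] ee x z :=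
    fun hj => S.ww_dev hh hx hoff hj
  have hqe : ∀ j, (fun t => qh t j) =O[atTop] ee x z := by
    intro j
    apply Asymptotics.IsBigO.fun_sum
    intro j0 hj0
    exact ((hwe (Finset.mem_compl.1 hj0)).const_mul_left (E j0 j)).congr_left fun t => by ring
  set qt : ℝ → Fin n → ℝ := fun t j => ∑ i', (∑ j', qh t j' * vv y y' i' j') * G i' j with hqt
  have hto : ∀ j, (fun t => qt t j) =O[atTop] oo y k τ τm x xh := by
    intro j
    apply Asymptotics.IsBigO.fun_sum
    intro i _
    by_cases hi : i ∈ TT y (ZZ z)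
    · refine (Asymptotics.isBigO_zero _ _).congr_left fun t => ?_
      rw [hB t i hi, zero_mul]
    · refine ((S.D_osc hh h hx hz0 hoff hT' hi).const_mul_left (G i j)).congr_left fun t => ?_
      rw [hC t i hi]; ring
  have hcons : ∀ t, τm ≤ t → ∑ j, qh t j * xi y k τ x z t j = ∑ j, qt t j * xi y k τ x z t j := by
    intro t ht
    have hu : ∀ i, ∑ j, (qh t j - qt t j) * vv y y' i j = 0 := by
      intro i
      have := hG (qh t) i
      simp only [sub_mul, Finset.sum_sub_distrib]
      rw [hqt]
      linarith
    have := S.conserved hh h hx hu ht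
    have h2 : ∑ j, (qh t j - qt t j) * xi y k τ x z t j = 0 := by
      simp only [xi_eq, mul_sub, Finset.sum_sub_distrib] at this ⊢
      linarith
    simp only [sub_mul, Finset.sum_sub_distrib] at h2
    linarith
  set om : ℝ → Fin r → ℝ := fun t i => ∑ j ∈ (ZZ z)ᶜ, (y i j : ℝ) * ww xh (x t) j with hom
  have home : ∀ i, (fun t => om t i) =O[atTop] ee x z := by
    intro i
    apply Asymptotics.IsBigO.fun_sum
    intro j hj
    exact (hwe (Finset.mem_compl.1 hj)).const_mul_left _
  set a : ℝ → Fin r → ℝ := fun t i =>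
    Win (τ i) (fun s => mono (x s) (y i)) t - τ i * mono z (y i) with ha
  refine ⟨fun t => ∑ j ∈ ZZ z, qh t j * xi y k τ x z t j + ∑ i ∈ TT y (ZZ z), k i * (om t i * a t i)
      + ∑ i ∈ (TT y (ZZ z))ᶜ, k i * ((Win (τ i) (fun s => mono (x s) (y i)) t - τ i * mono (x t) (y i)) * om t i),
    fun t => ∑ j, qt t j * xi y k τ x z t j, ?_, ?_, ?_⟩
  · have b1 : (fun t => ee x z t * mm x z t) =O[atTop]
        (fun t => ee x z t * mm x z t + oo y k τ τm x xh t * ee x z t) := by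
      apply Asymptotics.IsBigO.of_bound 1
      refine Eventually.of_forall fun t => ?_
      have := oo_nonneg (y := y) (k := k) (τ := τ) (τm := τm) (x := x) (xh := xh) t
      have := ee_nonneg (x := x) (z := z) t
      have := S.mm_nonneg (z := z) t
      rw [one_mul, Real.norm_eq_abs, Real.norm_eq_abs, abs_of_nonneg (by positivity),
        abs_of_nonneg (by positivity)]
      have : 0 ≤ oo y k τ τm x xh t * ee x z t := by positivity
      linarith
    have b2 : (fun t => oo y k τ τm x xh t * ee x z t) =O[atTop]
        (fun t => ee x z t * mm x z t + oo y k τ τm x xh t * ee x z t) := by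
      apply Asymptotics.IsBigO.of_bound 1
      refine Eventually.of_forall fun t => ?_
      have := oo_nonneg (y := y) (k := k) (τ := τ) (τm := τm) (x := x) (xh := xh) t
      have := ee_nonneg (x := x) (z := z) t
      have := S.mm_nonneg (z := z) t
      rw [one_mul, Real.norm_eq_abs, Real.norm_eq_abs, abs_of_nonneg (by positivity),
        abs_of_nonneg (by positivity)]
      have : 0 ≤ ee x z t * mm x z t := by positivity
      linarith
    refine ((Asymptotics.IsBigO.fun_sum fun j hj => ?_).add
      (Asymptotics.IsBigO.fun_sum fun i hi => ?_)).add (Asymptotics.IsBigO.fun_sum fun i hi => ?_)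
    · exact ((hqe j).mul (S.xi_W hj)).trans b1
    · exact (((home i).mul (S.win_T hi)).const_mul_left (k i)).trans b1
    · exact (((S.win_osc hh h hx i).mul (home i)).const_mul_left (k i)).trans b2
  · exact Asymptotics.IsBigO.fun_sum fun j _ => (hto j).mul (S.xi_dev hh h hx j)
  · filter_upwards [eventually_ge_atTop τm] with t ht
    rw [← hcons t ht, sum_compl_split (ZZ z) (fun j => qh t j * xi y k τ x z t j)]
    have e1 : ∑ j ∈ (ZZ z)ᶜ, qh t j * xi y k τ x z t j =
        ∑ j ∈ (ZZ z)ᶜ, ww xh (x t) j * (x t j - z j) + ∑ i, k i * (om t i * a t i) := by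
      have : ∑ i, k i * (om t i * a t i) = ∑ j ∈ (ZZ z)ᶜ, ∑ i, ww xh (x t) j * (k i * (y i j : ℝ) * a t i) := by
        rw [Finset.sum_comm]
        apply Finset.sum_congr rfl
        intro i _
        simp only [hom]
        rw [Finset.sum_mul, Finset.mul_sum]
        exact Finset.sum_congr rfl fun j _ => by ring
      rw [this, ← Finset.sum_add_distrib]
      apply Finset.sum_congr rfl
      intro j hj
      rw [hA t j (Finset.mem_compl.1 hj), ← Finset.mul_sum]
      unfold xi
      ring
    have e2 : ∑ i ∈ (TT y (ZZ z))ᶜ, k i * ((Win (τ i) (fun s => mono (x s) (y i)) t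
        - τ i * mono (x t) (y i)) * om t i) ≤ ∑ i ∈ (TT y (ZZ z))ᶜ, k i * (om t i * a t i) := by
      apply Finset.sum_le_sum
      intro i hi
      have hi' := not_TT (Finset.mem_compl.1 hi)
      have ho : om t i = Real.log (mono (x t) (y i)) - Real.log (mono xh (y i)) := by
        rw [log_mono_ww hh (S.pos t), sum_compl_split (ZZ z)]
        have : ∑ j ∈ ZZ z, (y i j : ℝ) * ww xh (x t) j = 0 :=
          Finset.sum_eq_zero fun j hj => by rw [hi' j hj]; simp
        rw [this]; simp only [hom]; ring
      have hmz := mono_off hoff (y i) hi'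
      have hp := log_prod_nonneg (S.gpos (y i) t) (mono_pos' hh (y i))
      apply mul_le_mul_of_nonneg_left _ (S.hk i).le
      simp only [ha]
      rw [hmz, ho]
      have := mul_nonneg (S.hτ i) hp
      nlinarith
    have e3 := Finset.sum_add_sum_compl (TT y (ZZ z)) (fun i => k i * (om t i * a t i))
    beta_reduce
    linarith

lemma Sys.ee_bound (S : Sys y y' k τ τm M x) (hh : ∀ j, 0 < xh j) (h : CBf y y' k xh)
    (hx : Tendsto x atTop (𝓝 z)) (hz0 : ∀ j, 0 ≤ z j) (hoff : ∀ j ∉ ZZ z, xh j = z j)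
    (hT' : ∀ i, i ∈ TT y (ZZ z) ↔ ∃ j ∈ ZZ z, y' i j ≠ 0)
    (hdual : ∀ q : Fin n → ℝ, ∃ qh : Fin n → ℝ, (∀ j ∉ ZZ z, qh j = q j) ∧
      ∀ i ∈ TT y (ZZ z), ∑ j, qh j * vv y y' i j = 0) :
    ∃ C, 0 ≤ C ∧ ∀ᶠ t in atTop, (ee x z t)^2 ≤ C * ((oo y k τ τm x xh t)^2 + (mm x z t)^2) := by
  obtain ⟨f, g, hf, hg, hfg⟩ := S.esq hh h hx hz0 hoff hT' hdual
  obtain ⟨A, hA0, hA⟩ := hf.exists_nonneg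
  obtain ⟨B, hB0, hB⟩ := hg.exists_nonneg
  have hM := S.hM
  set D : ℝ := (n : ℝ) * (8 * M)  with hD
  have hD0 : 0 ≤ D := by positivity
  set C := D * (A + B) with hC
  have hC0 : 0 ≤ C := by positivity
  refine ⟨2 * (C^2 + 4 * C^2 + 2 * C), by positivity, ?_⟩
  filter_upwards [hA.bound, hB.bound, hfg] with t hA hB hfg
  have o0 := oo_nonneg (y := y) (k := k) (τ := τ) (τm := τm) (x := x) (xh := xh) t
  have e0 := ee_nonneg (x := x) (z := z) t
  have m0 := S.mm_nonneg (z := z) t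
  rw [Real.norm_eq_abs, Real.norm_eq_abs, abs_of_nonneg (a := _ + _) (by positivity)] at hA
  rw [Real.norm_eq_abs, Real.norm_eq_abs, abs_of_nonneg (a := _ * _) (by positivity)] at hB
  have h1 : (ee x z t)^2 ≤ D * ∑ j ∈ (ZZ z)ᶜ, ww xh (x t) j * (x t j - z j) := by
    have c1 := sq_sum_le_card_mul_sum_sq (s := (ZZ z)ᶜ) (f := fun j => |x t j - z j|)
    have c2 : (((ZZ z)ᶜ.card : ℕ) : ℝ) ≤ n := by
      exact_mod_cast (Finset.card_le_univ _).trans (by simp)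
    have c3 : ∑ j ∈ (ZZ z)ᶜ, |x t j - z j|^2 ≤
        8 * M * ∑ j ∈ (ZZ z)ᶜ, ww xh (x t) j * (x t j - z j) := by
      rw [Finset.mul_sum]
      apply Finset.sum_le_sum
      intro j hj
      have hj' := hoff j (Finset.mem_compl.1 hj)
      have zM : z j ≤ M := le_of_tendsto (tendsto_pi_nhds.1 hx j)
        (Eventually.of_forall fun t => S.bd t j)
      have q1 := FF_sq (S.pos t j) (hh j) (S.bd t j) (by rw [hj']; exact zM)
      have q2 := FF_nonneg (hh j) (S.pos t j)
      rw [sq_abs, ← hj']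
      have q3 : ww xh (x t) j * (x t j - xh j) = FF (x t j) (xh j) + FF (xh j) (x t j) := by
        unfold ww FF; ring
      rw [q3]
      have q4 := FF_nonneg (S.pos t j) (hh j)
      nlinarith [mul_nonneg (show 0 ≤ M by linarith) q2, mul_nonneg (show 0 ≤ M by linarith) q4]
    have c4 : 0 ≤ ∑ j ∈ (ZZ z)ᶜ, |x t j - z j|^2 := Finset.sum_nonneg fun _ _ => by positivity
    calc (ee x z t)^2 ≤ (((ZZ z)ᶜ.card : ℕ) : ℝ) * ∑ j ∈ (ZZ z)ᶜ, |x t j - z j|^2 := c1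
      _ ≤ n * (8 * M * ∑ j ∈ (ZZ z)ᶜ, ww xh (x t) j * (x t j - z j)) :=
        mul_le_mul c2 c3 c4 (by positivity)
      _ = _ := by rw [hD]; ring
  have fa := abs_le.1 hA
  have ga := abs_le.1 hB
  generalize ee x z t = e at *
  generalize mm x z t = m at *
  generalize oo y k τ τm x xh t = o at *
  have h2 : e^2 ≤ D * (B * (o * (e+m+o)) + A * (e*m + o*e)) :=
    h1.trans (mul_le_mul_of_nonneg_left (by linarith) hD0)
  have h3 : D * (B * (o * (e+m+o)) + A * (e*m + o*e)) ≤ C * (e*m + 2*(o*e) + o*m + o^2) := by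
    have : C * (e*m + 2*(o*e) + o*m + o^2) - D * (B * (o * (e+m+o)) + A * (e*m + o*e)) =
      D * B * (e*m + o*e) + D * A * (o*e+o*m+o^2) := by rw [hC]; ring
    have : 0 ≤ D * B * (e*m + o*e) + D * A * (o*e+o*m+o^2) := by positivity
    linarith
  have h4 : C * (e*m) ≤ e^2/4 + C^2 * m^2 := by nlinarith [sq_nonneg (e/2 - C*m)]
  have h5 : C * (2*(o*e)) ≤ e^2/4 + 4*C^2 * o^2 := by nlinarith [sq_nonneg (e/2 - 2*C*o)]
  have h6 : C * (o*m) ≤ C * (o^2 + m^2) :=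
    mul_le_mul_of_nonneg_left (by nlinarith [sq_nonneg (o-m)]) hC0
  nlinarith [mul_nonneg hC0 (sq_nonneg m), mul_nonneg (sq_nonneg C) (sq_nonneg m),
    mul_nonneg (sq_nonneg C) (sq_nonneg o)]

lemma Sys.Q_bound (S : Sys y y' k τ τm M x) (hh : ∀ j, 0 < xh j) (h : CBf y y' k xh)
    (hx : Tendsto x atTop (𝓝 z)) (hz0 : ∀ j, 0 ≤ z j) (hoff : ∀ j ∉ ZZ z, xh j = z j)
    (hT' : ∀ i, i ∈ TT y (ZZ z) ↔ ∃ j ∈ ZZ z, y' i j ≠ 0)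
    (hdual : ∀ q : Fin n → ℝ, ∃ qh : Fin n → ℝ, (∀ j ∉ ZZ z, qh j = q j) ∧
      ∀ i ∈ TT y (ZZ z), ∑ j, qh j * vv y y' i j = 0) :
    ∃ C, 0 < C ∧ ∀ᶠ t in atTop, VV y k τ x xh (ZZ z)ᶜ (TT y (ZZ z))ᶜ t ≤
      C * ((VV y k τ x xh univ univ (t - (τm + 1)) - VV y k τ x xh univ univ t) + mm x z t) := by
  obtain ⟨C, hC0, hC⟩ := S.ee_bound hh h hx hz0 hoff hT' hdual
  have hg : ∀ i ∈ (TT y (ZZ z))ᶜ, ∃ K, 0 ≤ K ∧ ∀ᶠ t in atTop,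
      k i * Win (τ i) (fun s => FF (mono (x s) (y i)) (mono xh (y i))) t ≤
        K * ((ee x z t)^2 + (mm x z t)^2 + (oo y k τ τm x xh t)^2) := by
    intro i hi
    have hi' := not_TT (Finset.mem_compl.1 hi)
    have hmz := mono_off hoff (y i) hi'
    have hgp := mono_pos' hh (y i)
    obtain ⟨K1, hK1, h1⟩ := S.osc_mono hh h hx (y i)
    obtain ⟨K2, hK2, h2⟩ := (S.mono_dev hx (y i)).exists_nonneg
    have hki := (S.hk i).le
    have hti := S.hτ i
    refine ⟨k i * (τ i * ((K1+K2)^2 * 3 / mono xh (y i))), by positivity, ?_⟩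
    filter_upwards [h1, h2.bound] with t h1 h2
    have o0 := oo_nonneg (y := y) (k := k) (τ := τ) (τm := τm) (x := x) (xh := xh) t
    have e0 := ee_nonneg (x := x) (z := z) t
    have m0 := S.mm_nonneg (z := z) t
    rw [Real.norm_eq_abs, Real.norm_eq_abs, abs_of_nonneg (a := _ + _) (by positivity)] at h2
    rw [mul_assoc, mul_assoc]
    apply mul_le_mul_of_nonneg_left _ hki
    apply Win_le ((continuous_FF _).comp (S.contg (y i))) hti
    intro s hs
    have h3 := h1 s ⟨by linarith [S.hτm i, hs.1], hs.2⟩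
    rw [hmz] at h2
    have h4 : |mono (x s) (y i) - mono xh (y i)| ≤ (K1 + K2) * (ee x z t + mm x z t + oo y k τ τm x xh t) := by
      have h5 := abs_sub_le (mono (x s) (y i)) (mono (x t) (y i)) (mono xh (y i))
      nlinarith [mul_nonneg hK1 e0, mul_nonneg hK1 m0, mul_nonneg hK2 o0]
    refine (FF_le_sq (S.gpos _ _) hgp).trans ?_
    rw [div_mul_eq_mul_div]
    apply div_le_div_of_nonneg_right _ hgp.le
    rw [← sq_abs]
    calc _ ≤ ((K1 + K2) * (ee x z t + mm x z t + oo y k τ τm x xh t))^2 :=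
          pow_le_pow_left₀ (abs_nonneg _) h4 2
      _ = (K1+K2)^2 * (ee x z t + mm x z t + oo y k τ τm x xh t)^2 := by ring
      _ ≤ (K1+K2)^2 * (3 * ((ee x z t)^2 + (mm x z t)^2 + (oo y k τ τm x xh t)^2)) := by
          apply mul_le_mul_of_nonneg_left _ (sq_nonneg _)
          nlinarith [sq_nonneg (ee x z t - mm x z t), sq_nonneg (ee x z t - oo y k τ τm x xh t),
            sq_nonneg (mm x z t - oo y k τ τm x xh t)]
      _ = _ := by ring
  choose! K hK0 hK using hg
  set KK := ∑ i ∈ (TT y (ZZ z))ᶜ, K i with hKK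
  have hKK0 : 0 ≤ KK := Finset.sum_nonneg hK0
  set L := ∑ j ∈ (ZZ z)ᶜ, 1 / xh j with hL
  have hL0 : 0 ≤ L := Finset.sum_nonneg fun j _ => (one_div_pos.2 (hh j)).le
  have hK' := (Filter.eventually_all_finset _).2 hK
  have hm : ∀ᶠ t in atTop, mm x z t ≤ 1 := by
    have : Tendsto (mm x z) atTop (𝓝 (∑ j ∈ ZZ z, z j)) :=
      tendsto_finsetSum _ fun j _ => tendsto_pi_nhds.1 hx j
    rw [Finset.sum_eq_zero (fun j hj => mem_ZZ.1 hj)] at this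
    exact this.eventually_le_const one_pos
  refine ⟨(L + KK) * (C + 1) + 1, by positivity, ?_⟩
  filter_upwards [hC, hK', hm, eventually_ge_atTop (τm + (τm+1))] with t hC hK' hm ht
  have o0 := oo_nonneg (y := y) (k := k) (τ := τ) (τm := τm) (x := x) (xh := xh) t
  have e0 := ee_nonneg (x := x) (z := z) t
  have m0 := S.mm_nonneg (z := z) t
  have hV : VV y k τ x xh univ univ t ≤ VV y k τ x xh univ univ (t - (τm+1)) :=
    S.V_anti hh h (show τm ≤ _ by linarith) (show τm ≤ _ by linarith [S.hτm0])
      (by linarith [S.hτm0])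
  have ho : (oo y k τ τm x xh t)^2 =
      VV y k τ x xh univ univ (t - (τm + 1)) - VV y k τ x xh univ univ t :=
    Real.sq_sqrt (by linarith)
  have h1 : ∑ j ∈ (ZZ z)ᶜ, FF (x t j) (xh j) ≤ L * (ee x z t)^2 := by
    rw [hL, Finset.sum_mul]
    apply Finset.sum_le_sum
    intro j hj
    refine (FF_le_sq (S.pos t j) (hh j)).trans ?_
    rw [one_div, inv_mul_eq_div]
    apply div_le_div_of_nonneg_right _ (hh j).le
    rw [hoff j (Finset.mem_compl.1 hj), ← sq_abs]
    exact pow_le_pow_left₀ (abs_nonneg _) (le_ee t (Finset.mem_compl.1 hj)) 2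
  have h2 : ∑ i ∈ (TT y (ZZ z))ᶜ, k i * Win (τ i) (fun s => FF (mono (x s) (y i)) (mono xh (y i))) t
      ≤ KK * ((ee x z t)^2 + (mm x z t)^2 + (oo y k τ τm x xh t)^2) := by
    rw [hKK, Finset.sum_mul]
    exact Finset.sum_le_sum hK'
  rw [← ho]
  unfold VV
  refine (add_le_add h1 h2).trans ?_
  generalize ee x z t = e at *
  generalize mm x z t = m at *
  generalize oo y k τ τm x xh t = o at *
  have hmm : m^2 ≤ m := by nlinarith
  have he : e^2 ≤ C * (o^2 + m) := hC.trans (mul_le_mul_of_nonneg_left (by linarith) hC0)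
  have g1 : L * e^2 ≤ L * (C * (o^2+m)) := mul_le_mul_of_nonneg_left he hL0
  have g2 : KK * (e^2 + m^2 + o^2) ≤ KK * (C * (o^2+m) + (o^2 + m)) :=
    mul_le_mul_of_nonneg_left (by linarith) hKK0
  nlinarith [mul_nonneg hL0 (add_nonneg (sq_nonneg o) m0), sq_nonneg o]

end Qd
open Topology

lemma final_abs {h Y : ℝ → ℝ} {C T0 : ℝ} (hC : 0 < C) (hT0 : 0 < T0)
    (h0 : ∀ᶠ t in atTop, 0 ≤ h t) (hY0 : ∀ᶠ t in atTop, 0 < Y t)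
    (hY : ∀ᶠ t in atTop, h t + Y t / 2 ≤ C * (h (t - T0) - h t))
    (hgr : ∀ σ > 1, ∀ᶠ t in atTop, Y t ≤ σ * Y (t + T0)) : False := by
  set σ : ℝ := 1 + 1 / (2 * C) with hσ
  have hσ1 : 1 < σ := by rw [hσ]; have : 0 < 1 / (2 * C) := by positivity
                         linarith
  set θ : ℝ := C / (1 + C) with hθ
  have hθ0 : 0 < θ := by positivity
  obtain ⟨A, hA⟩ := eventually_atTop.1 (h0.and (hY0.and (hY.and (hgr σ hσ1))))
  set a : ℕ → ℝ := fun N => A + N * T0 with ha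
  have haA : ∀ N, A ≤ a N := fun N => by
    simp only [ha]; have : 0 ≤ (N : ℝ) * T0 := by positivity
    linarith
  have ha1 : ∀ N, a (N+1) - T0 = a N := fun N => by simp only [ha]; push_cast; ring
  have ha2 : ∀ N, a N + T0 = a (N+1) := fun N => by simp only [ha]; push_cast; ring
  have hh : ∀ N, h (a N) ≤ θ^N * h (a 0) := by
    intro N
    induction N with
    | zero => simp
    | succ N ih =>
      obtain ⟨_, b2, b3, _⟩ := hA _ (haA (N+1))
      rw [ha1] at b3
      have : h (a (N+1)) ≤ θ * h (a N) := by
        rw [hθ, div_mul_eq_mul_div, le_div_iff₀ (by linarith)]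
        nlinarith
      calc _ ≤ θ * h (a N) := this
        _ ≤ θ * (θ^N * h (a 0)) := mul_le_mul_of_nonneg_left ih hθ0.le
        _ = _ := by ring
  have hYs : ∀ N, Y (a 0) ≤ σ^N * Y (a N) := by
    intro N
    induction N with
    | zero => simp
    | succ N ih =>
      obtain ⟨_, b2, b3, b4⟩ := hA _ (haA N)
      rw [ha2] at b4
      calc _ ≤ σ^N * Y (a N) := ih
        _ ≤ σ^N * (σ * Y (a (N+1))) := mul_le_mul_of_nonneg_left b4 (by positivity)
        _ = _ := by ring
  have hfin : ∀ N : ℕ, Y (a 0) ≤ (σ * θ)^N * (σ * (2 * C) * h (a 0)) := by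
    intro N
    obtain ⟨b1, b2, b3, b4⟩ := hA _ (haA (N+1))
    rw [ha1] at b3
    have b5 : Y (a (N+1)) ≤ 2 * C * h (a N) := by nlinarith
    have b6 : Y (a (N+1)) ≤ 2 * C * (θ^N * h (a 0)) :=
      b5.trans (mul_le_mul_of_nonneg_left (hh N) (by positivity))
    calc _ ≤ σ^(N+1) * Y (a (N+1)) := hYs _
      _ ≤ σ^(N+1) * (2 * C * (θ^N * h (a 0))) := mul_le_mul_of_nonneg_left b6 (by positivity)
      _ = _ := by ring
  have hlt : σ * θ < 1 := by
    have : σ * θ = (C + 1/2) / (1 + C) := by rw [hσ, hθ]; field_simp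
    rw [this, div_lt_one (by linarith)]
    linarith
  have hl := (tendsto_pow_atTop_nhds_zero_of_lt_one (by positivity) hlt).mul_const
    (σ * (2 * C) * h (a 0))
  rw [zero_mul] at hl
  have := ge_of_tendsto hl (Eventually.of_forall hfin)
  have := (hA _ (haA 0)).2.1
  linarith

section Fin2
variable {l : ℕ} {y y' : Fin r → Fin n → ℕ} {Sp : Fin l → Set (Fin n)} {grp : Fin r → Fin l}
variable {k τ : Fin r → ℝ} {τm M : ℝ} {x : ℝ → Fin n → ℝ} {xh z : Fin n → ℝ}

lemma Sys.contra (S : Sys y y' k τ τm M x) (hh : ∀ j, 0 < xh j) (h : CBf y y' k xh)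
    (hx : Tendsto x atTop (𝓝 z)) (hz0 : ∀ j, 0 ≤ z j) (hoff : ∀ j ∉ ZZ z, xh j = z j)
    (hT' : ∀ i, i ∈ TT y (ZZ z) ↔ ∃ j ∈ ZZ z, y' i j ≠ 0)
    (hdual : ∀ q : Fin n → ℝ, ∃ qh : Fin n → ℝ, (∀ j ∉ ZZ z, qh j = q j) ∧
      ∀ i ∈ TT y (ZZ z), ∑ j, qh j * vv y y' i j = 0) (hne : (ZZ z).Nonempty) : False := by
  classical
  set W := ZZ z with hW
  set T := TT y W with hT
  set Vi : ℝ := ∑ j ∈ W, xh j + ∑ i ∈ T, k i * (τ i * mono xh (y i)) with hVi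
  have hT1 : ∀ i ∈ T, ∃ j ∈ W, y i j ≠ 0 := fun i hi => mem_TT.1 hi
  have hzW : ∀ j ∈ W, z j = 0 := fun j hj => mem_ZZ.1 hj
  have hxW : ∀ j ∈ W, Tendsto (fun t => x t j) atTop (𝓝 0) := fun j hj => by
    rw [← hzW j hj]; exact tendsto_pi_nhds.1 hx j
  have hFs : ∀ a : ℝ, FF a a = 0 := fun a => by unfold FF; ring
  -- split
  have hsplit : ∀ t, VV y k τ x xh univ univ t = VV y k τ x xh W T t + VV y k τ x xh Wᶜ Tᶜ t := by
    intro t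
    unfold VV
    rw [← Finset.sum_add_sum_compl W, ← Finset.sum_add_sum_compl T]
    ring
  -- limit
  have hlim : Tendsto (VV y k τ x xh univ univ) atTop (𝓝 Vi) := by
    have h1 := S.VV_lim hh h xh W T le_rfl hx
    rw [bdry_val hzW hT1] at h1
    have h2 := S.VV_lim hh h xh Wᶜ Tᶜ le_rfl hx
    have e1 : ∑ j ∈ Wᶜ, FF (z j) (xh j) = 0 := Finset.sum_eq_zero fun j hj => by
      rw [hoff j (Finset.mem_compl.1 hj), hFs]
    have e2 : ∑ i ∈ Tᶜ, k i * (τ i * FF (mono z (y i)) (mono xh (y i))) = 0 :=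
      Finset.sum_eq_zero fun i hi => by
        rw [mono_off hoff (y i) (not_TT (Finset.mem_compl.1 hi)), hFs]; ring
    rw [e1, e2] at h2
    have := h1.add h2
    rw [add_zero, add_zero] at this
    exact this.congr fun t => (hsplit t).symm
  obtain ⟨C, hC, hQ⟩ := S.Q_bound hh h hx hz0 hoff hT' hdual
  have ht0 := S.hτm0
  have hY1 := S.Y_bound hh W T hT1 hxW 1
  have hY2 := S.Y_bound hh W T hT1 hxW (2 * C)
  have hmp : ∀ t, 0 < ∑ j ∈ W, x t j := fun t => Finset.sum_pos (fun j _ => S.pos t j) hne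
  refine final_abs (h := fun t => VV y k τ x xh univ univ t - Vi)
    (Y := fun t => Vi - VV y k τ x xh W T t) (C := C) (T0 := τm + 1) hC (by linarith) ?_ ?_ ?_ ?_
  · filter_upwards [eventually_ge_atTop τm] with t ht
    have : Vi ≤ VV y k τ x xh univ univ t := by
      apply le_of_tendsto hlim
      filter_upwards [eventually_ge_atTop t] with s hs
      exact S.V_anti hh h (Set.mem_Ici.2 ht) (Set.mem_Ici.2 (ht.trans hs)) hs
    linarith
  · filter_upwards [hY1] with t h1
    have := hmp t
    linarith
  · filter_upwards [hQ, hY2] with t h1 h2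
    have e : mm x z t = ∑ j ∈ W, x t j := rfl
    rw [e] at h1
    have := hsplit t
    nlinarith
  · intro σ hσ
    obtain ⟨K, hK0, hK⟩ := S.Win_le_mul
    set ε := Real.log σ / (τm + 1) with hε
    have hε0 : 0 < ε := div_pos (Real.log_pos hσ) (by linarith)
    set B : ℝ := ∑ j ∈ Wᶜ, ∑ i ∈ T, k i * (K * ((y' i j : ℝ) + (y i j : ℝ))) with hB
    have hBt : ∀ j, 0 ≤ ∑ i ∈ T, k i * (K * ((y' i j : ℝ) + (y i j : ℝ))) := fun j =>
      Finset.sum_nonneg fun i _ => mul_nonneg (S.hk i).le (by positivity)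
    have hB0 : 0 ≤ B := Finset.sum_nonneg fun j _ => hBt j
    have hδ : 0 < ε / (B + 1) := by positivity
    have hw : ∀ᶠ t in atTop, ∀ j ∈ Wᶜ, |ww xh (x t) j| ≤ ε / (B+1) := by
      rw [Filter.eventually_all_finset]
      intro j hj
      have l1 : Tendsto (fun t => x t j) atTop (𝓝 (xh j)) := by
        rw [hoff j (Finset.mem_compl.1 hj)]; exact tendsto_pi_nhds.1 hx j
      have l2 : Tendsto (fun t => |ww xh (x t) j|) atTop (𝓝 0) := by
        have := (((Real.continuousAt_log (hh j).ne').tendsto.comp l1).sub_const (Real.log (xh j))).abs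
        rw [sub_self, abs_zero] at this
        exact this
      exact l2.eventually_le_const hδ
    obtain ⟨A, hA⟩ := eventually_atTop.1 (hw.and (hY1.and ((eventually_ge_atTop (2*τm)).and
      (eventually_gt_atTop τm))))
    have hder : ∀ t > A, HasDerivAt (fun t => Vi - VV y k τ x xh W T t) _ t := fun t ht =>
      (S.VV_der hh W T (fun i hi j hj => ⟨not_TT hi j hj, by
        by_contra h0; exact hi ((hT' i).2 ⟨j, hj, h0⟩)⟩)
        (fun t => h.hBW hh W T (fun i => mem_TT) hT' (x t)) t (hA t ht.le).2.2.2).const_sub Vi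
    filter_upwards [eventually_ge_atTop A] with t ht
    have hg := gron_Ici (C := ε) (continuous_const.sub (S.VV_cont W T)) hder ?_ ht
      (show t ≤ t + (τm + 1) by linarith)
    · have e : Real.exp (ε * (t + (τm + 1) - t)) = σ := by
        rw [hε]
        have : Real.log σ / (τm + 1) * (t + (τm + 1) - t) = Real.log σ := by
          have : τm + 1 ≠ 0 := by linarith
          rw [add_sub_cancel_left, div_mul_cancel₀ _ this]
        rw [this, Real.exp_log (by linarith)]
      rw [e] at hg
      exact hg
    · intro s hs
      obtain ⟨c1, c2, c3, c4⟩ := hA s (le_of_lt hs)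
      have d1 : 0 ≤ ∑ i ∈ T, k i * FF (mono (x (s - τ i)) (y i)) (BB xh (y i) (y' i) (x s)) :=
        Finset.sum_nonneg fun i _ => S.DD_term_nonneg hh s i
      have hm := hmp s
      set m := ∑ j ∈ W, x s j with hmdef
      have d2 : |∑ j ∈ Wᶜ, ww xh (x s) j * ∑ i ∈ T, k i * (mono (x (s - τ i)) (y i) * (y' i j : ℝ)
          - mono (x s) (y i) * (y i j : ℝ))| ≤ ε / (B+1) * (B * m) := by
        refine (Finset.abs_sum_le_sum_abs _ _).trans ?_
        rw [hB, Finset.sum_mul, Finset.mul_sum]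
        apply Finset.sum_le_sum
        intro j hj
        rw [abs_mul]
        apply mul_le_mul (c1 j hj) _ (abs_nonneg _) hδ.le
        refine (Finset.abs_sum_le_sum_abs _ _).trans ?_
        rw [Finset.sum_mul]
        apply Finset.sum_le_sum
        intro i hi
        obtain ⟨j', hj', hij⟩ := hT1 i hi
        have q1 := (hK i j' s c3 hij).1
        have q2 : x s j' ≤ m := Finset.single_le_sum (f := fun j => x s j)
          (fun j _ => (S.pos s j).le) hj'
        have q3 : K * x s j' ≤ K * m := mul_le_mul_of_nonneg_left q2 hK0
        have q4 := (q1 (s - τ i) ⟨le_rfl, by linarith [S.hτ i]⟩).trans q3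
        have q5 := (q1 s ⟨by linarith [S.hτ i], le_rfl⟩).trans q3
        have p4 := S.gpos (y i) (s - τ i)
        have p5 := S.gpos (y i) s
        rw [abs_mul, abs_of_pos (S.hk i), mul_assoc]
        apply mul_le_mul_of_nonneg_left _ (S.hk i).le
        have y1 : (0:ℝ) ≤ (y' i j : ℝ) := Nat.cast_nonneg _
        have y2 : (0:ℝ) ≤ (y i j : ℝ) := Nat.cast_nonneg _
        have r1 := mul_le_mul_of_nonneg_right q4 y1
        have r2 := mul_le_mul_of_nonneg_right q5 y2
        have r3 := mul_nonneg p4.le y1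
        have r4 := mul_nonneg p5.le y2
        rw [abs_le]
        constructor <;> nlinarith
      have d3 : ε / (B+1) * (B * m) ≤ ε * m := by
        rw [div_mul_eq_mul_div, div_le_iff₀ (by linarith)]
        nlinarith [mul_pos hε0 hm]
      have d4 := (abs_le.1 (d2.trans d3)).1
      have d5 : ε * m ≤ ε * (Vi - VV y k τ x xh W T s) :=
        mul_le_mul_of_nonneg_left (by linarith) hε0.le
      simp only [neg_mul]
      change -(ε * (Vi - VV y k τ x xh W T s)) ≤ _
      linarith

lemma Sys.persist (S : Sys y y' k τ τm M x) {xb : Fin n → ℝ} (hb : ∀ j, 0 < xb j)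
    (h : CBf y y' k xb) (hcomb : IsCombination y y' Sp grp)
    (h2d : ∀ p, Module.finrank ℝ (stoichOn y y' (Rgrp grp p)) = 2)
    (hcase : ∀ W : Set (Fin n), Semilocking y y' Finset.univ W → W ≠ Set.univ →
      W ∩ interSpecies Sp = ∅) (j : Fin n) :
    ∃ c > 0, ∀ᶠ t in atTop, c ≤ x t j := by
  obtain ⟨z, hz, hcard, ε1, hε1, hsel⟩ := S.select (y := y) (y' := y') xb
  by_cases hne : (ZZ z).Nonempty
  · exfalso
    have hU := S.not_origin hb h hz hne hcard
    have hT' := S.mem_TT' hb h hz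
    have hsl : Semilocking y y' Finset.univ (ZZ z : Set (Fin n)) := by
      refine ⟨by simpa using hne, fun i _ hi => ?_⟩
      have := mem_TT.1 ((hT' i).2 (by simpa using hi))
      simpa using this
    have hc := hcase _ hsl (by simpa using hU)
    have hWc : ∀ j ∈ ZZ z, ∀ p q, j ∈ Sp p → j ∈ Sp q → p = q := by
      intro j hj p q hp hq
      by_contra hpq
      have : j ∈ (ZZ z : Set (Fin n)) ∩ interSpecies Sp := ⟨by simpa using hj, p, q, hpq, hp, hq⟩
      rw [hc] at this
      exact this
    have hx := S.trap hb h hcomb.1 hcomb.2 h2d hz hWc hε1 hsel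
    have hvt : ∀ p, ∀ j ∈ ZZ z, j ∈ Sp p →
        VertexType (stoichOn y y' (Rgrp grp p)) (ZZ z : Set (Fin n)) := by
      intro p j hj hjp
      by_contra hv
      exact S.no_edge hb h hcomb.2 hx hWc (h2d p) hv hj hjp
    have hdual := Sys.dual hcomb.1 hcomb.2 hWc hvt
    obtain ⟨xh, hh, hcb, hoff⟩ := S.exists_xh hb h hz hdual
    exact S.contra hh hcb hx (S.Om_nonneg hz) hoff hT' hdual hne
  · refine S.interior hb h hz (fun j => ?_) j
    refine lt_of_le_of_ne (S.Om_nonneg hz j) fun h0 => hne ⟨j, mem_ZZ.2 h0.symm⟩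

end Fin2

theorem stmt9 {n r l : ℕ} (y y' : Fin r → Fin n → ℕ)
    (k τ : Fin r → ℝ) (τm : ℝ)
    (hk : ∀ i, 0 < k i) (hτ : ∀ i, 0 ≤ τ i) (hτm : ∀ i, τ i ≤ τm) (hτm0 : 0 ≤ τm)
    (hCB : ComplexBalancedOn y y' k Finset.univ)
    (Sp : Fin l → Set (Fin n)) (grp : Fin r → Fin l)
    (hcomb : IsCombination y y' Sp grp)
    (hsubCB : ∀ p, ComplexBalancedOn y y' k (Rgrp grp p))
    (h2d : ∀ p, Module.finrank ℝ (stoichOn y y' (Rgrp grp p)) = 2)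
    (hcase : ∀ W : Set (Fin n), Semilocking y y' Finset.univ W → W ≠ Set.univ →
      W ∩ interSpecies Sp = ∅) :
    Persistent y y' k τ τm := by
  intro x hx hp hb j
  obtain ⟨M, S⟩ := Sys.of_solution hk hτ hτm hτm0 hx hp hb
  obtain ⟨xb, hxb, hcb⟩ := hCB
  obtain ⟨c, hc, hev⟩ := S.persist hxb (CBf_of hcb) hcomb h2d hcase j
  have hev' : ∀ᶠ t in atTop, c ≤ x t j := by
    filter_upwards [hev, eventually_ge_atTop (0:ℝ)] with t h1 ht
    rwa [max_eq_left ht] at h1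
  obtain ⟨B, hB⟩ := hb
  have hbd : ∀ᶠ t in atTop, x t j ≤ B := by
    filter_upwards [eventually_ge_atTop (-τm)] with t ht
    exact (le_abs_self _).trans ((norm_le_pi_norm (x t) j).trans (hB t ht))
  refine lt_of_lt_of_le hc (le_liminf_of_le ?_ hev')
  exact (isBoundedUnder_of_eventually_le hbd).isCoboundedUnder_ge
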